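/- Fix an integer d ≥ 12. There exist constants C > 0 and Ω > 0 such that for every integer N ≥ 2, the number of polynomials p ∈ P_d(N) whose Galois group is neither the full symmetric group S_d nor the alternating group A_d — that is, for which it is not the case that p has d distinct complex roots and alternatingGroup (rootSet) ≤ (galActionHom).range — is at most C · N^{d-1} · (log N)^Ω. -/

import Mathlib

section
open Polynomial

namespace GC

/-- monic polynomials of degree `d` with bounded coefficients -/
noncomputable def box (d B : ℕ) : Finset ℤ[X] :=
  open Classical in
  (Fintype.piFinset fun _ : Fin d => Finset.Icc (-(B : ℤ)) B).image
    (fun c => X ^ d + ∑ i : Fin d, C (c i) * X ^ (i : ℕ))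

lemma aux_coeff {R : Type*} [CommRing R] {d : ℕ} (c : Fin d → R) (j : ℕ) :
    (∑ i : Fin d, C (c i) * X ^ (i : ℕ)).coeff j = if h : j < d then c ⟨j, h⟩ else 0 := by
  simp only [finsetSum_coeff, coeff_C_mul, coeff_X_pow, mul_ite, mul_one, mul_zero]
  split_ifs with h
  · rw [Finset.sum_eq_single ⟨j, h⟩]
    · simp
    · intro b _ hb
      rw [if_neg]; rintro rfl; exact hb rfl
    · simp
  · refine Finset.sum_eq_zero fun i _ => ?_
    rw [if_neg]; have := i.2; omega

lemma aux_degree {R : Type*} [CommRing R] {d : ℕ} (c : Fin d → R) :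
    (∑ i : Fin d, C (c i) * X ^ (i : ℕ) : R[X]).degree < (d : WithBot ℕ) := by
  rw [degree_lt_iff_coeff_zero]
  intro m hm
  rw [aux_coeff, dif_neg (by omega)]

lemma eq_aux {R : Type*} [CommRing R] {d : ℕ} {p : R[X]} (hp : p.Monic) (hd : p.natDegree = d) :
    p = X ^ d + ∑ i : Fin d, C (p.coeff i) * X ^ (i : ℕ) := by
  ext j
  rw [coeff_add, aux_coeff (fun i : Fin d => p.coeff i), coeff_X_pow]
  rcases lt_trichotomy j d with h | h | h
  · simp [h, h.ne]
  · subst h; subst hd; rw [coeff_natDegree, hp.leadingCoeff]; simp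
  · rw [coeff_eq_zero_of_natDegree_lt (by omega)]; simp [h.ne', not_lt.2 h.le]

lemma mem_box {d B : ℕ} {p : ℤ[X]} :
    p ∈ box d B ↔ p.Monic ∧ p.natDegree = d ∧ ∀ i < d, |p.coeff i| ≤ (B : ℤ) := by
  classical
  unfold box
  rw [Finset.mem_image]
  constructor
  · rintro ⟨c, hc, rfl⟩
    rw [Fintype.mem_piFinset] at hc
    refine ⟨monic_X_pow_add (aux_degree c), natDegree_eq_of_degree_eq_some
      (by rw [degree_add_eq_left_of_degree_lt] <;> rw [degree_X_pow]; exact aux_degree c), fun i hi => ?_⟩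
    rw [coeff_add, aux_coeff, coeff_X_pow, if_neg (by omega), dif_pos hi, zero_add, abs_le]
    exact Finset.mem_Icc.1 (hc _)
  · rintro ⟨h1, h2, h3⟩
    exact ⟨fun i => p.coeff i, Fintype.mem_piFinset.2 fun i => Finset.mem_Icc.2 (abs_le.1 (h3 i i.2)),
      (eq_aux h1 h2).symm⟩

lemma card_box_le (d B : ℕ) : (box d B).card ≤ (2 * B + 1) ^ d := by
  classical
  unfold box
  refine Finset.card_image_le.trans ?_
  rw [Fintype.card_piFinset]
  simp only [Int.card_Icc, Finset.prod_const, Finset.card_univ, Fintype.card_fin]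
  apply le_of_eq; congr 1; omega

/-- Mahler measure of an integer polynomial -/
noncomputable def mm (p : ℤ[X]) : ℝ := (p.map (Int.castRingHom ℂ)).mahlerMeasure

lemma mm_mul (p q : ℤ[X]) : mm (p * q) = mm p * mm q := by
  simp [mm, Polynomial.map_mul, mahlerMeasure_mul]

lemma one_le_mm {p : ℤ[X]} (hp : p.Monic) : 1 ≤ mm p :=
  one_le_mahlerMeasure_of_ne_zero hp.ne_zero

lemma mm_le {d N : ℕ} (hN : 1 ≤ N) {p : ℤ[X]} (hp : p ∈ box d N) : mm p ≤ (d + 1) * N := by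
  obtain ⟨h1, h2, h3⟩ := mem_box.1 hp
  refine (mahlerMeasure_le_sum_norm_coeff _).trans ?_
  rw [Polynomial.sum_over_range' _ (by simp) (d + 1)
    (Nat.lt_succ_of_le ((natDegree_map_le).trans h2.le))]
  have hN' : (1 : ℝ) ≤ N := by exact_mod_cast hN
  calc _ ≤ ∑ i ∈ Finset.range (d + 1), (N : ℝ) := by
        refine Finset.sum_le_sum fun i hi => ?_
        rw [coeff_map, eq_intCast, Complex.norm_intCast]
        rcases (Nat.lt_succ_iff.1 (Finset.mem_range.1 hi)).lt_or_eq with h | h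
        · exact_mod_cast h3 i h
        · have : p.coeff i = 1 := by rw [h, ← h2]; exact h1
          simpa [this] using hN'
    _ = _ := by simp

lemma mem_box_of_mm {d : ℕ} {B : ℕ} {p : ℤ[X]} (h1 : p.Monic) (h2 : p.natDegree = d)
    (h : mm p ≤ B) : p ∈ box d (2 ^ d * B) := by
  refine mem_box.2 ⟨h1, h2, fun i hi => ?_⟩
  have := norm_coeff_le_choose_mul_mahlerMeasure i (p.map (Int.castRingHom ℂ))
  rw [coeff_map, eq_intCast, Complex.norm_intCast,
    natDegree_map_eq_of_injective (Int.castRingHom ℂ).injective_int, h2] at this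
  have h3 : (d.choose i : ℝ) ≤ 2 ^ d := by exact_mod_cast Nat.choose_le_two_pow d i
  have h4 : |((p.coeff i : ℤ) : ℝ)| ≤ 2 ^ d * B :=
    this.trans (mul_le_mul h3 h (by exact mahlerMeasure_nonneg _) (by positivity))
  exact_mod_cast h4

lemma log_bound {X : ℝ} (hX : 2 ≤ X) : ((Nat.log 2 ⌊X⌋₊ + 1 : ℕ) : ℝ) ≤ 3 * Real.log X := by
  have hlog2 : 0.6931471803 < Real.log 2 := Real.log_two_gt_d9
  have hlogX : Real.log 2 ≤ Real.log X := Real.log_le_log (by norm_num) hX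
  have h1 : (2 : ℝ) ^ (Nat.log 2 ⌊X⌋₊) ≤ X := by
    have h0 : ⌊X⌋₊ ≠ 0 := by
      rw [← Nat.pos_iff_ne_zero]; exact Nat.floor_pos.2 (by linarith)
    have := Nat.pow_log_le_self 2 h0
    calc (2 : ℝ) ^ (Nat.log 2 ⌊X⌋₊) ≤ (⌊X⌋₊ : ℝ) := by exact_mod_cast this
      _ ≤ _ := Nat.floor_le (by linarith)
  have h2 := Real.log_le_log (by positivity) h1
  rw [Real.log_pow] at h2
  push_cast
  nlinarith

/-- dyadic level -/
noncomputable def dl (x : ℝ) : ℕ := Nat.log 2 ⌊x⌋₊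

lemma dl_le {x : ℝ} (hx : 1 ≤ x) : (2 : ℝ) ^ dl x ≤ x := by
  have h0 : ⌊x⌋₊ ≠ 0 := by
    rw [← Nat.pos_iff_ne_zero]; exact Nat.floor_pos.2 hx
  have := Nat.pow_log_le_self 2 h0
  calc (2 : ℝ) ^ dl x ≤ (⌊x⌋₊ : ℝ) := by exact_mod_cast this
    _ ≤ _ := Nat.floor_le (by linarith)

lemma lt_dl (x : ℝ) : x < 2 ^ (dl x + 1) := by
  have := Nat.lt_pow_succ_log_self (b := 2) one_lt_two ⌊x⌋₊
  have h2 : (⌊x⌋₊ : ℝ) + 1 ≤ 2 ^ (dl x + 1) := by exact_mod_cast this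
  exact (Nat.lt_floor_add_one _).trans_le h2

/-- reducible count -/
theorem red_count (d : ℕ) : ∃ C : ℝ, 0 < C ∧ ∀ N : ℕ, 2 ≤ N →
    ({p : ℤ[X] | p ∈ box d N ∧ ∃ g h : ℤ[X], g.Monic ∧ h.Monic ∧ 0 < g.natDegree ∧ 0 < h.natDegree ∧
      p = g * h}.ncard : ℝ) ≤ C * N ^ (d - 1) * Real.log ((d + 1) * N) ^ 2 := by
  classical
  refine ⟨d * (9 * (2 ^ (d + 3)) ^ d * (d + 1) ^ (d - 1)) + 1, by positivity, fun N hN => ?_⟩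
  set X : ℝ := (d + 1) * N with hX
  have hN' : (2 : ℝ) ≤ N := by exact_mod_cast hN
  have hX2 : 2 ≤ X := by
    have : (0 : ℝ) ≤ d := by positivity
    nlinarith
  let L := Nat.log 2 ⌊X⌋₊ + 1
  let A : Finset (ℕ × ℕ) := (Finset.range L ×ˢ Finset.range L).filter
    (fun a => (2 : ℝ) ^ (a.1 + a.2) ≤ X)
  let T : Finset ℤ[X] := (Finset.range d).biUnion fun k => if k = 0 then ∅ else A.biUnion fun a =>
    (box k (2 ^ k * 2 ^ (a.1 + 1)) ×ˢ box (d - k) (2 ^ (d - k) * 2 ^ (a.2 + 1))).image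
      (fun q => q.1 * q.2)
  have hsub : {p : ℤ[X] | p ∈ box d N ∧ ∃ g h : ℤ[X], g.Monic ∧ h.Monic ∧ 0 < g.natDegree ∧
      0 < h.natDegree ∧ p = g * h} ⊆ (T : Set ℤ[X]) := by
    rintro p ⟨hp, g, h, hg, hh, hg0, hh0, rfl⟩
    have hdeg : g.natDegree + h.natDegree = d := by
      rw [← hg.natDegree_mul hh]; exact (mem_box.1 hp).2.1
    have hm := mm_le (by omega) hp
    rw [mm_mul] at hm
    have g1 := one_le_mm hg
    have h1 := one_le_mm hh
    have hgX : mm g ≤ X := by nlinarith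
    have hhX : mm h ≤ X := by nlinarith
    refine Finset.mem_coe.2 (Finset.mem_biUnion.2 ⟨g.natDegree, Finset.mem_range.2 (by omega), ?_⟩)
    rw [if_neg (by omega)]
    refine Finset.mem_biUnion.2 ⟨(dl (mm g), dl (mm h)), Finset.mem_filter.2
      ⟨Finset.mem_product.2 ⟨Finset.mem_range.2 ?_, Finset.mem_range.2 ?_⟩, ?_⟩, ?_⟩
    · exact Nat.lt_succ_of_le (Nat.log_mono_right (b := 2) (Nat.floor_mono hgX))
    · exact Nat.lt_succ_of_le (Nat.log_mono_right (b := 2) (Nat.floor_mono hhX))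
    · simp only [pow_add]
      exact (mul_le_mul (dl_le g1) (dl_le h1) (by positivity) (by linarith)).trans hm
    · refine Finset.mem_image.2 ⟨(g, h), Finset.mem_product.2 ⟨?_, ?_⟩, rfl⟩
      · exact mem_box_of_mm hg rfl (by push_cast; exact (lt_dl _).le)
      · exact mem_box_of_mm hh (by simp only; omega) (by push_cast; exact (lt_dl _).le)
  have hT : (T.card : ℝ) ≤ d * (L ^ 2 * ((2 ^ (d + 3)) ^ d * X ^ (d - 1))) := by
    refine (Nat.cast_le.2 Finset.card_biUnion_le).trans ?_
    push_cast
    refine (Finset.sum_le_card_nsmul _ _ (L ^ 2 * ((2 ^ (d + 3)) ^ d * X ^ (d - 1))) ?_).trans ?_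
    swap
    · rw [Finset.card_range, nsmul_eq_mul]
    intro k hk
    rw [Finset.mem_range] at hk
    split_ifs with hk0
    · simp; positivity
    refine (Nat.cast_le.2 Finset.card_biUnion_le).trans ?_
    push_cast
    have hA : (A.card : ℝ) ≤ L ^ 2 := by
      have : A.card ≤ L ^ 2 := by
        refine (Finset.card_filter_le _ _).trans ?_
        simp [sq]
      exact_mod_cast this
    refine (Finset.sum_le_card_nsmul _ _ ((2 ^ (d + 3)) ^ d * X ^ (d - 1)) ?_).trans ?_
    swap
    · rw [nsmul_eq_mul]
      exact mul_le_mul_of_nonneg_right hA (by positivity)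
    rintro ⟨a, b⟩ hab
    have hab' := (Finset.mem_filter.1 hab).2
    simp only at hab' ⊢
    have hb1 : ∀ k a : ℕ, k ≤ d → (box k (2 ^ k * 2 ^ (a + 1))).card ≤ (2 ^ (d + 3)) ^ k * (2 ^ a) ^ k := by
      intro k a hk
      refine (card_box_le _ _).trans ?_
      rw [← mul_pow]
      refine Nat.pow_le_pow_left ?_ _
      have e1 : 2 ^ k ≤ 2 ^ d := Nat.pow_le_pow_right (by norm_num) hk
      have e2 : 1 ≤ 2 ^ a := Nat.one_le_two_pow
      have e3 : 1 ≤ 2 ^ d := Nat.one_le_two_pow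
      have e4 : 2 ^ k * 2 ^ a ≤ 2 ^ d * 2 ^ a := Nat.mul_le_mul_right _ e1
      rw [pow_succ, pow_add]
      nlinarith
    have e := Finset.card_image_le (f := fun q : ℤ[X] × ℤ[X] => q.1 * q.2) (s :=
      box k (2 ^ k * 2 ^ (a + 1)) ×ˢ box (d - k) (2 ^ (d - k) * 2 ^ (b + 1)))
    rw [Finset.card_product] at e
    have e' := e.trans (Nat.mul_le_mul (hb1 k a hk.le) (hb1 (d - k) b (by omega)))
    have e'' := (Nat.cast_le (α := ℝ)).2 e'
    refine e''.trans ?_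
    push_cast
    calc ((2 : ℝ) ^ (d + 3)) ^ k * (2 ^ a) ^ k * ((2 ^ (d + 3)) ^ (d - k) * (2 ^ b) ^ (d - k))
        = ((2 : ℝ) ^ (d + 3)) ^ (k + (d - k)) * ((2 ^ a) ^ k * (2 ^ b) ^ (d - k)) := by
          rw [pow_add]; ring
      _ ≤ ((2 : ℝ) ^ (d + 3)) ^ (k + (d - k)) * ((2 ^ a) ^ (d - 1) * (2 ^ b) ^ (d - 1)) := by
          gcongr
          · exact one_le_pow₀ (by norm_num)
          · omega
          · exact one_le_pow₀ (by norm_num)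
          · omega
      _ ≤ _ := by
          rw [← mul_pow, ← pow_add, show k + (d - k) = d by omega]
          gcongr
  have hL := log_bound hX2
  have h0 : (Set.ncard {p : ℤ[X] | p ∈ box d N ∧ ∃ g h : ℤ[X], g.Monic ∧ h.Monic ∧ 0 < g.natDegree ∧
      0 < h.natDegree ∧ p = g * h} : ℝ) ≤ T.card := by
    rw [← Set.ncard_coe_finset T]
    exact_mod_cast Set.ncard_le_ncard hsub (Finset.finite_toSet T)
  refine h0.trans (hT.trans ?_)
  have hL2 : (L : ℝ) ^ 2 ≤ (3 * Real.log X) ^ 2 := pow_le_pow_left₀ (by positivity) hL 2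
  calc (d : ℝ) * (L ^ 2 * ((2 ^ (d + 3)) ^ d * X ^ (d - 1)))
      ≤ d * ((3 * Real.log X) ^ 2 * ((2 ^ (d + 3)) ^ d * X ^ (d - 1))) := by gcongr
    _ = d * (9 * (2 ^ (d + 3)) ^ d * (d + 1) ^ (d - 1)) * N ^ (d - 1) * Real.log X ^ 2 := by
      rw [mul_pow (3 : ℝ), show X ^ (d - 1) = (d + 1) ^ (d - 1) * N ^ (d - 1) from mul_pow _ _ _]; ring
    _ ≤ _ := by
      gcongr
      linarith

end GC
end

section
open NumberField NumberField.InfinitePlace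

namespace HT

lemma prod_emb_eq {F : Type*} [Field F] [NumberField F] (x : F) :
    ∏ σ : F →+* ℂ, max 1 ‖σ x‖ = ∏ w : InfinitePlace F, (max 1 (w x)) ^ w.mult := by
  classical
  rw [← Finset.prod_fiberwise Finset.univ (fun σ : F →+* ℂ => InfinitePlace.mk σ)]
  refine Finset.prod_congr rfl fun w _ => ?_
  rw [← card_filter_mk_eq w, ← Finset.prod_const]
  refine Finset.prod_congr rfl fun σ hσ => ?_
  rw [← (Finset.mem_filter.1 hσ).2, InfinitePlace.apply]

lemma eq_of_lt_one {F : Type*} [Field F] [NumberField F] (x : 𝓞 F)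
    (h : ∀ w : InfinitePlace F, w (x : F) < 1) : x = 0 := by
  by_contra hx
  have w : InfinitePlace F := Classical.arbitrary _
  exact absurd (h w) (not_lt.2 (InfinitePlace.one_le_of_lt_one (w := w) hx (fun z _ => h z)))

noncomputable def cell {F : Type*} [Field F] [NumberField F] (x : 𝓞 F) (w : InfinitePlace F) : ℤ × ℤ :=
  (⌊2 * (w.embedding x).re⌋, ⌊2 * (w.embedding x).im⌋)

noncomputable def lev {F : Type*} [Field F] [NumberField F] (x : 𝓞 F) (w : InfinitePlace F) : ℕ :=
  Nat.log 2 ⌊max 1 (w (x : F))⌋₊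

lemma cell_inj {F : Type*} [Field F] [NumberField F] :
    Function.Injective (fun (x : 𝓞 F) => cell x) := by
  intro x y hxy
  rw [← sub_eq_zero]
  apply eq_of_lt_one
  intro w
  have h := congrFun hxy w
  simp only [cell, Prod.mk.injEq] at h
  have h1 := Int.abs_sub_lt_one_of_floor_eq_floor h.1
  have h2 := Int.abs_sub_lt_one_of_floor_eq_floor h.2
  rw [abs_lt] at h1 h2
  rw [← norm_embedding_eq]
  have h3 : ‖w.embedding ((x - y : 𝓞 F) : F)‖ ^ 2 < 1 := by
    rw [← Complex.normSq_eq_norm_sq, Complex.normSq_apply]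
    simp only [map_sub, Complex.sub_re, Complex.sub_im]
    nlinarith
  by_contra hcon
  push Not at hcon
  nlinarith

lemma lev_le {F : Type*} [Field F] [NumberField F] (x : 𝓞 F) (w : InfinitePlace F) :
    (2 : ℝ) ^ lev x w ≤ max 1 (w (x : F)) := by
  have h1 : 1 ≤ max 1 (w (x : F)) := le_max_left _ _
  have h0 : ⌊max 1 (w (x : F))⌋₊ ≠ 0 := by
    rw [← Nat.pos_iff_ne_zero]; exact Nat.floor_pos.2 h1
  have := Nat.pow_log_le_self 2 h0
  calc (2 : ℝ) ^ lev x w ≤ (⌊max 1 (w (x : F))⌋₊ : ℝ) := by exact_mod_cast this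
    _ ≤ _ := Nat.floor_le (by linarith)

lemma lt_lev {F : Type*} [Field F] [NumberField F] (x : 𝓞 F) (w : InfinitePlace F) :
    max 1 (w (x : F)) < 2 ^ (lev x w + 1) := by
  have := Nat.lt_pow_succ_log_self (b := 2) one_lt_two ⌊max 1 (w (x : F))⌋₊
  have h2 : (⌊max 1 (w (x : F))⌋₊ : ℝ) + 1 ≤ 2 ^ (lev x w + 1) := by
    exact_mod_cast this
  exact (Nat.lt_floor_add_one _).trans_le h2

noncomputable def cells {F : Type*} [Field F] [NumberField F] (w : InfinitePlace F) (a : ℕ) :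
    Finset (ℤ × ℤ) :=
  open Classical in
  if w.IsReal then Finset.Icc (-2 ^ (a + 2)) (2 ^ (a + 2)) ×ˢ {0}
  else Finset.Icc (-2 ^ (a + 2)) (2 ^ (a + 2)) ×ˢ Finset.Icc (-2 ^ (a + 2)) (2 ^ (a + 2))

lemma card_cells {F : Type*} [Field F] [NumberField F] (w : InfinitePlace F) (a : ℕ) :
    (cells w a).card ≤ (16 * 2 ^ a) ^ w.mult := by
  have h : (Finset.Icc (-2 ^ (a + 2) : ℤ) (2 ^ (a + 2))).card ≤ 16 * 2 ^ a := by
    rw [Int.card_Icc]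
    have : (1 : ℤ) ≤ 2 ^ a := one_le_pow₀ (by norm_num)
    rw [Int.toNat_le]
    push_cast
    rw [pow_add]
    linarith
  unfold cells InfinitePlace.mult
  split_ifs
  · simpa using h
  · rw [Finset.card_product, sq]
    exact Nat.mul_le_mul h h

lemma floor_mem {r B : ℝ} {n : ℕ} (h : |r| ≤ B) (hB : B ≤ 2 ^ n) :
    ⌊2 * r⌋ ∈ Finset.Icc (-2 ^ (n + 1) : ℤ) (2 ^ (n + 1)) := by
  rw [abs_le] at h
  rw [Finset.mem_Icc]
  constructor
  · rw [Int.le_floor]; push_cast; rw [pow_succ]; linarith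
  · have : (⌊2 * r⌋ : ℝ) ≤ 2 ^ (n + 1) := by
      refine (Int.floor_le _).trans ?_
      rw [pow_succ]; linarith
    exact_mod_cast this

lemma cell_mem {F : Type*} [Field F] [NumberField F] (x : 𝓞 F) (w : InfinitePlace F) :
    cell x w ∈ cells w (lev x w) := by
  have h1 : ‖w.embedding (x : F)‖ ≤ 2 ^ (lev x w + 1) := by
    rw [norm_embedding_eq]
    exact (le_max_right _ _).trans (lt_lev x w).le
  have hre := floor_mem ((Complex.abs_re_le_norm _).trans h1) le_rfl
  have him := floor_mem ((Complex.abs_im_le_norm _).trans h1) le_rfl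
  unfold cells cell
  split_ifs with hw
  · refine Finset.mem_product.2 ⟨hre, ?_⟩
    have : (w.embedding (x : F)).im = 0 := by
      rw [← embedding_of_isReal_apply hw]; exact Complex.ofReal_im _
    simp [this]
  · exact Finset.mem_product.2 ⟨hre, him⟩

theorem count {F : Type*} [Field F] [NumberField F] {m : ℕ} (hm : Module.finrank ℚ F = m)
    {X : ℝ} (hX : 2 ≤ X) :
    {x : 𝓞 F | ∏ σ : F →+* ℂ, max 1 ‖σ x‖ ≤ X}.Finite ∧
    ({x : 𝓞 F | ∏ σ : F →+* ℂ, max 1 ‖σ x‖ ≤ X}.ncard : ℝ) ≤ 48 ^ m * X * Real.log X ^ m := by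
  classical
  set S := {x : 𝓞 F | ∏ σ : F →+* ℂ, max 1 ‖σ x‖ ≤ X} with hS
  let L : ℕ := Nat.log 2 ⌊X⌋₊ + 1
  let A : Finset (InfinitePlace F → ℕ) :=
    (Fintype.piFinset fun _ => Finset.range L).filter (fun a => ∏ w : InfinitePlace F, ((2 : ℝ) ^ a w) ^ w.mult ≤ X)
  let I : Finset (InfinitePlace F → ℤ × ℤ) := A.biUnion fun a => Fintype.piFinset fun w => cells w (a w)
  have hmaps : Set.MapsTo (fun x : 𝓞 F => cell x) S (I : Set _) := by
    intro x hx
    have hx' : ∏ w : InfinitePlace F, (max 1 (w (x : F))) ^ w.mult ≤ X := by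
      rw [← prod_emb_eq]; exact hx
    rw [Finset.mem_coe, Finset.mem_biUnion]
    refine ⟨lev x, Finset.mem_filter.2 ⟨Fintype.mem_piFinset.2 fun w => ?_, ?_⟩,
      Fintype.mem_piFinset.2 fun w => cell_mem x w⟩
    · rw [Finset.mem_range, Nat.lt_succ_iff]
      refine Nat.log_mono_right (Nat.floor_mono ?_)
      refine le_trans ?_ hx'
      rw [← Finset.mul_prod_erase _ _ (Finset.mem_univ w)]
      have h1 : 1 ≤ max 1 (w (x : F)) := le_max_left _ _
      have h2 : max 1 (w (x : F)) ≤ max 1 (w (x : F)) ^ w.mult := le_self_pow₀ h1 mult_ne_zero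
      have h3 : 1 ≤ ∏ w ∈ Finset.univ.erase w, max 1 (w (x : F)) ^ w.mult :=
        (Finset.prod_const_one (M := ℝ)).symm.le.trans
          (Finset.prod_le_prod (fun _ _ => zero_le_one) (fun w _ => one_le_pow₀ (le_max_left _ _)))
      nlinarith
    · refine le_trans (Finset.prod_le_prod (fun _ _ => by positivity) fun w _ => ?_) hx'
      exact pow_le_pow_left₀ (by positivity) (lev_le x w) _
  have hfin : S.Finite := Set.Finite.of_injOn hmaps cell_inj.injOn (Finset.finite_toSet I)
  refine ⟨hfin, ?_⟩
  have hcard : S.ncard ≤ I.card := by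
    rw [← Set.ncard_coe_finset]
    exact Set.ncard_le_ncard_of_injOn _ hmaps cell_inj.injOn (Finset.finite_toSet I)
  have hI : (I.card : ℝ) ≤ A.card * (16 ^ m * X) := by
    refine (Nat.cast_le.2 (Finset.card_biUnion_le)).trans ?_
    push_cast
    rw [← nsmul_eq_mul]
    refine Finset.sum_le_card_nsmul _ _ _ fun a ha => ?_
    rw [Fintype.card_piFinset]
    push_cast
    refine (Finset.prod_le_prod (fun _ _ => by positivity)
      fun w _ => (Nat.cast_le (α := ℝ).2 (card_cells w (a w)))).trans ?_
    push_cast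
    simp_rw [mul_pow]
    rw [Finset.prod_mul_distrib, Finset.prod_pow_eq_pow_sum, sum_mult_eq, hm]
    exact mul_le_mul_of_nonneg_left (Finset.mem_filter.1 ha).2 (by positivity)
  have hlog2 : 0.6931471803 < Real.log 2 := Real.log_two_gt_d9
  have hlogX : Real.log 2 ≤ Real.log X := Real.log_le_log (by norm_num) hX
  have hL : (L : ℝ) ≤ 3 * Real.log X := by
    have h1 : (2 : ℝ) ^ (Nat.log 2 ⌊X⌋₊) ≤ X := by
      have h0 : ⌊X⌋₊ ≠ 0 := by
        rw [← Nat.pos_iff_ne_zero]; exact Nat.floor_pos.2 (by linarith)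
      have := Nat.pow_log_le_self 2 h0
      calc (2 : ℝ) ^ (Nat.log 2 ⌊X⌋₊) ≤ (⌊X⌋₊ : ℝ) := by exact_mod_cast this
        _ ≤ _ := Nat.floor_le (by linarith)
    have h2 := Real.log_le_log (by positivity) h1
    rw [Real.log_pow] at h2
    simp only [L]
    push_cast
    nlinarith
  have hA : (A.card : ℝ) ≤ (3 * Real.log X) ^ m := by
    have h1 : A.card ≤ L ^ Fintype.card (InfinitePlace F) := by
      refine (Finset.card_filter_le _ _).trans ?_
      rw [Fintype.card_piFinset]; simp
    have h2 : Fintype.card (InfinitePlace F) ≤ m := by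
      rw [← hm, ← sum_mult_eq (K := F), Fintype.card, Finset.card_eq_sum_ones]
      exact Finset.sum_le_sum fun w _ => mult_pos
    have h3 : A.card ≤ L ^ m := h1.trans (Nat.pow_le_pow_right (by omega) h2)
    calc (A.card : ℝ) ≤ (L : ℝ) ^ m := by exact_mod_cast h3
      _ ≤ _ := pow_le_pow_left₀ (by positivity) hL _
  calc (S.ncard : ℝ) ≤ I.card := by exact_mod_cast hcard
    _ ≤ _ := hI
    _ ≤ (3 * Real.log X) ^ m * (16 ^ m * X) := mul_le_mul_of_nonneg_right hA (by positivity)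
    _ = 48 ^ m * X * Real.log X ^ m := by
      rw [mul_pow, show (48 : ℝ) = 3 * 16 by norm_num, mul_pow]; ring

end HT
end

section
open Polynomial NumberField

namespace GC

lemma mahler_prod {ι : Type*} [Fintype ι] (P : ι → ℂ[X]) :
    (∏ i, P i).mahlerMeasure = ∏ i, (P i).mahlerMeasure := by
  have := prod_mahlerMeasure_eq_mahlerMeasure_prod (Finset.univ.val.map P)
  rw [Multiset.map_map] at this
  exact this

/-- `f` is the norm of a monic polynomial over a number field with primitive element of given
minimal polynomial -/
def NormData (q : ℚ[X]) (m e : ℕ) (J : Finset ℕ) (f : ℤ[X]) : Prop :=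
  ∃ (F : Type) (_ : Field F) (_ : NumberField F) (pb : PowerBasis ℚ F) (G : (𝓞 F)[X]),
    Module.finrank ℚ F = m ∧ minpoly ℚ pb.gen = q ∧ G.Monic ∧ G.natDegree = e ∧
    (∀ i < e, i ∉ J → ((G.coeff i : 𝓞 F) : F) = pb.gen) ∧
    f.map (Int.castRingHom ℂ) = ∏ σ : F →+* ℂ, G.map (σ.comp (algebraMap (𝓞 F) F))

lemma height_le {F : Type} [Field F] [NumberField F] {m e : ℕ} (hm : Module.finrank ℚ F = m)
    {G : (𝓞 F)[X]} (hG : G.Monic) (he : G.natDegree = e) {f : ℤ[X]}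
    (hf : f.map (Int.castRingHom ℂ) = ∏ σ : F →+* ℂ, G.map (σ.comp (algebraMap (𝓞 F) F))) (i : ℕ) :
    ∏ σ : F →+* ℂ, max 1 ‖σ (G.coeff i)‖ ≤ (2 ^ e) ^ m * mm f := by
  rw [mm, hf, mahler_prod]
  have hcard : Fintype.card (F →+* ℂ) = m := by rw [← hm]; exact Embeddings.card F ℂ
  rw [← hcard, ← Finset.card_univ, ← Finset.prod_const, ← Finset.prod_mul_distrib]
  refine Finset.prod_le_prod (fun _ _ => by positivity) fun σ _ => ?_
  have h1 : 1 ≤ (G.map (σ.comp (algebraMap (𝓞 F) F))).mahlerMeasure := by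
    apply one_le_mahlerMeasure_of_one_le_norm_leadingCoeff
    rw [(hG.map _).leadingCoeff]; simp
  have h2 : (1 : ℝ) ≤ 2 ^ e := one_le_pow₀ (by norm_num)
  refine max_le (by nlinarith) ?_
  have := norm_coeff_le_choose_mul_mahlerMeasure i (G.map (σ.comp (algebraMap (𝓞 F) F)))
  rw [coeff_map, hG.natDegree_map, he] at this
  refine this.trans ?_
  gcongr
  exact_mod_cast Nat.choose_le_two_pow e i

theorem fiber_count {d m e Y : ℕ} (hY : 2 ≤ Y) (J : Finset ℕ) (q : ℚ[X]) :
    ({f : ℤ[X] | f ∈ box d Y ∧ NormData q m e J f}.ncard : ℝ) ≤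
      (48 ^ m * ((2 ^ e) ^ m * ((d + 1) * Y)) * Real.log ((2 ^ e) ^ m * ((d + 1) * Y)) ^ m) ^ J.card := by
  classical
  set Z : ℝ := (2 ^ e) ^ m * ((d + 1) * Y) with hZ
  have hZ2 : 2 ≤ Z := by
    have h1 : (1 : ℝ) ≤ (2 ^ e) ^ m := one_le_pow₀ (one_le_pow₀ (by norm_num))
    have h2 : (2 : ℝ) ≤ Y := by exact_mod_cast hY
    have h3 : (0 : ℝ) ≤ d := by positivity
    have : (2 : ℝ) ≤ (d + 1) * Y := by nlinarith
    nlinarith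
  set S := {f : ℤ[X] | f ∈ box d Y ∧ NormData q m e J f} with hS
  rcases S.eq_empty_or_nonempty with h0 | ⟨f0, hf0, F, _, _, pb, G0, hm, hq, -, -, -, -⟩
  · rw [h0]; simp
    have := Real.log_nonneg (by linarith : 1 ≤ Z)
    positivity
  obtain ⟨hfin, hcount⟩ := HT.count hm hZ2
  set H := {x : 𝓞 F | ∏ σ : F →+* ℂ, max 1 ‖σ x‖ ≤ Z} with hH
  obtain ⟨γ, hγ⟩ : ∃ γ : 𝓞 F, ∀ y : 𝓞 F, (y : F) = pb.gen → γ = y := by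
    by_cases h : ∃ y : 𝓞 F, (y : F) = pb.gen
    · obtain ⟨y, hy⟩ := h
      exact ⟨y, fun z hz => RingOfIntegers.ext (hy.trans hz.symm)⟩
    · exact ⟨0, fun y hy => absurd ⟨y, hy⟩ h⟩
  let Pi : Finset (J → 𝓞 F) := Fintype.piFinset fun _ => hfin.toFinset
  let poly : (J → 𝓞 F) → (𝓞 F)[X] := fun c => X ^ e + ∑ i : Fin e, C (if h : (i : ℕ) ∈ J then c ⟨i, h⟩ else γ) * X ^ (i : ℕ)
  let nm : (J → 𝓞 F) → ℂ[X] := fun c => ∏ σ : F →+* ℂ, (poly c).map (σ.comp (algebraMap (𝓞 F) F))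
  have hinj : Function.Injective (fun f : ℤ[X] => f.map (Int.castRingHom ℂ)) :=
    map_injective _ (Int.castRingHom ℂ).injective_int
  have hmaps : Set.MapsTo (fun f : ℤ[X] => f.map (Int.castRingHom ℂ)) S ((Pi.image nm : Finset ℂ[X]) : Set ℂ[X]) := by
    rintro f ⟨hf, F', _, _, pb', G', hm', hq', hG', he', hJ', hf'⟩
    let ψ : F' ≃ₐ[ℚ] F := pb'.equivOfMinpoly pb (hq'.trans hq.symm)
    have hψ : ψ pb'.gen = pb.gen := pb'.equivOfMinpoly_gen pb _
    let ψi : 𝓞 F' ≃+* 𝓞 F := RingOfIntegers.mapRingEquiv ψ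
    have hψi : ∀ x : 𝓞 F', ((ψi x : 𝓞 F) : F) = ψ (x : F') := fun x => rfl
    let G : (𝓞 F)[X] := G'.map (ψi : 𝓞 F' →+* 𝓞 F)
    have hG : G.Monic := hG'.map _
    have he : G.natDegree = e := by rw [hG'.natDegree_map, he']
    have hfG : f.map (Int.castRingHom ℂ) = ∏ σ : F →+* ℂ, G.map (σ.comp (algebraMap (𝓞 F) F)) := by
      rw [hf']
      refine Fintype.prod_equiv (Equiv.mk (fun σ => σ.comp (ψ.symm : F →+* F'))
        (fun τ => τ.comp (ψ : F' →+* F)) ?_ ?_) _ _ ?_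
      · intro σ; ext x; simp
      · intro σ; ext x; simp
      · intro σ
        simp only [G, Equiv.coe_fn_mk, Polynomial.map_map]
        congr 1
        ext x
        change σ x = σ (ψ.symm ((ψi x : 𝓞 F) : F))
        rw [hψi, AlgEquiv.symm_apply_apply]
    have hGJ : ∀ i < e, i ∉ J → ((G.coeff i : 𝓞 F) : F) = pb.gen := by
      intro i hi hiJ
      rw [coeff_map]
      change ((ψi (G'.coeff i) : 𝓞 F) : F) = _
      rw [hψi, hJ' i hi hiJ, hψ]
    rw [Finset.mem_coe, Finset.mem_image]
    refine ⟨fun i => G.coeff i, Fintype.mem_piFinset.2 fun i => ?_, ?_⟩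
    · rw [Set.Finite.mem_toFinset]
      refine (height_le hm hG he hfG i).trans ?_
      exact mul_le_mul_of_nonneg_left (mm_le (by omega) hf) (by positivity)
    · have : poly (fun i => G.coeff i) = G := by
        refine Eq.trans ?_ (eq_aux hG he).symm
        simp only [poly]
        congr 1
        refine Finset.sum_congr rfl fun i _ => ?_
        congr 2
        split_ifs with h
        · rfl
        · exact hγ _ (hGJ i i.2 h)
      simp only [nm, this]
      exact hfG.symm
  have h1 : S.ncard ≤ (Pi.image nm).card := by
    rw [← Set.ncard_coe_finset]
    exact Set.ncard_le_ncard_of_injOn _ hmaps hinj.injOn (Finset.finite_toSet _)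
  have h2 : Pi.card = H.ncard ^ J.card := by
    rw [Fintype.card_piFinset, Finset.prod_const, Finset.card_univ, Fintype.card_coe,
      Set.ncard_eq_toFinset_card _ hfin]
  calc (S.ncard : ℝ) ≤ (H.ncard : ℝ) ^ J.card := by
        exact_mod_cast h1.trans (Finset.card_image_le.trans h2.le)
    _ ≤ _ := pow_le_pow_left₀ (by positivity) hcount _

end GC
end

section
open Polynomial NumberField IntermediateField

namespace GC

lemma map_castQ (f : ℤ[X]) : (f.map (Int.castRingHom ℚ)).map (algebraMap ℚ ℂ) = f.map (Int.castRingHom ℂ) := by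
  rw [Polynomial.map_map]; congr 1

lemma splC {K : Type*} [Field K] [NumberField K] (x : K) :
    ((minpoly ℚ x).map (algebraMap ℚ ℂ)).Splits := IsAlgClosed.splits _

lemma prod_eq {ι : Type*} [Fintype ι] {f : ℤ[X]} (hf : f.Monic)
    (hirr : Irreducible (f.map (Int.castRingHom ℚ))) {e : ℕ}
    (P : ι → ℂ[X]) (hP : ∀ i, (P i).Monic) (he : ∀ i, (P i).natDegree = e)
    (hdeg : Fintype.card ι * e ≤ f.natDegree)
    (hroot : ∀ β, (f.map (Int.castRingHom ℂ)).eval β = 0 → ∃ i, (P i).eval β = 0) :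
    f.map (Int.castRingHom ℂ) = ∏ i, P i := by
  have hsep : (f.map (Int.castRingHom ℂ)).Separable := by
    rw [← map_castQ]; exact hirr.separable.map
  have hfm : (f.map (Int.castRingHom ℂ)).Monic := hf.map _
  have hPm : (∏ i, P i).Monic := monic_prod_of_monic _ _ fun i _ => hP i
  symm
  apply eq_of_monic_of_dvd_of_natDegree_le hfm hPm
  · rw [Polynomial.Splits.dvd_iff_roots_le_roots (IsAlgClosed.splits _) hfm.ne_zero hPm.ne_zero,
      Multiset.le_iff_subset (nodup_roots hsep)]
    intro β hβ
    rw [mem_roots hfm.ne_zero] at hβ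
    obtain ⟨i, hi⟩ := hroot β hβ
    rw [mem_roots hPm.ne_zero, IsRoot.def, eval_prod]
    exact Finset.prod_eq_zero (Finset.mem_univ i) hi
  · rw [natDegree_prod_of_monic _ _ fun i _ => hP i, hf.natDegree_map]
    simp only [he, Finset.sum_const, Finset.card_univ, smul_eq_mul]
    exact hdeg

/-- complex roots are images under embeddings -/
lemma exists_emb {L : Type*} [Field L] [NumberField L] {α : L} {f : ℤ[X]}
    (hmin : minpoly ℚ α = f.map (Int.castRingHom ℚ)) {β : ℂ}
    (hβ : (f.map (Int.castRingHom ℂ)).eval β = 0) : ∃ φ : L →+* ℂ, φ α = β := by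
  have hβ2 : aeval β (minpoly ℚ α) = 0 := by
    rw [hmin, aeval_def, eval₂_eq_eval_map, map_castQ, hβ]
  obtain ⟨φ, hφ⟩ := IntermediateField.exists_algHom_of_splits_of_aeval
    (fun x : L => ⟨Algebra.IsIntegral.isIntegral x, splC x⟩) hβ2
  exact ⟨φ, hφ⟩

lemma gen_of_inj {F : Type*} [Field F] [NumberField F] {γ : F}
    (h : ∀ σ τ : F →+* ℂ, σ γ = τ γ → σ = τ) : ℚ⟮γ⟯ = ⊤ := by
  rw [Field.primitive_element_iff_algHom_eq_of_eval' ℚ ℂ splC]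
  intro σ τ hst
  have := h (σ : F →+* ℂ) (τ : F →+* ℂ) hst
  ext x
  exact RingHom.congr_fun this x

lemma exists_pb {F : Type*} [Field F] [NumberField F] {γ : F} (h : ℚ⟮γ⟯ = ⊤) :
    ∃ pb : PowerBasis ℚ F, pb.gen = γ := by
  have hint := Algebra.IsIntegral.isIntegral (R := ℚ) γ
  have : Algebra.adjoin ℚ {γ} = ⊤ := by
    rw [← IntermediateField.adjoin_simple_toSubalgebra_of_isAlgebraic hint.isAlgebraic, h]; rfl
  exact ⟨PowerBasis.ofAdjoinEqTop hint this, PowerBasis.ofAdjoinEqTop_gen hint this⟩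

/-- minimal polynomial of a generator -/
lemma minpoly_prod {F : Type*} [Field F] [NumberField F] {m : ℕ} (hm : Module.finrank ℚ F = m)
    {γ : 𝓞 F} (h : ℚ⟮(γ : F)⟯ = ⊤) :
    minpoly ℚ (γ : F) = (minpoly ℤ γ).map (Int.castRingHom ℚ) ∧ (minpoly ℤ γ).Monic ∧
    (minpoly ℤ γ).natDegree = m ∧
    (minpoly ℤ γ).map (Int.castRingHom ℂ) = ∏ σ : F →+* ℂ, (X - C (σ γ)) := by
  have hγ : IsIntegral ℤ γ := RingOfIntegers.isIntegral γ
  have h1 : minpoly ℚ (γ : F) = (minpoly ℤ γ).map (Int.castRingHom ℚ) :=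
    minpoly.isIntegrallyClosed_eq_field_fractions ℚ F hγ
  have h2 := minpoly.monic hγ
  have hint := Algebra.IsIntegral.isIntegral (R := ℚ) (γ : F)
  have h3 : (minpoly ℤ γ).natDegree = m := by
    rw [← h2.natDegree_map (Int.castRingHom ℚ), ← h1, ← hm,
      (Field.primitive_element_iff_minpoly_natDegree_eq ℚ (γ : F)).1 h]
  refine ⟨h1, h2, h3, prod_eq h2 (h1 ▸ minpoly.irreducible hint) (e := 1) _
    (fun σ => monic_X_sub_C _) (fun σ => natDegree_X_sub_C _) ?_ ?_⟩
  · rw [h3, mul_one, ← hm, Embeddings.card]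
  · intro β hβ
    obtain ⟨φ, hφ⟩ := exists_emb h1 hβ
    exact ⟨φ, by simp [hφ]⟩

lemma mm_minpoly {F : Type*} [Field F] [NumberField F] 
    {γ : 𝓞 F} (h : ℚ⟮(γ : F)⟯ = ⊤) :
    mm (minpoly ℤ γ) = ∏ σ : F →+* ℂ, max 1 ‖σ γ‖ := by
  rw [mm, (minpoly_prod rfl h).2.2.2, mahler_prod]
  simp

theorem norm_of_intermediate {L : Type} [Field L] [NumberField L] {α : L} {f : ℤ[X]} {d : ℕ} (hf : f.Monic)
    (hd : f.natDegree = d)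
    (hmin : minpoly ℚ α = f.map (Int.castRingHom ℚ)) {F : IntermediateField ℚ L}
    (hbot : F ≠ ⊥) (hlt : F < ℚ⟮α⟯) :
    ∃ m e t : ℕ, 2 ≤ m ∧ 2 ≤ e ∧ m * e = d ∧ t ≤ d ^ 3 ∧ ∃ Q : ℤ[X], Q.Monic ∧ Q.natDegree = m ∧
      mm Q ≤ 2 ^ d * mm (taylor (t : ℤ) f) ∧
      NormData (Q.map (Int.castRingHom ℚ)) m e ((Finset.range e).erase 0) (taylor (t : ℤ) f) := by
  classical
  have hαint : IsIntegral ℤ α := by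
    refine ⟨f, hf, ?_⟩
    have := minpoly.aeval ℚ α
    rw [hmin, aeval_def, eval₂_map] at this
    rw [← this]
    congr 1
    exact RingHom.ext_int _ _
  have hαF : IsIntegral (𝓞 F) α := hαint.tower_top
  have hint := Algebra.IsIntegral.isIntegral (R := ℚ) α
  have hintF := Algebra.IsIntegral.isIntegral (R := F) α
  let G := minpoly (𝓞 F) α
  have hGmap : minpoly F α = G.map (algebraMap (𝓞 F) F) :=
    minpoly.isIntegrallyClosed_eq_field_fractions' F hαF
  have hG : G.Monic := minpoly.monic hαF
  set m := Module.finrank ℚ F with hm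
  set e := G.natDegree with he
  have heF : e = Module.finrank F F⟮α⟯ := by
    rw [IntermediateField.adjoin.finrank hintF, hGmap, hG.natDegree_map]
  have hres : (F⟮α⟯).restrictScalars ℚ = ℚ⟮α⟯ := by
    apply le_antisymm
    · rw [← SetLike.coe_subset_coe]
      change ((F⟮α⟯ : IntermediateField F L) : Set L) ⊆ _
      have : F⟮α⟯ ≤ IntermediateField.extendScalars hlt.le := by
        rw [IntermediateField.adjoin_simple_le_iff, IntermediateField.mem_extendScalars]
        exact IntermediateField.mem_adjoin_simple_self ℚ α
      exact this
    · rw [IntermediateField.adjoin_simple_le_iff]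
      exact IntermediateField.mem_adjoin_simple_self F α
  have hdQ : Module.finrank ℚ ℚ⟮α⟯ = d := by
    rw [IntermediateField.adjoin.finrank hint, hmin, hf.natDegree_map, hd]
  have hme : m * e = d := by
    rw [← hdQ, ← hres, heF]
    exact Module.finrank_mul_finrank ℚ F F⟮α⟯
  have hd0 : 0 < d := by rw [← hdQ]; exact Module.finrank_pos
  have hm2 : 2 ≤ m := by
    have h1 : m ≠ 1 := fun h => hbot (IntermediateField.finrank_eq_one_iff.1 h)
    have h0 : 0 < m := Module.finrank_pos
    omega
  have he2 : 2 ≤ e := by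
    have h1 : e ≠ 1 := by
      intro h
      have : Module.finrank ℚ F = Module.finrank ℚ ℚ⟮α⟯ := by rw [hdQ, ← hme, h, mul_one]
      exact hlt.ne (IntermediateField.eq_of_le_of_finrank_eq hlt.le this)
    have h0 : 0 < e := Nat.pos_of_ne_zero (by rintro h; rw [h] at hme; omega)
    omega
  have hirr : Irreducible (f.map (Int.castRingHom ℚ)) := hmin ▸ minpoly.irreducible hint
  let P : (F →+* ℂ) → ℂ[X] := fun σ => G.map (σ.comp (algebraMap (𝓞 F) F))
  have hP : ∀ σ, (P σ).Monic := fun σ => hG.map _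
  have hPe : ∀ σ, (P σ).natDegree = e := fun σ => hG.natDegree_map _
  have hcard : Fintype.card (F →+* ℂ) = m := Embeddings.card F ℂ
  have hprod : f.map (Int.castRingHom ℂ) = ∏ σ, P σ := by
    refine prod_eq hf hirr P hP hPe (by rw [hcard, hme, hd]) ?_
    intro β hβ
    obtain ⟨φ, hφ⟩ := exists_emb hmin hβ
    refine ⟨φ.comp (algebraMap F L), ?_⟩
    simp only [P, RingHom.comp_assoc]
    have h := minpoly.aeval (𝓞 F) α
    rw [aeval_def] at h
    rw [eval_map, ← hφ]
    have := congrArg φ h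
    rw [map_zero, hom_eval₂] at this
    rw [← this]
    rfl
  have hsf : Squarefree (f.map (Int.castRingHom ℂ)) := by
    rw [← map_castQ]; exact (hirr.separable.map (f := algebraMap ℚ ℂ)).squarefree
  have hPinj : ∀ σ τ, P σ = P τ → σ = τ := by
    intro σ τ h
    by_contra hne
    have : P σ * P σ ∣ f.map (Int.castRingHom ℂ) := by
      rw [hprod]
      nth_rewrite 2 [h]
      rw [← Finset.prod_pair (f := P) hne]
      exact Finset.prod_dvd_prod_of_subset _ _ _ (Finset.subset_univ _)
    have h1 := natDegree_eq_zero_of_isUnit (hsf _ this)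
    rw [hPe] at h1; omega
  -- choose t
  let D : ℂ[X] := ∏ p ∈ Finset.univ.filter (fun p : (F →+* ℂ) × (F →+* ℂ) => p.1 ≠ p.2), (P p.1 - P p.2)
  have hD : D ≠ 0 := by
    rw [Finset.prod_ne_zero_iff]
    intro p hp h
    exact (Finset.mem_filter.1 hp).2 (hPinj _ _ (sub_eq_zero.1 h))
  have hDdeg : D.natDegree ≤ d ^ 3 := by
    refine (natDegree_prod_le _ _).trans ?_
    refine (Finset.sum_le_card_nsmul _ _ e ?_).trans ?_
    · intro p _
      refine (natDegree_sub_le _ _).trans ?_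
      rw [hPe, hPe, max_self]
    · rw [smul_eq_mul]
      have h1 : (Finset.univ.filter (fun p : (F →+* ℂ) × (F →+* ℂ) => p.1 ≠ p.2)).card ≤ m * m := by
        refine (Finset.card_filter_le _ _).trans ?_
        rw [Finset.card_univ, Fintype.card_prod, hcard]
      have h2 : m ≤ d := by rw [← hme]; exact Nat.le_mul_of_pos_right _ (by omega)
      have h3 : e ≤ d := by rw [← hme]; exact Nat.le_mul_of_pos_left _ (by omega)
      calc _ ≤ (m * m) * e := Nat.mul_le_mul_right _ h1
        _ ≤ (d * d) * d := Nat.mul_le_mul (Nat.mul_le_mul h2 h2) h3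
        _ = d ^ 3 := by ring
  obtain ⟨t, ht, htD⟩ : ∃ t : ℕ, t ≤ d ^ 3 ∧ D.eval (t : ℂ) ≠ 0 := by
    by_contra hcon
    push Not at hcon
    have hle : ((Finset.range (d ^ 3 + 1)).image (fun n : ℕ => (n : ℂ))).card ≤ D.natDegree := by
      apply Polynomial.card_le_degree_of_subset_roots
      intro z hz
      obtain ⟨n, hn, rfl⟩ := Finset.mem_image.1 (Finset.mem_def.2 hz)
      rw [mem_roots hD]
      exact hcon n (Nat.lt_succ_iff.1 (Finset.mem_range.1 hn))
    rw [Finset.card_image_of_injective _ Nat.cast_injective, Finset.card_range] at hle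
    omega
  let γ : 𝓞 F := G.eval (t : 𝓞 F)
  have hγσ : ∀ σ : F →+* ℂ, σ (γ : F) = (P σ).eval (t : ℂ) := by
    intro σ
    have := hom_eval₂ G (RingHom.id _) (σ.comp (algebraMap (𝓞 F) F)) (t : 𝓞 F)
    simp only [P, eval_map]
    rw [RingHom.comp_id, map_natCast] at this
    rw [← this]; rfl
  have hγ : ℚ⟮(γ : F)⟯ = ⊤ := by
    apply gen_of_inj
    intro σ τ h
    by_contra hne
    apply htD
    rw [eval_prod]
    refine Finset.prod_eq_zero (i := (σ, τ)) (Finset.mem_filter.2 ⟨Finset.mem_univ _, hne⟩) ?_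
    rw [eval_sub, ← hγσ, ← hγσ, h, sub_self]
  obtain ⟨h1, h2, h3, h4⟩ := minpoly_prod rfl hγ
  obtain ⟨pb, hpb⟩ := exists_pb hγ
  have hft : (taylor (t : ℤ) f).map (Int.castRingHom ℂ) =
      ∏ σ : F →+* ℂ, (taylor (t : 𝓞 F) G).map (σ.comp (algebraMap (𝓞 F) F)) := by
    simp only [map_taylor]
    rw [hprod]
    have := map_prod (taylorAlgHom (t : ℂ)) P Finset.univ
    simp only [map_intCast, map_natCast, Int.cast_natCast, coe_taylorAlgHom] at this ⊢
    exact this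
  have hGt : (taylor (t : 𝓞 F) G).Monic := by
    rw [Monic, leadingCoeff_taylor]; exact hG
  have hc0 : (taylor (t : 𝓞 F) G).coeff 0 = γ := taylor_coeff_zero _ _
  refine ⟨m, e, t, hm2, he2, hme, ht, minpoly ℤ γ, h2, h3, ?_, F, inferInstance, inferInstance, pb,
    taylor (t : 𝓞 F) G, rfl, by rw [hpb, h1], hGt, natDegree_taylor _ _, ?_, hft⟩
  · rw [mm_minpoly hγ]
    have := height_le rfl hGt (natDegree_taylor _ _) hft 0
    rw [hc0] at this
    refine this.trans (le_of_eq ?_)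
    rw [← pow_mul, ← hme, mul_comm m e]
  · intro i hi hiJ
    have : i = 0 := by
      by_contra h
      exact hiJ (Finset.mem_erase.2 ⟨h, Finset.mem_range.2 hi⟩)
    rw [this, hc0, hpb]

end GC
end

section
open Polynomial NumberField IntermediateField

namespace GC

/-- normalised logarithm, at least one for `N ≥ 2` -/
noncomputable def ll (N : ℕ) : ℝ := 2 * Real.log N

lemma one_le_ll {N : ℕ} (hN : 2 ≤ N) : 1 ≤ ll N := by
  have hlog2 : 0.6931471803 < Real.log 2 := Real.log_two_gt_d9
  have : Real.log 2 ≤ Real.log N := Real.log_le_log (by norm_num) (by exact_mod_cast hN)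
  unfold ll; linarith

lemma log_mul_le {c : ℝ} (hc : 1 ≤ c) {N : ℕ} (hN : 2 ≤ N) :
    Real.log (c * N) ≤ (Real.log c + 1) * ll N := by
  have h1 := one_le_ll hN
  have h2 := Real.log_nonneg hc
  have hN' : (0 : ℝ) < N := by exact_mod_cast (by omega : 0 < N)
  rw [Real.log_mul (by linarith) hN'.ne']
  have : Real.log N ≤ ll N := by unfold ll at *; linarith
  nlinarith

/-- negligible families of polynomials -/
def Small (d : ℕ) (P : ℕ → ℤ[X] → Prop) : Prop :=
  ∃ C : ℝ, 0 < C ∧ ∃ Ω : ℕ, ∀ N : ℕ, 2 ≤ N →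
    ({p : ℤ[X] | p ∈ box d N ∧ P N p}.ncard : ℝ) ≤ C * N ^ (d - 1) * ll N ^ Ω

lemma fin_box {d N : ℕ} (P : ℤ[X] → Prop) : {p : ℤ[X] | p ∈ box d N ∧ P p}.Finite :=
  (Finset.finite_toSet (box d N)).subset fun _ hp => hp.1

lemma Small.mono {d : ℕ} {P Q : ℕ → ℤ[X] → Prop} (hQ : Small d Q)
    (h : ∀ N, 2 ≤ N → ∀ p ∈ box d N, P N p → Q N p) : Small d P := by
  obtain ⟨C, hC, Ω, hΩ⟩ := hQ
  refine ⟨C, hC, Ω, fun N hN => le_trans ?_ (hΩ N hN)⟩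
  have : {p : ℤ[X] | p ∈ box d N ∧ P N p} ⊆ {p : ℤ[X] | p ∈ box d N ∧ Q N p} :=
    fun p hp => ⟨hp.1, h N hN p hp.1 hp.2⟩
  exact_mod_cast Set.ncard_le_ncard this (fin_box _)

lemma Small.or {d : ℕ} {P Q : ℕ → ℤ[X] → Prop} (hP : Small d P) (hQ : Small d Q) :
    Small d (fun N p => P N p ∨ Q N p) := by
  obtain ⟨C, hC, Ω, hΩ⟩ := hP
  obtain ⟨C', hC', Ω', hΩ'⟩ := hQ
  refine ⟨C + C', by positivity, Ω + Ω', fun N hN => ?_⟩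
  have h1 := one_le_ll hN
  have hu : {p : ℤ[X] | p ∈ box d N ∧ (P N p ∨ Q N p)} =
      {p : ℤ[X] | p ∈ box d N ∧ P N p} ∪ {p : ℤ[X] | p ∈ box d N ∧ Q N p} := by
    ext p; simp only [Set.mem_union, Set.mem_ofPred_eq]; tauto
  rw [hu]
  have := Set.ncard_union_le {p : ℤ[X] | p ∈ box d N ∧ P N p} {p : ℤ[X] | p ∈ box d N ∧ Q N p}
  calc _ ≤ _ := Nat.cast_le.2 this
    _ ≤ C * N ^ (d - 1) * ll N ^ Ω + C' * N ^ (d - 1) * ll N ^ Ω' := by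
      push_cast; exact add_le_add (hΩ N hN) (hΩ' N hN)
    _ ≤ C * N ^ (d - 1) * ll N ^ (Ω + Ω') + C' * N ^ (d - 1) * ll N ^ (Ω + Ω') := by
      gcongr <;> first | exact h1 | omega
    _ = _ := by ring

lemma ncard_le_of_cover {ι T : Type*} {s : Finset ι} {S : Set T} (A : ι → Set T) {B : ℝ}
    (hfin : ∀ i ∈ s, (A i).Finite) (hS : ∀ p ∈ S, ∃ i ∈ s, p ∈ A i)
    (hB : ∀ i ∈ s, ((A i).ncard : ℝ) ≤ B) : (S.ncard : ℝ) ≤ s.card * B := by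
  classical
  have h1 : S ⊆ ⋃ i ∈ s, A i := fun p hp => by
    obtain ⟨i, hi, h⟩ := hS p hp
    exact Set.mem_biUnion hi h
  have h2 : (⋃ i ∈ s, A i).Finite := s.finite_toSet.biUnion hfin
  have h3 := (Set.ncard_le_ncard h1 h2).trans (Finset.set_ncard_biUnion_le s A)
  calc (S.ncard : ℝ) ≤ ∑ i ∈ s, ((A i).ncard : ℝ) := by exact_mod_cast h3
    _ ≤ s.card • B := Finset.sum_le_card_nsmul _ _ _ hB
    _ = _ := nsmul_eq_mul _ _

lemma small_red (d : ℕ) : Small d (fun _ p => ¬ Irreducible p ∧ p ≠ 1) := by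
  obtain ⟨C, hC, h⟩ := red_count d
  refine ⟨C * (Real.log (d + 1) + 1) ^ 2, ?_, 2, fun N hN => ?_⟩
  · have := Real.log_nonneg (by linarith [Nat.cast_nonneg (α := ℝ) d] : (1 : ℝ) ≤ d + 1)
    positivity
  have hc : (1 : ℝ) ≤ d + 1 := by linarith [Nat.cast_nonneg (α := ℝ) d]
  have h1 := log_mul_le hc hN
  have hN' : (1 : ℝ) ≤ N := by exact_mod_cast (by omega : 1 ≤ N)
  have h0 : 0 ≤ Real.log ((d + 1) * N) := Real.log_nonneg (by nlinarith)
  calc _ ≤ _ := Nat.cast_le.2 (Set.ncard_le_ncard (t := {p : ℤ[X] | p ∈ box d N ∧ ∃ g h : ℤ[X],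
          g.Monic ∧ h.Monic ∧ 0 < g.natDegree ∧ 0 < h.natDegree ∧ p = g * h}) ?_ (fin_box _))
    _ ≤ _ := h N hN
    _ ≤ C * N ^ (d - 1) * ((Real.log (d + 1) + 1) * ll N) ^ 2 := by gcongr
    _ = _ := by ring
  rintro p ⟨hp, hirr, hp1⟩
  refine ⟨hp, ?_⟩
  have hm := (mem_box.1 hp).1
  rw [hm.irreducible_iff_natDegree' ] at hirr
  push Not at hirr
  obtain ⟨g, h, hg, hh, hgh, hdeg⟩ := hirr hp1
  rw [Finset.mem_Ioc] at hdeg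
  refine ⟨g, h, hg, hh, ?_, hdeg.1, hgh.symm⟩
  have := hg.natDegree_mul hh
  rw [hgh] at this
  have := hdeg.2
  omega

lemma taylor_mem {d N T t : ℕ} (hN : 1 ≤ N) (ht : t ≤ T) {f : ℤ[X]} (hf : f ∈ box d N) :
    taylor (t : ℤ) f ∈ box d ((d + 1) * 2 ^ d * (T + 1) ^ d * N) := by
  obtain ⟨h1, h2, h3⟩ := mem_box.1 hf
  refine mem_box.2 ⟨by rw [Monic, leadingCoeff_taylor]; exact h1, by rw [natDegree_taylor, h2], ?_⟩
  intro n hn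
  have h3' : ∀ i ≤ d, |f.coeff i| ≤ N := by
    intro i hi
    rcases hi.lt_or_eq with h | h
    · exact h3 i h
    · rw [h, ← h2, coeff_natDegree, h1.leadingCoeff, abs_one]; exact_mod_cast hN
  rw [taylor_coeff, hasseDeriv_apply, sum_over_range' _ (by simp) (d + 1) (by omega), eval_finsetSum]
  refine (Finset.abs_sum_le_sum_abs _ _).trans ?_
  refine (Finset.sum_le_card_nsmul _ _ ((2 ^ d * (T + 1) ^ d * N : ℕ) : ℤ) ?_).trans ?_
  · intro i hi
    rw [eval_monomial, abs_mul, abs_mul]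
    have hi' : i ≤ d := Nat.lt_succ_iff.1 (Finset.mem_range.1 hi)
    have e1 : |((i.choose n : ℕ) : ℤ)| ≤ 2 ^ d := by
      rw [Nat.abs_cast]
      exact_mod_cast (Nat.choose_le_two_pow i n).trans (Nat.pow_le_pow_right (by norm_num) hi')
    have e2 : |(t : ℤ) ^ (i - n)| ≤ (T + 1) ^ d := by
      rw [abs_pow, Nat.abs_cast]
      have : t ^ (i - n) ≤ (T + 1) ^ d :=
        (Nat.pow_le_pow_left (by omega : t ≤ T + 1) _).trans
          (Nat.pow_le_pow_right (by omega) (by omega))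
      exact_mod_cast this
    have e3 := h3' i hi'
    push_cast
    calc _ ≤ (2 : ℤ) ^ d * N * (T + 1) ^ d := by gcongr
      _ = _ := by ring
  · rw [Finset.card_range, nsmul_eq_mul]
    push_cast
    apply le_of_eq; ring

/-- the stem field has a proper intermediate field -/
def Imprim (f : ℤ[X]) : Prop :=
  ∃ (L : Type) (_ : Field L) (_ : NumberField L) (α : L) (F : IntermediateField ℚ L),
    minpoly ℚ α = f.map (Int.castRingHom ℚ) ∧ F ≠ ⊥ ∧ F < ℚ⟮α⟯

theorem small_imprim (d : ℕ) : Small d (fun _ p => Imprim p) := by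
  classical
  let c : ℕ := (d + 1) * 2 ^ d * (d ^ 3 + 1) ^ d
  have hc : 1 ≤ c := Nat.succ_le_of_lt (by positivity)
  let c2 : ℕ := 2 ^ d * ((d + 1) * c)
  have hc2 : 1 ≤ c2 := Nat.succ_le_of_lt (by positivity)
  let c3 : ℕ := 3 * (2 ^ d * c2)
  have hc3 : 1 ≤ c3 := Nat.succ_le_of_lt (by positivity)
  let K : ℝ := Real.log c2 + 1
  have hK : 1 ≤ K := by
    have := Real.log_nonneg (by exact_mod_cast hc2 : (1 : ℝ) ≤ c2)
    simp only [K]; linarith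
  refine ⟨(d ^ 3 + 1) * (d + 1) * (c3 ^ d * (48 ^ d * c2) ^ d * K ^ (d * d)), by positivity, d * d, fun N hN => ?_⟩
  have hl := one_le_ll hN
  have hN' : (1 : ℝ) ≤ N := by exact_mod_cast (by omega : 1 ≤ N)
  let Y := c * N
  have hY : 2 ≤ Y := by simp only [Y]; nlinarith
  let A : ℕ × ℕ → Set ℤ[X] := fun tm => {f | f ∈ box d N ∧ ∃ e, 2 ≤ tm.2 ∧ 2 ≤ e ∧ tm.2 * e = d ∧
    ∃ Q : ℤ[X], Q ∈ box tm.2 (2 ^ d * (c2 * N)) ∧ taylor (tm.1 : ℤ) f ∈ box d Y ∧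
      NormData (Q.map (Int.castRingHom ℚ)) tm.2 e ((Finset.range e).erase 0) (taylor (tm.1 : ℤ) f)}
  have key : ({p : ℤ[X] | p ∈ box d N ∧ Imprim p}.ncard : ℝ) ≤
      (Finset.range (d ^ 3 + 1) ×ˢ Finset.range (d + 1)).card *
        ((c3 ^ d * (48 ^ d * c2) ^ d * K ^ (d * d)) * N ^ (d - 1) * ll N ^ (d * d)) := by
    apply ncard_le_of_cover A
    · intro i _; exact fin_box _
    · rintro p ⟨hp, L, _, _, α, F, hmin, hb, hlt⟩
      obtain ⟨hp1, hp2, -⟩ := mem_box.1 hp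
      obtain ⟨m, e, t, hm, he, hme, ht, Q, hQ1, hQ2, hQ3, hQ4⟩ :=
        norm_of_intermediate hp1 hp2 hmin hb hlt
      have hmd : m ≤ d := by rw [← hme]; exact Nat.le_mul_of_pos_right _ (by omega)
      have htm : taylor (t : ℤ) p ∈ box d Y := taylor_mem (by omega) ht hp
      refine ⟨(t, m), Finset.mem_product.2 ⟨Finset.mem_range.2 (by omega), Finset.mem_range.2 (by omega)⟩,
        hp, e, hm, he, hme, Q, ?_, htm, hQ4⟩
      have hQm : mm Q ≤ ((c2 * N : ℕ) : ℝ) := by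
        refine hQ3.trans ?_
        have := mm_le (by omega) htm
        calc (2 : ℝ) ^ d * mm (taylor (t : ℤ) p) ≤ 2 ^ d * ((d + 1) * (Y : ℕ)) := by gcongr
          _ = _ := by simp only [c2, Y]; push_cast; ring
      have hb := mem_box_of_mm hQ1 hQ2 hQm
      rw [mem_box] at hb ⊢
      refine ⟨hb.1, hb.2.1, fun i hi => (hb.2.2 i hi).trans ?_⟩
      have : 2 ^ m * (c2 * N) ≤ 2 ^ d * (c2 * N) :=
        Nat.mul_le_mul_right _ (Nat.pow_le_pow_right (by norm_num) hmd)
      exact_mod_cast this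
    · rintro ⟨t, m⟩ -
      by_cases hcond : ∃ e, 2 ≤ m ∧ 2 ≤ e ∧ m * e = d
      swap
      · have : A (t, m) = ∅ := by
          rw [Set.eq_empty_iff_forall_notMem]
          rintro f ⟨-, e, h1, h2, h3, -⟩
          exact hcond ⟨e, h1, h2, h3⟩
        rw [this, Set.ncard_empty, Nat.cast_zero]
        have : (0 : ℝ) ≤ K := by linarith
        positivity
      obtain ⟨e, hm, he, hme⟩ := hcond
      have hmd : m ≤ d := by rw [← hme]; exact Nat.le_mul_of_pos_right _ (by omega)
      have hed : e ≤ d := by rw [← hme]; exact Nat.le_mul_of_pos_left _ (by omega)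
      let B : ℤ[X] → Set ℤ[X] := fun Q => {f | f ∈ box d N ∧ taylor (t : ℤ) f ∈
        {g : ℤ[X] | g ∈ box d Y ∧ NormData (Q.map (Int.castRingHom ℚ)) m e ((Finset.range e).erase 0) g}}
      have h1 : ((A (t, m)).ncard : ℝ) ≤ (box m (2 ^ d * (c2 * N))).card *
          (48 ^ m * (c2 * N) * (K * ll N) ^ m) ^ (e - 1) := by
        apply ncard_le_of_cover B
        · intro i _; exact fin_box _
        · rintro f ⟨hf, e', _, _, he', Q, hQ, h2, h3⟩
          have : e' = e := Nat.eq_of_mul_eq_mul_left (by omega : 0 < m) (he'.trans hme.symm)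
          subst this
          exact ⟨Q, hQ, hf, h2, h3⟩
        · intro Q _
          have h2 : (B Q).ncard ≤ {g : ℤ[X] | g ∈ box d Y ∧
              NormData (Q.map (Int.castRingHom ℚ)) m e ((Finset.range e).erase 0) g}.ncard :=
            Set.ncard_le_ncard_of_injOn (taylor (t : ℤ)) (fun f hf => hf.2)
              (taylor_injective _).injOn (fin_box _)
          refine (Nat.cast_le.2 h2).trans ((fiber_count hY _ _).trans ?_)
          have e1 : ((2 : ℝ) ^ e) ^ m * ((d + 1) * (Y : ℕ)) = c2 * N := by
            simp only [c2, Y]; rw [← pow_mul, mul_comm e m, hme]; push_cast; ring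
          rw [e1, Finset.card_erase_of_mem (Finset.mem_range.2 (by omega)), Finset.card_range]
          have e2 := log_mul_le (by exact_mod_cast hc2 : (1 : ℝ) ≤ c2) hN
          have e3 : 0 ≤ Real.log (c2 * N) := Real.log_nonneg (by
            have : (1 : ℝ) ≤ c2 := by exact_mod_cast hc2
            nlinarith)
          have e4 : Real.log (c2 * N) ^ m ≤ (K * ll N) ^ m := pow_le_pow_left₀ e3 e2 _
          refine pow_le_pow_left₀ (by positivity) ?_ _
          exact mul_le_mul_of_nonneg_left e4 (by positivity)
      refine h1.trans ?_
      have h2 : ((box m (2 ^ d * (c2 * N))).card : ℝ) ≤ c3 ^ d * N ^ m := by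
        have e1 : (box m (2 ^ d * (c2 * N))).card ≤ (c3 * N) ^ m := by
          refine (card_box_le _ _).trans (Nat.pow_le_pow_left ?_ _)
          have : 1 ≤ 2 ^ d * (c2 * N) := Nat.succ_le_of_lt (by positivity)
          calc _ ≤ 3 * (2 ^ d * (c2 * N)) := by omega
            _ = _ := by simp only [c3]; ring
        have e2 : (c3 * N) ^ m ≤ c3 ^ d * N ^ m := by
          rw [mul_pow]
          exact Nat.mul_le_mul_right _ (Nat.pow_le_pow_right hc3 hmd)
        exact_mod_cast e1.trans e2
      have hKl : 1 ≤ K * ll N := by nlinarith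
      have hc2' : (1 : ℝ) ≤ c2 := by exact_mod_cast hc2
      have h48 : (1 : ℝ) ≤ 48 ^ d := one_le_pow₀ (by norm_num)
      have h48c : (1 : ℝ) ≤ 48 ^ d * c2 := by nlinarith
      have h3 : (48 ^ m * (c2 * N) * (K * ll N) ^ m) ^ (e - 1) ≤
          (48 ^ d * c2) ^ d * N ^ (e - 1) * (K * ll N) ^ (d * d) := by
        calc (48 ^ m * (c2 * N) * (K * ll N) ^ m) ^ (e - 1)
            ≤ (48 ^ d * (c2 * N) * (K * ll N) ^ d) ^ (e - 1) := by
              gcongr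
              · norm_num
          _ = (48 ^ d * c2) ^ (e - 1) * N ^ (e - 1) * (K * ll N) ^ (d * (e - 1)) := by
            rw [mul_pow, ← pow_mul, ← mul_assoc, mul_pow]
          _ ≤ _ := by
            gcongr
            · omega
            · omega
      have hexp : m + (e - 1) ≤ d - 1 := by
        have : m + e ≤ m * e := by nlinarith
        omega
      calc _ ≤ (c3 ^ d * N ^ m) * ((48 ^ d * c2) ^ d * N ^ (e - 1) * (K * ll N) ^ (d * d)) := by
            gcongr
        _ = (c3 ^ d * (48 ^ d * c2) ^ d * K ^ (d * d)) * N ^ (m + (e - 1)) * ll N ^ (d * d) := by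
            rw [mul_pow K, pow_add]; ring
        _ ≤ _ := by gcongr
  refine key.trans (le_of_eq ?_)
  rw [Finset.card_product, Finset.card_range, Finset.card_range]
  push_cast; ring

end GC
end

section
open Equiv Equiv.Perm MulAction

namespace GT
set_option linter.unusedSectionVars false
variable {α : Type*} [Fintype α] [DecidableEq α]

def T (G : Subgroup (Perm α)) (a b c d : α) : Prop :=
  a ≠ b ∧ a ≠ c ∧ a ≠ d ∧ b ≠ c ∧ b ≠ d ∧ c ≠ d ∧ swap a b * swap c d ∈ G

variable {G : Subgroup (Perm α)}

lemma T.sw1 {a b c d : α} (h : T G a b c d) : T G b a c d := by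
  unfold T at *; rw [swap_comm b a]; grind
lemma T.sw2 {a b c d : α} (h : T G a b c d) : T G c d a b := by
  unfold T at *
  have : swap c d * swap a b = swap a b * swap c d := by
    ext x; simp only [Perm.mul_apply, swap_apply_def]; grind
  rw [this]; grind

lemma three (hG : IsPreprimitive G α) {a b c : α} (h1 : a ≠ b) (h2 : a ≠ c) (h3 : b ≠ c)
    (h : swap a b * swap a c ∈ G) : alternatingGroup α ≤ G :=
  alternatingGroup_le_of_isPreprimitive_of_isThreeCycle_mem hG
    (isThreeCycle_swap_mul_swap_same h1 h2 h3) h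

lemma L1 (hG : IsPreprimitive G α) {a b c d e f g : α} (h : T G a b c d) (h' : T G a e f g)
    (hb : b ≠ e ∧ b ≠ f ∧ b ≠ g) (hc : c ≠ e ∧ c ≠ f ∧ c ≠ g) (hd : d ≠ e ∧ d ≠ f ∧ d ≠ g) :
    alternatingGroup α ≤ G := by
  obtain ⟨a1, a2, a3, a4, a5, a6, a7⟩ := h
  obtain ⟨b1, b2, b3, b4, b5, b6, b7⟩ := h'
  have key : swap a e * swap a b =
      (swap a b * swap c d) * (swap a e * swap f g) * ((swap a b * swap c d) * (swap a e * swap f g)) := by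
    ext x; simp only [Perm.mul_apply, swap_apply_def]; grind
  refine three hG b1 a1 hb.1.symm (key ▸ ?_)
  exact G.mul_mem (G.mul_mem a7 b7) (G.mul_mem a7 b7)

lemma L3a (hG : IsPreprimitive G α) {a b c d e : α} (h : T G a b c d) (h' : T G a e c d) (hb : b ≠ e) :
    alternatingGroup α ≤ G := by
  obtain ⟨a1, a2, a3, a4, a5, a6, a7⟩ := h
  obtain ⟨b1, b2, b3, b4, b5, b6, b7⟩ := h'
  have key : swap a b * swap a e =
      (swap a b * swap c d) * (swap a e * swap c d) := by
    ext x; simp only [Perm.mul_apply, swap_apply_def]; grind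
  exact three hG a1 b1 hb (key ▸ G.mul_mem a7 b7)

lemma Lshare {a b c d e f : α} (h : T G a b c d) (h' : T G a b e f) (hc : c ≠ e ∧ c ≠ f)
   (hd : d ≠ e ∧ d ≠ f) : T G c d e f := by
  obtain ⟨a1, a2, a3, a4, a5, a6, a7⟩ := h
  obtain ⟨b1, b2, b3, b4, b5, b6, b7⟩ := h'
  have key : swap c d * swap e f =
      (swap a b * swap c d) * (swap a b * swap e f) := by
    ext x; simp only [Perm.mul_apply, swap_apply_def]; grind
  exact ⟨a6, hc.1, hc.2, hd.1, hd.2, b6, key ▸ G.mul_mem a7 b7⟩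

lemma Lconj {g : Perm α} (hg : g ∈ G) {a b c d : α} (h : T G a b c d) :
    T G (g a) (g b) (g c) (g d) := by
  obtain ⟨a1, a2, a3, a4, a5, a6, a7⟩ := h
  have key : swap (g a) (g b) * swap (g c) (g d) = g * (swap a b * swap c d) * g⁻¹ := by
    have h1 : ∀ x y : α, swap (g x) (g y) = g * swap x y * g⁻¹ := fun x y => by
      exact Equiv.swap_apply_apply g x y
    rw [h1, h1]; group
  refine ⟨?_, ?_, ?_, ?_, ?_, ?_, key ▸ G.mul_mem (G.mul_mem hg a7) (G.inv_mem hg)⟩ <;>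
   simpa using ‹_›

lemma two_of_trans (hG : IsPreprimitive G α) (hc : 12 ≤ Fintype.card α) (Δ : Finset α)
    (hΔ : Δ.card ≤ 9) (h2 : 2 ≤ Δ.card)
    {a : α} (h : ∀ x ∈ Δ, ∃ g ∈ G, (∀ z, z ∉ Δ → g z = z) ∧ g a = x) :
    IsMultiplyPretransitive G α 2 := by
  have hn : Set.ncard ((Δ : Set α)ᶜ) = (Fintype.card α - Δ.card - 1) + 1 := by
    have := Set.ncard_add_ncard_compl (Δ : Set α)
    rw [Set.ncard_coe_finset, Nat.card_eq_fintype_card] at this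
    omega
  refine hG.is_two_pretransitive hn (by rw [Nat.card_eq_fintype_card]; omega) ?_
  have h' : ∀ x y : α, x ∈ Δ → y ∈ Δ → ∃ g ∈ G, (∀ z, z ∉ Δ → g z = z) ∧ g x = y := by
    intro x y hx hy
    obtain ⟨g, hg, hg1, hg2⟩ := h x hx
    obtain ⟨k, hk, hk1, hk2⟩ := h y hy
    refine ⟨k * g⁻¹, G.mul_mem hk (G.inv_mem hg), fun z hz => ?_, ?_⟩
    · rw [Perm.mul_apply, Perm.inv_eq_iff_eq.mpr (hg1 z hz).symm, hk1 z hz]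
    · rw [Perm.mul_apply, Perm.inv_eq_iff_eq.mpr hg2.symm, hk2]
  rw [isPretransitive_iff]
  rintro ⟨x, hx⟩ ⟨y, hy⟩
  rw [SubMulAction.mem_ofFixingSubgroup_iff] at hx hy
  simp only [Set.mem_compl_iff, Finset.mem_coe, not_not] at hx hy
  obtain ⟨g, hg, hg1, hg2⟩ := h' x y hx hy
  refine ⟨⟨⟨g, hg⟩, ?_⟩, ?_⟩
  · rw [mem_fixingSubgroup_iff]
    intro z hz
    exact hg1 z (by simpa using hz)
  · exact Subtype.ext hg2

lemma done_of_two (hG : IsPreprimitive G α) (hc : 12 ≤ Fintype.card α)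
    (h2 : IsMultiplyPretransitive G α 2) {a b c d : α} (h : T G a b c d) :
    alternatingGroup α ≤ G := by
  classical
  rw [is_two_pretransitive_iff] at h2
  let S : Finset (Perm α) := Finset.univ.filter (fun g => g ∈ G ∧ g a = a)
  let Sx : α → α → Finset (Perm α) := fun x y => S.filter (fun g => g x = y)
  have e1 : ∀ x y y', x ≠ a → y ≠ a → y' ≠ a → (Sx x y).card ≤ (Sx x y').card := by
    intro x y y' hx hy hy'
    obtain ⟨⟨k, hk⟩, hk1, hk2⟩ := h2 (a := a) (b := y) (c := a) (d := y') hy.symm hy'.symm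
    refine Finset.card_le_card_of_injOn (fun g => k * g) ?_ (fun _ _ _ _ h => mul_left_cancel h)
    intro g hg
    simp only [Sx, S, Finset.coe_filter, Finset.mem_filter, Finset.mem_univ, true_and, Set.mem_ofPred_eq] at hg ⊢
    refine ⟨⟨G.mul_mem hk hg.1.1, ?_⟩, ?_⟩
    · rw [Perm.mul_apply, hg.1.2]; exact hk1
    · rw [Perm.mul_apply, hg.2]; exact hk2
  have e2 : ∀ x y, x ≠ a → y ≠ a → (Fintype.card α - 1) * (Sx x y).card ≤ S.card := by
    intro x y hx hy
    have : (Finset.univ.erase a).card = Fintype.card α - 1 := by simp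
    rw [← this, ← smul_eq_mul]
    refine (Finset.card_nsmul_le_sum _ (fun y' => (Sx x y').card) _ ?_).trans ?_
    · intro y' hy'
      exact e1 x y y' hx hy (Finset.ne_of_mem_erase hy')
    · rw [← Finset.card_biUnion]
      · exact Finset.card_le_card (Finset.biUnion_subset.2 fun _ _ => Finset.filter_subset _ _)
      · intro u _ v _ huv
        rw [Function.onFun, Finset.disjoint_left]
        intro g hg hg'
        simp only [Sx, Finset.mem_filter] at hg hg'
        exact huv (hg.2.symm.trans hg'.2)
  have hS : 0 < S.card := Finset.card_pos.2 ⟨1, by simp [S, G.one_mem]⟩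
  by_contra hcon
  obtain ⟨a1, a2, a3, a4, a5, a6, a7⟩ := id h
  let U : Finset (α × α) := ({b, c, d} : Finset α) ×ˢ ({b, c, d} : Finset α)
  have hsub : S ⊆ U.biUnion (fun p => Sx p.1 p.2) := by
    intro g hg
    by_contra hg'
    apply hcon
    have hgG : g ∈ G ∧ g a = a := by simpa [S] using hg
    have hno : ∀ x ∈ ({b, c, d} : Finset α), ∀ y ∈ ({b, c, d} : Finset α), g x ≠ y := by
      intro x hx y hy hxy
      apply hg'
      rw [Finset.mem_biUnion]
      exact ⟨(x, y), Finset.mem_product.2 ⟨hx, hy⟩, Finset.mem_filter.2 ⟨hg, hxy⟩⟩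
    have := Lconj hgG.1 h
    rw [hgG.2] at this
    simp only [Finset.mem_insert, Finset.mem_singleton, forall_eq_or_imp, forall_eq] at hno
    refine L1 hG h this ?_ ?_ ?_ <;> grind
  have h9 : U.card ≤ 9 := by
    rw [Finset.card_product]
    have : ({b, c, d} : Finset α).card ≤ 3 := Finset.card_le_three
    nlinarith
  have hle : ∀ p ∈ U, 11 * (Sx p.1 p.2).card ≤ S.card := by
    intro p hp
    have hp' := Finset.mem_product.1 hp
    simp only [Finset.mem_insert, Finset.mem_singleton] at hp'
    refine le_trans (Nat.mul_le_mul_right _ ?_) (e2 p.1 p.2 (by grind) (by grind))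
    omega
  have h1 : 11 * S.card ≤ 9 * S.card := by
    calc 11 * S.card ≤ 11 * ∑ p ∈ U, (Sx p.1 p.2).card :=
          Nat.mul_le_mul_left _ ((Finset.card_le_card hsub).trans Finset.card_biUnion_le)
      _ = ∑ p ∈ U, 11 * (Sx p.1 p.2).card := Finset.mul_sum _ _ _
      _ ≤ ∑ p ∈ U, S.card := Finset.sum_le_sum hle
      _ = U.card * S.card := by simp
      _ ≤ 9 * S.card := Nat.mul_le_mul_right _ h9
  omega

lemma L2 (hG : IsPreprimitive G α) (hcard : 12 ≤ Fintype.card α) {a b c d e f : α}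
    (h : T G a b c d) (h' : T G a c e f) (hb : b ≠ e ∧ b ≠ f) (hd : d ≠ e ∧ d ≠ f) :
    alternatingGroup α ≤ G := by
  obtain ⟨a1, a2, a3, a4, a5, a6, a7⟩ := id h
  obtain ⟨b1, b2, b3, b4, b5, b6, b7⟩ := id h'
  have m := G.mul_mem a7 b7
  have mm := G.mul_mem m m
  refine done_of_two hG hcard (two_of_trans hG hcard {a, b, c, d} ?_ ?_ (a := a) ?_) h
  · exact Finset.card_le_four.trans (by norm_num)
  · rw [Finset.card_insert_of_notMem (by grind), Finset.card_insert_of_notMem (by grind)]; omega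
  · intro x hx
    simp only [Finset.mem_insert, Finset.mem_singleton] at hx ⊢
    rcases hx with rfl | rfl | rfl | rfl
    · exact ⟨1, G.one_mem, by simp, by simp⟩
    · refine ⟨_, a7, fun z hz => ?_, ?_⟩ <;> simp only [Perm.mul_apply, swap_apply_def] <;> grind
    · refine ⟨_, mm, fun z hz => ?_, ?_⟩ <;> simp only [Perm.mul_apply, swap_apply_def] <;> grind
    · refine ⟨_, G.mul_mem a7 mm, fun z hz => ?_, ?_⟩ <;>
        simp only [Perm.mul_apply, swap_apply_def] <;> grind

lemma L3 (hG : IsPreprimitive G α) (hcard : 12 ≤ Fintype.card α) {a b c d e : α}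
    (h : T G a b c d) (h' : T G a c d e) (hb : b ≠ e) :
    alternatingGroup α ≤ G := by
  obtain ⟨a1, a2, a3, a4, a5, a6, a7⟩ := id h
  obtain ⟨b1, b2, b3, b4, b5, b6, b7⟩ := id h'
  have m := G.mul_mem a7 b7
  have mm := G.mul_mem m m
  refine done_of_two hG hcard (two_of_trans hG hcard {a, b, c, d, e} ?_ ?_ (a := a) ?_) h
  · exact Finset.card_le_five.trans (by norm_num)
  · rw [Finset.card_insert_of_notMem (by grind), Finset.card_insert_of_notMem (by grind)]; omega
  · intro x hx
    simp only [Finset.mem_insert, Finset.mem_singleton] at hx ⊢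
    rcases hx with rfl | rfl | rfl | rfl | rfl
    · exact ⟨1, G.one_mem, by simp, by simp⟩
    · refine ⟨_, a7, fun z hz => ?_, ?_⟩ <;> simp only [Perm.mul_apply, swap_apply_def] <;> grind
    · refine ⟨_, b7, fun z hz => ?_, ?_⟩ <;> simp only [Perm.mul_apply, swap_apply_def] <;> grind
    · refine ⟨_, m, fun z hz => ?_, ?_⟩ <;> simp only [Perm.mul_apply, swap_apply_def] <;> grind
    · refine ⟨_, mm, fun z hz => ?_, ?_⟩ <;> simp only [Perm.mul_apply, swap_apply_def] <;> grind

lemma L4 (hG : IsPreprimitive G α) (hcard : 12 ≤ Fintype.card α) {a b c d : α}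
    (h : T G a b c d) (h' : T G a c b d) :
    alternatingGroup α ≤ G := by
  obtain ⟨a1, a2, a3, a4, a5, a6, a7⟩ := id h
  obtain ⟨b1, b2, b3, b4, b5, b6, b7⟩ := id h'
  refine done_of_two hG hcard (two_of_trans hG hcard {a, b, c, d} ?_ ?_ (a := a) ?_) h
  · exact Finset.card_le_four.trans (by norm_num)
  · rw [Finset.card_insert_of_notMem (by grind), Finset.card_insert_of_notMem (by grind)]; omega
  · intro x hx
    simp only [Finset.mem_insert, Finset.mem_singleton] at hx ⊢
    rcases hx with rfl | rfl | rfl | rfl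
    · exact ⟨1, G.one_mem, by simp, by simp⟩
    · refine ⟨_, a7, fun z hz => ?_, ?_⟩ <;> simp only [Perm.mul_apply, swap_apply_def] <;> grind
    · refine ⟨_, b7, fun z hz => ?_, ?_⟩ <;> simp only [Perm.mul_apply, swap_apply_def] <;> grind
    · refine ⟨_, G.mul_mem a7 b7, fun z hz => ?_, ?_⟩ <;>
        simp only [Perm.mul_apply, swap_apply_def] <;> grind

lemma T.sw3 {a b c d : α} (h : T G a b c d) : T G a b d c := h.sw2.sw1.sw2

lemma PairA (hG : IsPreprimitive G α) {a b c d f g : α} (h : T G a b c d) (h' : T G a b f g) :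
    alternatingGroup α ≤ G ∨ (f = c ∧ g = d) ∨ (f = d ∧ g = c) ∨
      (f ≠ c ∧ f ≠ d ∧ g ≠ c ∧ g ≠ d) := by
  by_cases h1 : f = c
  · subst h1
    by_cases h2 : g = d
    · simp [h2]
    · exact .inl (L3a hG h.sw2 h'.sw2 (Ne.symm h2))
  by_cases h2 : f = d
  · subst h2
    by_cases h3 : g = c
    · simp [h3]
    · exact .inl (L3a hG h.sw3.sw2 h'.sw2 (Ne.symm h3))
  by_cases h3 : g = c
  · subst h3
    exact .inl (L3a hG h.sw2 h'.sw3.sw2 (Ne.symm h2))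
  by_cases h4 : g = d
  · subst h4
    exact .inl (L3a hG h.sw3.sw2 h'.sw3.sw2 (Ne.symm h1))
  simp_all

lemma PB1 (hG : IsPreprimitive G α) (hcard : 12 ≤ Fintype.card α) {a b c d f g : α}
    (h : T G a b c d) (h' : T G a c f g) : alternatingGroup α ≤ G := by
  have aux : ∀ {f g : α}, T G a c f g → b = f → alternatingGroup α ≤ G := by
    intro f g h' hb
    subst hb
    by_cases hg : g = d
    · subst hg; exact L4 hG hcard h h'
    · exact L3 hG hcard h.sw2 h'.sw1 (Ne.symm hg)
  have aux2 : ∀ {f g : α}, T G a c f g → b ≠ f → b ≠ g → d = f → alternatingGroup α ≤ G := by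
    intro f g h' hb hb' hd
    subst hd
    exact L3 hG hcard h h' hb'
  by_cases h1 : b = f
  · exact aux h' h1
  by_cases h2 : b = g
  · exact aux h'.sw3 h2
  by_cases h3 : d = f
  · exact aux2 h' h1 h2 h3
  by_cases h4 : d = g
  · exact aux2 h'.sw3 h2 h1 h4
  exact L2 hG hcard h h' ⟨h1, h2⟩ ⟨h3, h4⟩

lemma PairB (hG : IsPreprimitive G α) (hcard : 12 ≤ Fintype.card α) {a b c d e f g : α}
    (h : T G a b c d) (h' : T G a e f g) (hbe : b ≠ e) :
    alternatingGroup α ≤ G ∨ (e ≠ c ∧ e ≠ d ∧ b ≠ f ∧ b ≠ g ∧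
      ((f = c ∧ g ≠ d) ∨ (f = d ∧ g ≠ c) ∨ (g = c ∧ f ≠ d) ∨ (g = d ∧ f ≠ c))) := by
  by_cases h1 : e = c
  · subst h1; exact .inl (PB1 hG hcard h h')
  by_cases h2 : e = d
  · subst h2; exact .inl (PB1 hG hcard h.sw3 h')
  by_cases h3 : b = f
  · subst h3; exact .inl (PB1 hG hcard h' h)
  by_cases h4 : b = g
  · subst h4; exact .inl (PB1 hG hcard h'.sw3 h)
  by_cases h5 : f = c ∧ g = d
  · obtain ⟨rfl, rfl⟩ := h5; exact .inl (L3a hG h h' hbe)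
  by_cases h6 : f = d ∧ g = c
  · obtain ⟨rfl, rfl⟩ := h6; exact .inl (L3a hG h h'.sw3 hbe)
  by_cases h7 : f ≠ c ∧ f ≠ d ∧ g ≠ c ∧ g ≠ d
  · exact .inl (L1 hG h h' ⟨hbe, h3, h4⟩ (by grind) (by grind))
  right
  grind

open scoped Pointwise in
lemma rudio (hG : IsPreprimitive G α) (hcard : 12 ≤ Fintype.card α) {a b c d : α}
    (h : T G a b c d) {x y : α} (hxy : x ≠ y) :
    ∃ q r s, T G x q r s ∧ y ≠ q ∧ y ≠ r ∧ y ≠ s := by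
  have hne : (({a, b, c, d} : Finset α) : Set α) ≠ Set.univ := by
    intro hu
    have : ({a, b, c, d} : Finset α).card = Fintype.card α := by
      rw [Finset.coe_eq_univ.mp hu, Finset.card_univ]
    have := (Finset.card_le_four (a := a) (b := b) (c := c) (d := d))
    omega
  obtain ⟨⟨g, hg⟩, h1, h2⟩ := IsPreprimitive.exists_mem_smul_and_notMem_smul (G := G)
    (A := (({a, b, c, d} : Finset α) : Set α)) (Finset.finite_toSet _) ⟨a, by simp⟩ hne hxy
  have h3 := Lconj hg h
  rw [Set.mem_smul_set] at h1 h2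
  obtain ⟨z, hz, hzx⟩ := h1
  simp only [Finset.coe_insert, Finset.coe_singleton, Set.mem_insert_iff, Set.mem_singleton_iff] at hz h2
  have hzx' : g z = x := hzx
  have h2' : ∀ w, (w = a ∨ w = b ∨ w = c ∨ w = d) → y ≠ g w := fun w hw hy => h2 ⟨w, hw, hy.symm⟩
  rcases hz with rfl | rfl | rfl | rfl
  · exact ⟨_, _, _, hzx' ▸ h3, by grind, by grind, by grind⟩
  · exact ⟨_, _, _, hzx' ▸ h3.sw1, by grind, by grind, by grind⟩
  · exact ⟨_, _, _, hzx' ▸ h3.sw2, by grind, by grind, by grind⟩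
  · exact ⟨_, _, _, hzx' ▸ h3.sw2.sw1, by grind, by grind, by grind⟩

lemma main2 (hG : IsPreprimitive G α) (hcard : 12 ≤ Fintype.card α) {a b c d e f : α}
    (t : T G a b c d) (s : T G a e c f) (hb : b ≠ e) (hb' : b ≠ f) (hd : d ≠ e) (hd' : d ≠ f) :
    alternatingGroup α ≤ G := by
  obtain ⟨g, h, i, s', c1, c2, c3⟩ := rudio hG hcard t (x := a) (y := c) t.2.1
  have r : T G e b f d := by
    have := Lconj s.2.2.2.2.2.2 t
    obtain ⟨a1, a2, a3, a4, a5, a6, a7⟩ := t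
    obtain ⟨b1, b2, b3, b4, b5, b6, b7⟩ := s
    simpa [swap_apply_def, a1, a1.symm, a2, a2.symm, a3, a3.symm, a4, a4.symm, a5, a5.symm, a6,
      a6.symm, b1, b2, b3, b4, b5, b6, hb, hb', hd, hd', b1.symm, b2.symm, b3.symm, b4.symm, b5.symm] using this
  by_cases hg : b = g
  · subst hg
    rcases PairA hG t s' with h1 | h1
    · exact h1
    rcases PairB hG hcard s s' hb.symm with h2 | ⟨h2, h3, h4, h5, h6⟩
    · exact h2
    have aux : ∀ {h i}, T G a b h i → c ≠ h → c ≠ i → h ≠ d → i ≠ d → e ≠ i → h = f →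
        alternatingGroup α ≤ G := by
      intro h i s' q1 q2 q3 q4 q5 hh
      subst hh
      have := Lshare t s' ⟨q1, q2⟩ ⟨q3.symm, q4.symm⟩
      have hai := s'.2.2.1
      exact L2 hG hcard this s.sw2 ⟨t.2.2.1.symm, hd⟩ ⟨hai.symm, q5.symm⟩
    rcases h6 with h6 | h6 | h6 | h6
    · grind
    · exact aux s' c2 c3 (by grind) (by grind) h5 h6.1
    · grind
    · exact aux s'.sw3 c3 c2 (by grind) (by grind) h4 h6.1
  · rcases PairB hG hcard t s' hg with h2 | ⟨h2, h3, h4, h5, h6⟩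
    · exact h2
    have aux : ∀ {h i}, T G a g h i → c ≠ h → c ≠ i → b ≠ h → b ≠ i → h = d →
        alternatingGroup α ≤ G := by
      intro h i s' q1 q2 q3 q4 q5
      subst q5
      by_cases he : e = g
      · subst he
        rcases PairA hG s s' with h1 | h1
        · exact h1
        have := Lshare s s' ⟨q1, q2⟩ ⟨hd'.symm, by grind⟩
        have hai := s'.2.2.1
        refine L2 hG hcard this t.sw2 ⟨s.2.2.1.symm, hb'.symm⟩ ⟨hai.symm, q4.symm⟩
      · rcases PairB hG hcard s s' he with h2 | ⟨h2, h3, h4, h5, h6⟩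
        · exact h2
        have hi : i = f := by grind
        subst hi
        have := Lshare s'.sw2 r.sw2.sw1 ⟨s.1, t.1⟩ ⟨Ne.symm he, Ne.symm hg⟩
        exact L2 hG hcard this s ⟨c1.symm, h3⟩ ⟨t.2.2.2.1, hb'⟩
    rcases h6 with h6 | h6 | h6 | h6
    · grind
    · exact aux s' c2 c3 h4 h5 h6.1
    · grind
    · exact aux s'.sw3 c3 c2 h5 h4 h6.1

lemma bitrans (hG : IsPreprimitive G α) (hcard : 12 ≤ Fintype.card α) {a b c d : α}
    (t : T G a b c d) : alternatingGroup α ≤ G := by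
  obtain ⟨e, f, g, s, c1, c2, c3⟩ := rudio hG hcard t (x := a) (y := b) t.1
  rcases PairB hG hcard t s c1 with h | ⟨h1, h2, h3, h4, h5⟩
  · exact h
  rcases h5 with ⟨rfl, h5⟩ | ⟨rfl, h5⟩ | ⟨rfl, h5⟩ | ⟨rfl, h5⟩
  · exact main2 hG hcard t s c1 h4 h2.symm h5.symm
  · exact main2 hG hcard t.sw3 s c1 h4 h1.symm h5.symm
  · exact main2 hG hcard t s.sw3 c1 h3 h2.symm h5.symm
  · exact main2 hG hcard t.sw3 s.sw3 c1 h3 h1.symm h5.symm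

/-- In a primitive group of degree at least 12 not containing the alternating group, every
nontrivial element moves at least 5 points. -/
theorem five_le_support (hG : IsPreprimitive G α) (hcard : 12 ≤ Fintype.card α)
    (hn : ¬ alternatingGroup α ≤ G) {g : Perm α} (hg : g ∈ G) (h1 : g ≠ 1) :
    5 ≤ g.support.card := by
  by_contra hlt
  apply hn
  obtain ⟨a, ha⟩ : ∃ a, g a ≠ a := by
    by_contra hcon
    push Not at hcon
    exact h1 (Perm.ext hcon)
  have hinj := g.injective
  have hlt4 : ∀ t : Finset α, t ⊆ g.support → t.card = 4 → t = g.support := fun t ht h4 =>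
    Finset.eq_of_subset_of_card_le ht (by omega)
  have hmem : ∀ x, x ∈ g.support ↔ g x ≠ x := fun x => mem_support
  have hb : g (g a) ≠ g a := fun h => ha (hinj h)
  rcases Nat.lt_or_ge g.support.card 3 with hs | hs
  · have h2 : g.support.card = 2 := by
      have := two_le_card_support_of_ne_one h1
      omega
    rw [subgroup_eq_top_of_isPreprimitive_of_isSwap_mem hG g (card_support_eq_two.mp h2) hg]
    exact le_top
  rcases Nat.lt_or_ge g.support.card 4 with hs4 | hs4
  · exact alternatingGroup_le_of_isPreprimitive_of_isThreeCycle_mem hG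
      (card_support_eq_three_iff.mp (by omega)) hg
  have hex : ∀ t : Finset α, t.card ≤ 3 → ∃ x, x ∉ t ∧ g x ≠ x := by
    intro t ht
    obtain ⟨x, hx, hx'⟩ := Finset.exists_mem_notMem_of_card_lt_card (s := t) (t := g.support) (by omega)
    exact ⟨x, hx', (hmem x).1 hx⟩
  have hfour : ∀ x y z w : α, g x ≠ x → g y ≠ y → g z ≠ z → g w ≠ w → x ≠ y → x ≠ z → x ≠ w →
      y ≠ z → y ≠ w → z ≠ w → ∀ u, g u ≠ u → u = x ∨ u = y ∨ u = z ∨ u = w := by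
    intro x y z w hx hy hz hw h1 h2 h3 h4 h5 h6 u hu
    have := hlt4 {x, y, z, w} (by
      intro v hv
      simp only [Finset.mem_insert, Finset.mem_singleton] at hv
      rw [hmem]; grind) (by
      rw [Finset.card_insert_of_notMem (by grind), Finset.card_insert_of_notMem (by grind),
        Finset.card_insert_of_notMem (by grind), Finset.card_singleton])
    have hu' := (hmem u).2 hu
    rw [← this] at hu'
    simpa using hu'
  by_cases hab : g (g a) = a
  · obtain ⟨c, hc, hcc⟩ := hex {a, g a} (Finset.card_le_two.trans (by norm_num))
    simp only [Finset.mem_insert, Finset.mem_singleton, not_or] at hc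
    have hd : g (g c) ≠ g c := fun h => hcc (hinj h)
    have q1 : g c ≠ a := fun h => hc.2 (hinj (by rw [h, hab]))
    have q2 : g c ≠ g a := fun h => hc.1 (hinj h)
    have q3 := hfour a (g a) c (g c) ha hb hcc hd ha.symm (Ne.symm hc.1) q1.symm (Ne.symm hc.2) q2.symm
      hcc.symm
    have q4 : g (g c) = c := by
      rcases q3 (g (g c)) (fun h => hd (hinj h)) with h | h | h | h
      · exact absurd (hinj (h.trans hab.symm)) q2
      · exact absurd (hinj h) q1
      · exact h
      · exact absurd h hd
    refine bitrans hG hcard (a := a) (b := g a) (c := c) (d := g c)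
      ⟨ha.symm, Ne.symm hc.1, q1.symm, Ne.symm hc.2, q2.symm, hcc.symm, ?_⟩
    have : swap a (g a) * swap c (g c) = g := by
      ext x
      have := q3 x
      simp only [Perm.mul_apply, swap_apply_def]
      grind
    rwa [this]
  · have hc : g (g (g a)) ≠ g (g a) := fun h => hb (hinj h)
    have q0 : g (g (g a)) ≠ g a := fun h => hab (hinj h)
    have q1 : g (g (g a)) ≠ a := by
      intro h
      obtain ⟨e, he, hee⟩ := hex {a, g a, g (g a)} Finset.card_le_three
      simp only [Finset.mem_insert, Finset.mem_singleton, not_or] at he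
      have q3 := hfour a (g a) (g (g a)) e ha hb hc hee ha.symm (Ne.symm hab) (Ne.symm he.1) hb.symm
        (Ne.symm he.2.1) (Ne.symm he.2.2)
      rcases q3 (g e) (fun h => hee (hinj h)) with h' | h' | h' | h'
      · exact he.2.2 (hinj (h'.trans h.symm))
      · exact he.1 (hinj h')
      · exact he.2.1 (hinj h')
      · exact hee h'
    have hd : g (g (g (g a))) ≠ g (g (g a)) := fun h => hc (hinj h)
    have q3 := hfour a (g a) (g (g a)) (g (g (g a))) ha hb hc hd ha.symm (Ne.symm hab) q1.symm hb.symm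
      q0.symm hc.symm
    have q4 : g (g (g (g a))) = a := by
      rcases q3 (g (g (g (g a)))) (fun h => hd (hinj h)) with h | h | h | h
      · exact h
      · exact absurd (hinj h) q1
      · exact absurd (hinj h) q0
      · exact absurd h hd
    refine bitrans hG hcard (a := a) (b := g (g a)) (c := g a) (d := g (g (g a)))
      ⟨Ne.symm hab, ha.symm, q1.symm, hb, hc.symm, q0.symm, ?_⟩
    have : swap a (g (g a)) * swap (g a) (g (g (g a))) = g * g := by
      ext x
      have := q3 x
      simp only [Perm.mul_apply, swap_apply_def]
      grind
    rw [this]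
    exact G.mul_mem hg hg

end GT
end

section
open Polynomial NumberField NumberField.InfinitePlace IntermediateField

namespace GC

lemma exists_small {K : Type} [Field K] [NumberField K] {d : ℕ} (hd : Module.finrank ℚ K = d) (hd3 : 3 ≤ d)
    (hF : ∀ F : IntermediateField ℚ K, F = ⊥ ∨ F = ⊤) {D : ℕ} (hD : |discr K| ≤ D) :
    ∃ θ : 𝓞 K, ℚ⟮(θ : K)⟯ = ⊤ ∧ ∏ σ : K →+* ℂ, max 1 ‖σ θ‖ ≤ Real.sqrt D * 2 ^ d + 1 := by
  classical
  let B : NNReal := NNReal.sqrt D * 2 ^ d + 1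
  have hmb : mixedEmbedding.minkowskiBound K ↑1 < (B : ENNReal) := by
    have : NNReal.sqrt D * 2 ^ d < B := by simp only [B]; exact lt_add_of_pos_right _ zero_lt_one
    refine lt_of_le_of_lt ?_ (ENNReal.coe_lt_coe.mpr this)
    rw [mixedEmbedding.minkowskiBound, mixedEmbedding.volume_fundamentalDomain_fractionalIdealLatticeBasis,
      Units.val_one, FractionalIdeal.absNorm_one, Rat.cast_one,
      ENNReal.ofReal_one, one_mul, mixedEmbedding.finrank, mixedEmbedding.volume_fundamentalDomain_latticeBasis,
      ENNReal.coe_mul, ENNReal.coe_pow, ENNReal.coe_ofNat, hd, show (NNReal.sqrt D : ENNReal) = (1 : ENNReal) * NNReal.sqrt D by rw [one_mul]]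
    gcongr
    · exact pow_le_one₀ (by positivity) (by simp)
    · rwa [← NNReal.coe_le_coe, coe_nnnorm, Int.norm_eq_abs, ← Int.cast_abs,
        NNReal.coe_natCast, ← Int.cast_natCast, Int.cast_le]
  obtain ⟨w0⟩ : Nonempty (InfinitePlace K) := inferInstance
  obtain ⟨w1, hw1⟩ : ∃ w1 : InfinitePlace K, w1 ≠ w0 := by
    by_contra! h
    have h1 := sum_mult_eq (K := K)
    have h2 : (Finset.univ : Finset (InfinitePlace K)) = {w0} := by
      ext w; simp [h w]
    rw [h2, Finset.sum_singleton, hd] at h1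
    have : w0.mult ≤ 2 := by rw [mult]; split_ifs <;> norm_num
    omega
  obtain ⟨g, hg1, hg2⟩ := mixedEmbedding.adjust_f K (f := fun _ => (1 : NNReal)) (w₁ := w0) B (fun _ _ => one_ne_zero)
  obtain ⟨θ, hθ0, hθ⟩ := mixedEmbedding.exists_ne_zero_mem_ringOfIntegers_lt (K := K) (f := g) (by
    rw [mixedEmbedding.convexBodyLT_volume]
    refine hmb.trans_le ?_
    rw [hg2]
    refine le_mul_of_one_le_left (zero_le) ?_
    exact_mod_cast mixedEmbedding.one_le_convexBodyLTFactor K)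
  have hlt : ∀ z : InfinitePlace K, z ≠ w0 → z θ < 1 := fun z hz => by
    have := hθ z; rw [hg1 z hz] at this; simpa using this
  have hge := one_le_of_lt_one hθ0 hlt
  refine ⟨θ, (hF _).resolve_left ?_, ?_⟩
  · intro hb
    have : (θ : K) ∈ (⊥ : IntermediateField ℚ K) := hb ▸ mem_adjoin_simple_self ℚ _
    obtain ⟨q, hq⟩ := mem_bot.1 this
    have hq' : (θ : K) = (q : K) := hq.symm
    have h1 := hlt w1 hw1
    have h2 : ∀ w : InfinitePlace K, w θ = ‖(q : ℂ)‖ := by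
      intro w
      rw [← w.norm_embedding_eq, hq', map_ratCast]
    rw [h2] at hge h1
    linarith
  · rw [HT.prod_emb_eq, ← Finset.mul_prod_erase Finset.univ _ (Finset.mem_univ w0),
      Finset.prod_eq_one, mul_one, max_eq_right hge]
    · have h1 : g w0 ^ w0.mult = B := by
        rw [← hg2, ← Finset.mul_prod_erase Finset.univ _ (Finset.mem_univ w0),
          Finset.prod_eq_one, mul_one]
        intro w hw
        rw [hg1 w (Finset.ne_of_mem_erase hw), one_pow]
      have h2 : (w0 θ) ^ w0.mult ≤ (g w0 : ℝ) ^ w0.mult :=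
        pow_le_pow_left₀ (by linarith) (hθ w0).le _
      have h3 : (g w0 : ℝ) ^ w0.mult = Real.sqrt D * 2 ^ d + 1 := by
        rw [← NNReal.coe_pow, h1]; simp [B]
      rw [← h3]; exact h2
    · intro w hw
      rw [max_eq_left (hlt w (Finset.ne_of_mem_erase hw)).le, one_pow]

/-- `p` defines a field without intermediate fields and with small discriminant -/
def SmallDisc (c : ℕ) (N : ℕ) (p : ℤ[X]) : Prop :=
  ∃ (K : Type) (_ : Field K) (_ : NumberField K) (α : 𝓞 K), ℚ⟮(α : K)⟯ = ⊤ ∧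
    (∀ F : IntermediateField ℚ K, F = ⊥ ∨ F = ⊤) ∧ minpoly ℤ α = p ∧ (discr K) ^ 2 ≤ c * N ^ 3

theorem small_disc {d : ℕ} (hd : 8 ≤ d) {c : ℕ} (hc : 1 ≤ c) : Small d (SmallDisc c) := by
  let c1 : ℝ := 2 * 2 ^ d * (2 ^ d + 2) + 1
  let c2 : ℕ := 2 ^ d * (d + 1)
  have hc2 : 1 ≤ c2 := Nat.succ_le_of_lt (by positivity)
  let K : ℝ := Real.log c2 + 1
  have hK : 1 ≤ K := by
    have := Real.log_nonneg (by exact_mod_cast hc2 : (1 : ℝ) ≤ c2)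
    simp only [K]; linarith
  refine ⟨c1 ^ d * c ^ d * (48 ^ d * c2 * K ^ d), by positivity, d, fun N hN => ?_⟩
  have hN' : (1 : ℝ) ≤ N := by exact_mod_cast (by omega : 1 ≤ N)
  have hc' : (1 : ℝ) ≤ c := by exact_mod_cast hc
  have hl := one_le_ll hN
  let S : ℝ := Real.sqrt (Real.sqrt (c * N ^ 3))
  have hS4 : S ^ 4 = c * N ^ 3 := by
    rw [show S ^ 4 = (S ^ 2) ^ 2 by ring, Real.sq_sqrt (Real.sqrt_nonneg _), Real.sq_sqrt (by positivity)]
  have hS1 : 1 ≤ S := by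
    rw [Real.one_le_sqrt, Real.one_le_sqrt]
    exact one_le_mul_of_one_le_of_one_le hc' (one_le_pow₀ hN')
  have hSd : S ^ d ≤ c ^ d * N ^ (d - 2) := by
    refine le_of_pow_le_pow_left₀ (n := 4) (by norm_num) (by positivity) ?_
    calc (S ^ d) ^ 4 = (S ^ 4) ^ d := by ring
      _ = (c : ℝ) ^ d * (N : ℝ) ^ (3 * d) := by rw [hS4, mul_pow, ← pow_mul]
      _ ≤ ((c : ℝ) ^ d) ^ 4 * (N : ℝ) ^ ((d - 2) * 4) := by
        refine mul_le_mul (le_self_pow₀ (one_le_pow₀ hc') (by norm_num))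
          (pow_le_pow_right₀ hN' (by omega)) (by positivity) (by positivity)
      _ = _ := by rw [mul_pow, pow_mul (N : ℝ)]
  let b : ℕ := ⌈2 ^ d * S + 1⌉₊
  have hb : (b : ℝ) ≤ 2 ^ d * S + 2 := by
    have := Nat.ceil_lt_add_one (by positivity : 0 ≤ 2 ^ d * S + 1)
    simp only [b]; linarith
  let A : ℤ[X] → Set ℤ[X] := fun Q => {f | f ∈ box d N ∧ NormData (Q.map (Int.castRingHom ℚ)) d 1 {0} f}
  have key : ({p : ℤ[X] | p ∈ box d N ∧ SmallDisc c N p}.ncard : ℝ) ≤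
      (box d (2 ^ d * b)).card * (48 ^ d * (c2 * N) * (K * ll N) ^ d) := by
    apply ncard_le_of_cover A
    · intro i _; exact fin_box _
    · rintro p ⟨hp, F, _, _, α, hα, hF, hmin, hdisc⟩
      have hfr : Module.finrank ℚ F = d := by
        have h1 := (minpoly_prod rfl hα).2.2.1
        rw [hmin, (mem_box.1 hp).2.1] at h1
        exact h1.symm
      obtain ⟨θ, hθ, hθ2⟩ := exists_small hfr (by omega) hF (D := (discr F).natAbs)
        (by rw [Int.natCast_natAbs])
      obtain ⟨pb, hpb⟩ := exists_pb hθ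
      obtain ⟨h1, h2, h3, h4⟩ := minpoly_prod hfr hθ
      have hmm : mm (minpoly ℤ θ) ≤ (b : ℕ) := by
        rw [mm_minpoly hθ]
        refine hθ2.trans ((?_ : _ ≤ _).trans (Nat.le_ceil _))
        rw [mul_comm]
        have : Real.sqrt ((discr F).natAbs : ℝ) ≤ S := by
          apply Real.sqrt_le_sqrt
          apply Real.le_sqrt_of_sq_le
          have : (((discr F).natAbs : ℤ)) ^ 2 ≤ c * N ^ 3 := by
            rw [Int.natCast_natAbs, sq_abs]; exact hdisc
          exact_mod_cast this
        gcongr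
      refine ⟨minpoly ℤ θ, mem_box_of_mm h2 h3 hmm, hp, F, inferInstance, inferInstance, pb, X - C α, hfr, ?_, monic_X_sub_C _,
        natDegree_X_sub_C _, ?_, ?_⟩
      · rw [hpb, h1]
      · intro i hi hi'
        exact absurd (Finset.mem_singleton.2 (by omega)) hi'
      · rw [← hmin, (minpoly_prod hfr hα).2.2.2]
        refine Finset.prod_congr rfl fun σ _ => ?_
        rw [Polynomial.map_sub, map_X, map_C]; rfl
    · intro Q _
      refine (fiber_count hN _ _).trans ?_
      rw [Finset.card_singleton, pow_one]
      have e1 : ((2 : ℝ) ^ 1) ^ d * ((d + 1) * (N : ℕ)) = c2 * N := by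
        simp only [c2]; push_cast; ring
      rw [e1]
      have e2 := log_mul_le (by exact_mod_cast hc2 : (1 : ℝ) ≤ c2) hN
      have e3 : 0 ≤ Real.log (c2 * N) := Real.log_nonneg (by
        have : (1 : ℝ) ≤ c2 := by exact_mod_cast hc2
        nlinarith)
      exact mul_le_mul_of_nonneg_left (pow_le_pow_left₀ e3 e2 _) (by positivity)
  refine key.trans ?_
  have hcard : ((box d (2 ^ d * b)).card : ℝ) ≤ c1 ^ d * (c ^ d * N ^ (d - 2)) := by
    have h1 : ((box d (2 ^ d * b)).card : ℝ) ≤ (2 * (2 ^ d * b) + 1) ^ d := by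
      exact_mod_cast card_box_le _ _
    refine h1.trans (le_trans ?_ (mul_le_mul_of_nonneg_left hSd (by positivity)))
    rw [← mul_pow]
    refine pow_le_pow_left₀ (by positivity) ?_ _
    have : (2 : ℝ) ^ d * b ≤ 2 ^ d * (2 ^ d * S + 2) := by gcongr
    have h2 : (0 : ℝ) < 2 ^ d := by positivity
    simp only [c1]
    nlinarith
  calc _ ≤ (c1 ^ d * (c ^ d * N ^ (d - 2))) * (48 ^ d * (c2 * N) * (K * ll N) ^ d) := by gcongr
    _ = c1 ^ d * c ^ d * (48 ^ d * c2 * K ^ d) * N ^ ((d - 2) + 1) * ll N ^ d := by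
      rw [pow_succ, mul_pow K]; ring
    _ = _ := by rw [show d - 2 + 1 = d - 1 by omega]

end GC
end

section
open Polynomial NumberField

namespace GC

lemma idem_zero {p b d : ℕ} (hp : p.Prime) (hb : b ≠ 0) (hd : d < p ^ b) {ι : Type*} [Fintype ι] [DecidableEq ι]
    (hι : Fintype.card ι = d) (E : Matrix ι ι (ZMod (p ^ b))) (hE : E * E = E) (htr : E.trace = 0) : E = 0 := by
  have : Fact p.Prime := ⟨hp⟩
  have : Fact (1 < p ^ b) := ⟨Nat.one_lt_pow hb hp.one_lt⟩
  have : NeZero (p ^ b) := ⟨by have := hp.pos; positivity⟩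
  have : IsLocalRing (ZMod (p ^ b)) := by
    refine IsLocalRing.of_nonunits_add ?_
    intro x y hx hy
    have key : ∀ z : ZMod (p ^ b), z ∈ nonunits _ ↔ p ∣ z.val := by
      intro z
      rw [mem_nonunits_iff, ← ZMod.natCast_zmod_val z, ZMod.isUnit_iff_coprime, ZMod.natCast_zmod_val,
        Nat.coprime_pow_right_iff (Nat.pos_of_ne_zero hb), Nat.coprime_comm, hp.coprime_iff_not_dvd, not_not]
    rw [key] at *
    rw [ZMod.val_add]
    exact (Nat.dvd_mod_iff (dvd_pow_self p hb)).2 (dvd_add hx hy)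
  let f := Matrix.toLin' E
  have hf : f ∘ₗ f = f := by
    rw [← Matrix.toLin'_mul, hE]
  have hproj : LinearMap.IsProj (LinearMap.range f) f := by
    refine ⟨fun x => ⟨x, rfl⟩, ?_⟩
    rintro _ ⟨y, rfl⟩
    exact LinearMap.congr_fun hf y
  have hcompl := hproj.isCompl
  have : Module.Finite (ZMod (p ^ b)) (LinearMap.range f) := inferInstance
  have h1 : Module.Projective (ZMod (p ^ b)) (LinearMap.range f) :=
    Module.Projective.of_split (LinearMap.range f).subtype hproj.codRestrict (by
      ext1 x; exact hproj.codRestrict_apply_cod x)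
  have h2 : Module.Projective (ZMod (p ^ b)) (LinearMap.ker f) :=
    Module.Projective.of_split (LinearMap.ker f).subtype
      (LinearMap.codRestrict (LinearMap.ker f) (LinearMap.id - f) (fun x => by
        have := LinearMap.congr_fun hf x
        rw [LinearMap.comp_apply] at this
        rw [LinearMap.mem_ker, LinearMap.sub_apply, map_sub, this]; simp)) (by
      ext1 x; apply Subtype.ext
      have : f x.1 = 0 := x.2
      simp [this])
  have : Module.Free (ZMod (p ^ b)) (LinearMap.range f) := Module.free_of_flat_of_isLocalRing
  have : Module.Free (ZMod (p ^ b)) (LinearMap.ker f) := Module.free_of_flat_of_isLocalRing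
  have ht := hproj.trace
  rw [Matrix.trace_toLin'_eq, htr] at ht
  have hle : Module.finrank (ZMod (p ^ b)) (LinearMap.range f) ≤ d := by
    have := LinearMap.finrank_range_le f
    rwa [Module.finrank_fintype_fun_eq_card, hι] at this
  have h0 : Module.finrank (ZMod (p ^ b)) (LinearMap.range f) = 0 := by
    have := (ZMod.natCast_eq_zero_iff _ _).1 ht.symm
    exact Nat.eq_zero_of_dvd_of_lt this (by omega)
  rw [Module.finrank_eq_zero_iff_of_free, Submodule.subsingleton_iff_eq_bot] at h0
  have : LinearMap.range f = ⊥ := h0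
  rw [LinearMap.range_eq_bot] at this
  exact (LinearEquiv.map_eq_zero_iff Matrix.toLin').1 this

lemma mem_span_of_matrix {K : Type*} [Field K] [NumberField K] {n : ℕ} {x : 𝓞 K} 
    (h : (Algebra.leftMulMatrix (RingOfIntegers.basis K) x).map (Int.castRingHom (ZMod n)) = 0) :
    x ∈ Ideal.span {(n : 𝓞 K)} := by
  have h1 : ∀ i j, (n : ℤ) ∣ Algebra.leftMulMatrix (RingOfIntegers.basis K) x i j := by
    intro i j
    have := congrFun (congrFun h i) j
    exact (ZMod.intCast_zmod_eq_zero_iff_dvd _ _).1 this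
  have h2 : ∀ j, (n : 𝓞 K) ∣ x * RingOfIntegers.basis K j := by
    intro j
    rw [← (RingOfIntegers.basis K).sum_repr (x * RingOfIntegers.basis K j)]
    refine Finset.dvd_sum fun i _ => ?_
    have h3 := h1 i j
    rw [Algebra.leftMulMatrix_eq_repr_mul] at h3
    obtain ⟨c, hc⟩ := h3
    rw [hc, mul_smul]
    exact ⟨c • RingOfIntegers.basis K i, by simp⟩
  rw [Ideal.mem_span_singleton]
  have h4 : x = ∑ j, x * ((RingOfIntegers.basis K).repr 1 j • RingOfIntegers.basis K j) := by
    rw [← Finset.mul_sum, (RingOfIntegers.basis K).sum_repr, mul_one]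
  rw [h4]
  refine Finset.dvd_sum fun j _ => ?_
  rw [mul_smul_comm, zsmul_eq_mul]
  exact Dvd.dvd.mul_left (h2 j) _

lemma matrix_of_mem_span {K : Type*} [Field K] [NumberField K] {n : ℕ} {x : 𝓞 K} 
    (h : x ∈ Ideal.span {(n : 𝓞 K)}) :
    (Algebra.leftMulMatrix (RingOfIntegers.basis K) x).map (Int.castRingHom (ZMod n)) = 0 := by
  obtain ⟨y, rfl⟩ := Ideal.mem_span_singleton.1 h
  rw [← nsmul_eq_mul, map_nsmul]
  ext i j
  rw [Matrix.map_apply, Matrix.smul_apply]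
  simp

lemma not_dvd_different {K : Type*} [Field K] [NumberField K] {d p b : ℕ} (hd : Module.finrank ℚ K = d)
    (hp : p.Prime) (hb : b ≠ 0) (hdp : d < p ^ b) {A J : Ideal (𝓞 K)} (hAJ : A * J = Ideal.span {((p ^ b : ℕ) : 𝓞 K)})
    (hco : IsCoprime A J) (hA : A ≠ ⊤) : ¬ A ∣ differentIdeal ℤ (𝓞 K) := by
  obtain ⟨y, hy, x, hx, hxy⟩ := Submodule.mem_sup.1 ((Ideal.eq_top_iff_one _).1 (Ideal.isCoprime_iff_sup_eq.1 hco))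
  have hmap : A * J = Ideal.map (algebraMap ℤ (𝓞 K)) (Ideal.span {((p ^ b : ℕ) : ℤ)}) := by
    rw [hAJ, Ideal.map_span, Set.image_singleton]; simp
  refine not_dvd_differentIdeal_of_intTrace_not_mem ℤ A J hmap x hx fun htr => hA ?_
  rw [Algebra.intTrace_eq_trace, Ideal.mem_span_singleton, Algebra.trace_eq_matrix_trace (RingOfIntegers.basis K)] at htr
  generalize hM : Algebra.leftMulMatrix (RingOfIntegers.basis K) = M at *
  have hE : (M x).map (Int.castRingHom (ZMod (p ^ b))) * (M x).map (Int.castRingHom (ZMod (p ^ b))) =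
      (M x).map (Int.castRingHom (ZMod (p ^ b))) := by
    have h1 : y * x ∈ Ideal.span {((p ^ b : ℕ) : 𝓞 K)} := hAJ ▸ Ideal.mul_mem_mul hy hx
    have h2 := matrix_of_mem_span h1
    rw [hM] at h2
    have h3 : y * x = x - x * x := by rw [eq_sub_of_add_eq hxy]; ring
    rw [h3, map_sub, map_mul, ← RingHom.mapMatrix_apply, map_sub, map_mul, sub_eq_zero] at h2
    rw [← RingHom.mapMatrix_apply]
    exact h2.symm
  have htr' : ((M x).map (Int.castRingHom (ZMod (p ^ b)))).trace = 0 := by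
    rw [← AddMonoidHom.coe_coe, ← AddMonoidHom.map_trace]
    exact (ZMod.intCast_zmod_eq_zero_iff_dvd _ _).2 htr
  have hcard : Fintype.card (Module.Free.ChooseBasisIndex ℤ (𝓞 K)) = d := by
    rw [← Module.finrank_eq_card_basis (RingOfIntegers.basis K), RingOfIntegers.rank, hd]
  have h0 := idem_zero hp hb hdp hcard _ hE htr'
  rw [← hM] at h0
  have h1 := mem_span_of_matrix h0
  rw [← hAJ] at h1
  rw [Ideal.eq_top_iff_one, ← hxy]
  have h2 : x ∈ A := (Ideal.mul_le_left : A * J ≤ A) h1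
  exact A.add_mem hy h2

end GC
end

section
open Polynomial NumberField UniqueFactorizationMonoid

namespace GC

lemma different_mul_dvd {K : Type*} [Field K] [NumberField K] {d : ℕ} (hd : Module.finrank ℚ K = d)
    (S : Finset ℕ) (hS : ∀ p ∈ S, p.Prime) (hSD : ∀ p : ℕ, p.Prime → (p : ℤ) ∣ discr K → p ∈ S) (b : ℕ → ℕ)
    (hb : ∀ p ∈ S, b p ≠ 0 ∧ d < p ^ b p) :
    differentIdeal ℤ (𝓞 K) * ∏ p ∈ S, radical (Ideal.span {(p : 𝓞 K)}) ∣
      ∏ p ∈ S, Ideal.span {(p : 𝓞 K)} ^ b p := by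
  classical
  have hne : ∀ p ∈ S, Ideal.span {(p : 𝓞 K)} ≠ 0 := by
    intro p hp
    rw [Ne, Ideal.zero_eq_bot, Ideal.span_singleton_eq_bot]
    exact_mod_cast (hS p hp).ne_zero
  have hprod : ∀ P : Ideal (𝓞 K), Prime P → ∀ p ∈ S, ∀ q ∈ S, P ∣ Ideal.span {(p : 𝓞 K)} → P ∣ Ideal.span {(q : 𝓞 K)} → p = q := by
    intro P hP p hp q hq h1 h2
    by_contra hne'
    have hcop := (Nat.coprime_primes (hS p hp) (hS q hq)).2 hne'
    rw [Ideal.dvd_span_singleton] at h1 h2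
    have h3 : IsCoprime (p : 𝓞 K) (q : 𝓞 K) := Nat.Coprime.cast hcop
    obtain ⟨u, v, huv⟩ := h3
    have : (1 : 𝓞 K) ∈ P := huv ▸ P.add_mem (P.mul_mem_left u h1) (P.mul_mem_left v h2)
    exact hP.not_isUnit (Ideal.isUnit_iff.2 ((Ideal.eq_top_iff_one _).2 this))
  rw [dvd_iff_emultiplicity_le (mul_ne_zero differentIdeal_ne_bot (Finset.prod_ne_zero_iff.2 fun p _ => radical_ne_zero))]
  intro P hP
  rw [emultiplicity_mul hP, Finset.emultiplicity_prod hP, Finset.emultiplicity_prod hP]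
  have hPp : P.IsPrime := Ideal.isPrime_of_prime hP
  have hPm : P.IsMaximal := hPp.isMaximal hP.ne_zero
  by_cases hex : ∃ p ∈ S, P ∣ Ideal.span {(p : 𝓞 K)}
  · obtain ⟨p, hp, hPdvd⟩ := hex
    have hother : ∀ q ∈ S, q ≠ p → emultiplicity P (radical (Ideal.span {(q : 𝓞 K)})) = 0 := by
      intro q hq hqp
      rw [emultiplicity_eq_zero]
      intro h
      exact hqp (hprod P hP q hq p hp (h.trans radical_dvd_self) hPdvd)
    rw [Finset.sum_eq_single p hother (fun h => absurd hp h)]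
    refine le_trans ?_ (Finset.single_le_sum (fun _ _ => zero_le) hp)
    rw [emultiplicity_pow hP]
    have hfin : FiniteMultiplicity P (Ideal.span {(p : 𝓞 K)}) := FiniteMultiplicity.of_prime_left hP (hne p hp)
    obtain ⟨J, hJ, hPJ⟩ := hfin.exists_eq_pow_mul_and_not_dvd
    have he : multiplicity P (Ideal.span {(p : 𝓞 K)}) ≠ 0 := by
      intro h0
      rw [h0, pow_zero, one_mul] at hJ
      exact hPJ (hJ ▸ hPdvd)
    rw [hfin.emultiplicity_eq_multiplicity]
    generalize multiplicity P (Ideal.span {(p : 𝓞 K)}) = e at *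
    have hco : IsCoprime (P ^ (e * b p)) (J ^ b p) := by
      apply IsCoprime.pow
      rw [Ideal.isCoprime_iff_sup_eq]
      refine hPm.1.2 _ (lt_of_le_of_ne le_sup_left fun h => hPJ ?_)
      rw [Ideal.dvd_iff_le, h]; exact le_sup_right
    have hnd := not_dvd_different hd (hS p hp) (hb p hp).1 (hb p hp).2
      (A := P ^ (e * b p)) (J := J ^ b p) (by
        rw [pow_mul, ← mul_pow, ← hJ, Ideal.span_singleton_pow, Nat.cast_pow]) hco (fun h => by
          have := Ideal.pow_le_self (I := P) (mul_ne_zero he (hb p hp).1)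
          rw [h] at this
          exact hPm.ne_top (top_le_iff.1 this))
    have h1 := emultiplicity_lt_iff_not_dvd.2 hnd
    have h2 : emultiplicity P (radical (Ideal.span {(p : 𝓞 K)})) ≤ 1 :=
      ((squarefree_iff_emultiplicity_le_one _).1 squarefree_radical P).resolve_right hP.not_isUnit
    calc _ ≤ emultiplicity P (differentIdeal ℤ (𝓞 K)) + 1 := by gcongr
      _ ≤ ((e * b p : ℕ) : ℕ∞) := Order.add_one_le_of_lt h1
      _ = _ := by push_cast; ring
  · push Not at hex
    have h0 : emultiplicity P (differentIdeal ℤ (𝓞 K)) = 0 := by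
      rw [emultiplicity_eq_zero]
      intro h
      have h1 : ((discr K : ℤ) : 𝓞 K) ∈ P := Ideal.dvd_iff_le.1 h (discr_mem_differentIdeal K (𝓞 K))
      have h2 : (((discr K).natAbs : ℕ) : 𝓞 K) ∈ P := by
        rw [← Int.cast_natCast]
        rcases Int.natAbs_eq (discr K) with h3 | h3
        · rw [← h3]; exact h1
        · rw [show ((discr K).natAbs : ℤ) = -discr K by omega, Int.cast_neg]; exact P.neg_mem h1
      rw [← Nat.prod_primeFactorsList (Int.natAbs_ne_zero.2 (discr_ne_zero K)), Nat.cast_list_prod] at h2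
      obtain ⟨x, hx, hxP⟩ := (Ideal.IsPrime.multiset_prod_mem_iff_exists_mem hPp _).1 (by rw [← Multiset.prod_coe] at h2; exact h2)
      rw [Multiset.mem_coe, List.mem_map] at hx
      obtain ⟨q, hq, rfl⟩ := hx
      have hq1 := Nat.prime_of_mem_primeFactorsList hq
      refine hex q (hSD q hq1 (Int.natCast_dvd.2 (Nat.dvd_of_mem_primeFactorsList hq))) ?_
      rwa [Ideal.dvd_span_singleton]
    have h1 : ∑ p ∈ S, emultiplicity P (radical (Ideal.span {(p : 𝓞 K)})) = 0 := by
      refine Finset.sum_eq_zero fun p hp => ?_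
      rw [emultiplicity_eq_zero]
      exact fun h => hex p hp (h.trans radical_dvd_self)
    rw [h0, h1]; simp

end GC
end

section
open Polynomial NumberField UniqueFactorizationMonoid IntermediateField

namespace GC

lemma charpoly_eq {K : Type*} [Field K] [NumberField K] {α : 𝓞 K} (h : ℚ⟮(α : K)⟯ = ⊤) :
    (Algebra.leftMulMatrix (RingOfIntegers.basis K) α).charpoly = minpoly ℤ α := by
  obtain ⟨-, h1, h2, -⟩ := minpoly_prod rfl h
  refine (eq_of_monic_of_dvd_of_natDegree_le h1 (Matrix.charpoly_monic _) ?_ ?_)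
  · apply minpoly.isIntegrallyClosed_dvd (RingOfIntegers.isIntegral α)
    apply Algebra.leftMulMatrix_injective (RingOfIntegers.basis K)
    rw [map_zero, ← aeval_algHom_apply]
    exact Matrix.aeval_self_charpoly _
  · rw [Matrix.charpoly_natDegree_eq_dim, h2, ← Module.finrank_eq_card_basis (RingOfIntegers.basis K), RingOfIntegers.rank]

lemma dvd_of_aeval_mem {K : Type*} [Field K] [NumberField K] {α : 𝓞 K} (h : ℚ⟮(α : K)⟯ = ⊤) {p : ℕ}
    {g : ℤ[X]} (hg : aeval α g ∈ Ideal.span {(p : 𝓞 K)}) :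
    (minpoly ℤ α).map (Int.castRingHom (ZMod p)) ∣ (g.map (Int.castRingHom (ZMod p))) ^ Module.finrank ℚ K := by
  obtain ⟨Q, hQ⟩ : (X - C α) ∣ (g.map (algebraMap ℤ (𝓞 K))) - C (aeval α g) := by
    have := Polynomial.X_sub_C_dvd_sub_C_eval (a := α) (p := g.map (algebraMap ℤ (𝓞 K)))
    rwa [eval_map_algebraMap] at this
  let ψ : 𝓞 K →+* Matrix _ _ (ZMod p) := (Int.castRingHom (ZMod p)).mapMatrix.comp
    (Algebra.leftMulMatrix (RingOfIntegers.basis K)).toRingHom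
  have hψ : ψ (aeval α g) = 0 := matrix_of_mem_span hg
  have h1 := congrArg (fun q => matPolyEquiv.symm (q.map ψ)) hQ
  simp only [Polynomial.map_sub, Polynomial.map_mul, map_X, map_C, hψ, map_zero, sub_zero, map_mul,
    Polynomial.map_map] at h1
  have h2 : matPolyEquiv.symm (X - C (ψ α)) = Matrix.charmatrix (ψ α) := by
    rw [AlgEquiv.symm_apply_eq, Matrix.matPolyEquiv_charmatrix]
  have h3 : matPolyEquiv.symm (g.map (ψ.comp (algebraMap ℤ (𝓞 K)))) =
      (g.map (Int.castRingHom (ZMod p))) • 1 := by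
    rw [AlgEquiv.symm_apply_eq, matPolyEquiv_smul_one, Polynomial.map_map]
    congr 1
    exact RingHom.ext_int _ _
  rw [h2, h3] at h1
  have h4 := congrArg Matrix.det h1
  rw [Matrix.det_mul, Matrix.det_smul, Matrix.det_one, mul_one, ← Module.finrank_eq_card_basis (RingOfIntegers.basis K), RingOfIntegers.rank] at h4
  rw [h4]
  have h5 : (ψ α).charpoly = (minpoly ℤ α).map (Int.castRingHom (ZMod p)) := by
    rw [← charpoly_eq h, ← Matrix.charpoly_map]; rfl
  rw [← h5]
  exact Dvd.intro _ rfl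

/-- degree of the radical of the reduction modulo `p` -/
noncomputable def rdeg (p : ℕ) [Fact p.Prime] (f : ℤ[X]) : ℕ :=
  (radical (f.map (Int.castRingHom (ZMod p)))).natDegree

lemma pow_rdeg_le {K : Type*} [Field K] [NumberField K] {α : 𝓞 K} (h : ℚ⟮(α : K)⟯ = ⊤) (p : ℕ) [hp : Fact p.Prime] :
    p ^ rdeg p (minpoly ℤ α) ≤ (radical (Ideal.span {(p : 𝓞 K)})).absNorm := by
  classical
  set f := (minpoly ℤ α) with hf
  set r := rdeg p f with hr
  set I := radical (Ideal.span {(p : 𝓞 K)}) with hI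
  have hfm : f.Monic := (minpoly_prod rfl h).2.1
  have hf0 : f.map (Int.castRingHom (ZMod p)) ≠ 0 := (hfm.map _).ne_zero
  have hs0 : Ideal.span {(p : 𝓞 K)} ≠ 0 := by
    rw [Ne, Ideal.zero_eq_bot, Ideal.span_singleton_eq_bot]
    exact_mod_cast hp.1.ne_zero
  obtain ⟨n, hn⟩ := exists_dvd_radical_self_pow hs0
  have hI0 : I.absNorm ≠ 0 := by
    rw [Ne, Ideal.absNorm_eq_zero_iff]; exact radical_ne_zero
  let G : (Fin r → ZMod p) → ℤ[X] := fun c => ∑ i, C ((c i).val : ℤ) * X ^ (i : ℕ)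
  let Φ : (Fin r → ZMod p) → (𝓞 K) ⧸ I := fun c => Ideal.Quotient.mk I (aeval α (G c))
  have hGm : ∀ c, (G c).map (Int.castRingHom (ZMod p)) = ∑ i, C (c i) * X ^ (i : ℕ) := by
    intro c
    simp only [G, Polynomial.map_sum]
    refine Finset.sum_congr rfl fun i _ => ?_
    rw [Polynomial.map_mul, map_C, Polynomial.map_pow, map_X]
    have : Int.castRingHom (ZMod p) ((c i).val : ℤ) = c i := by
      rw [eq_intCast, Int.cast_natCast, ZMod.natCast_zmod_val]
    rw [this]
  have hΦ : Function.Injective Φ := by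
    intro c c' hcc
    have h1 : aeval α (G c - G c') ∈ I := by rw [map_sub]; exact Ideal.Quotient.eq.1 hcc
    have h2 : aeval α ((G c - G c') ^ n) ∈ Ideal.span {(p : 𝓞 K)} := by
      rw [map_pow]; exact Ideal.dvd_iff_le.1 hn (Ideal.pow_mem_pow h1 n)
    have h3 := dvd_of_aeval_mem h h2
    rw [Polynomial.map_pow, ← pow_mul] at h3
    have h4 := (exists_dvd_pow_iff_radical_dvd hf0).1 ⟨_, h3⟩
    have h5 : (G c - G c').map (Int.castRingHom (ZMod p)) = ∑ i : Fin r, C (c i - c' i) * X ^ (i : ℕ) := by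
      rw [Polynomial.map_sub, hGm, hGm, ← Finset.sum_sub_distrib]
      refine Finset.sum_congr rfl fun i _ => ?_
      rw [C_sub]; ring
    have h6 : (G c - G c').map (Int.castRingHom (ZMod p)) = 0 := by
      refine eq_zero_of_dvd_of_degree_lt h4 ?_
      rw [h5, degree_eq_natDegree (p := radical (f.map (Int.castRingHom (ZMod p)))) radical_ne_zero]
      refine (degree_sum_fin_lt fun i => c i - c' i).trans_le (le_of_eq rfl)
    funext i
    have h7 := congrArg (fun q => q.coeff i) (h5.symm.trans h6)
    simp only [finsetSum_coeff, coeff_C_mul, coeff_X_pow, coeff_zero] at h7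
    rw [Finset.sum_eq_single i] at h7
    · simpa [sub_eq_zero] using h7
    · intro j _ hj; rw [if_neg (fun h => hj (Fin.ext h.symm)), mul_zero]
    · simp
  have hfin : Finite ((𝓞 K) ⧸ I) := Nat.finite_of_card_ne_zero (by
    rw [← Submodule.cardQuot_apply, ← Ideal.absNorm_apply]; exact hI0)
  have := Nat.card_le_card_of_injective Φ hΦ
  rw [Nat.card_eq_fintype_card, Fintype.card_fun, ZMod.card, Fintype.card_fin, ← Submodule.cardQuot_apply, ← Ideal.absNorm_apply] at this
  exact this

end GC
end

section
open Polynomial NumberField UniqueFactorizationMonoid IntermediateField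

namespace GC

/-- `rdeg` without instance argument -/
noncomputable def rd (p : ℕ) (f : ℤ[X]) : ℕ :=
  if h : p.Prime then @rdeg p ⟨h⟩ f else 0

lemma rd_eq (p : ℕ) [hp : Fact p.Prime] (f : ℤ[X]) : rd p f = rdeg p f := by
  rw [rd, dif_pos hp.1]

lemma rd_le {f : ℤ[X]} (hf : f.Monic) (p : ℕ) : rd p f ≤ f.natDegree := by
  by_cases hp : p.Prime
  · have : Fact p.Prime := ⟨hp⟩
    rw [rd_eq, rdeg]
    have h0 : f.map (Int.castRingHom (ZMod p)) ≠ 0 := (hf.map _).ne_zero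
    refine (natDegree_le_of_dvd radical_dvd_self h0).trans natDegree_map_le
  · rw [rd, dif_neg hp]; exact Nat.zero_le _

theorem discr_le {K : Type*} [Field K] [NumberField K] {d : ℕ} (hd : Module.finrank ℚ K = d)
    {α : 𝓞 K} (h : ℚ⟮(α : K)⟯ = ⊤) :
    (discr K).natAbs ≤ (d + 1) ^ (d * d * (d + 1)) *
      ∏ p ∈ (discr K).natAbs.primeFactors with d < p, p ^ (d - rd p (minpoly ℤ α)) := by
  set f := minpoly ℤ α with hf
  set S := (discr K).natAbs.primeFactors with hS
  have hfm := (minpoly_prod hd h).2.1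
  have hfd := (minpoly_prod hd h).2.2.1
  have hd0 : 0 < d := by rw [← hd]; exact Module.finrank_pos
  have hSp : ∀ p ∈ S, p.Prime := fun p hp => Nat.prime_of_mem_primeFactors hp
  have h1 := different_mul_dvd hd S hSp (fun p hp hpd => by
    rw [hS, Nat.mem_primeFactors]
    refine ⟨hp, Int.natCast_dvd.1 hpd, by simpa using discr_ne_zero K⟩)
    (fun p => if p ≤ d then d else 1) (fun p hp => by
      have hp2 := (hSp p hp).two_le
      by_cases hpd : p ≤ d
      · simp only [if_pos hpd]; exact ⟨hd0.ne', Nat.lt_pow_self hp2⟩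
      · simp only [if_neg hpd]; exact ⟨one_ne_zero, by rw [pow_one]; omega⟩)
  have h2 := map_dvd Ideal.absNorm h1
  rw [map_mul, map_prod, map_prod, NumberField.absNorm_differentIdeal K (𝓞 K)] at h2
  simp only [map_pow, Ideal.absNorm_span_natCast] at h2
  rw [RingOfIntegers.rank, hd] at h2
  have h3 := Nat.le_of_dvd (Finset.prod_pos fun p hp => by
    have := (hSp p hp).pos; positivity) h2
  have h4 : ∏ p ∈ S with d < p, p ^ rd p f ≤ ∏ p ∈ S, (radical (Ideal.span {(p : 𝓞 K)})).absNorm := by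
    have key : ∀ p ∈ S, p ^ rd p f ≤ (radical (Ideal.span {(p : 𝓞 K)})).absNorm := by
      intro p hp
      have : Fact p.Prime := ⟨hSp p hp⟩
      rw [rd_eq]; exact pow_rdeg_le h p
    calc _ ≤ ∏ p ∈ S, p ^ rd p f := Finset.prod_le_prod_of_subset_of_one_le' (Finset.filter_subset _ _)
            fun p hp _ => Nat.one_le_iff_ne_zero.2 (pow_ne_zero _ (hSp p hp).ne_zero)
      _ ≤ _ := Finset.prod_le_prod' key
  have h5 : ∏ p ∈ S, (p ^ d) ^ (if p ≤ d then d else 1) ≤ (d + 1) ^ (d * d * (d + 1)) *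
      ((∏ p ∈ S with d < p, p ^ (d - rd p f)) * ∏ p ∈ S with d < p, p ^ rd p f) := by
    rw [← Finset.prod_filter_mul_prod_filter_not S (fun p => p ≤ d)]
    refine Nat.mul_le_mul ?_ (le_of_eq ?_)
    · calc _ ≤ ∏ p ∈ S with p ≤ d, (d + 1) ^ (d * d) := by
            refine Finset.prod_le_prod' fun p hp => ?_
            have := (Finset.mem_filter.1 hp).2
            rw [if_pos this, ← pow_mul]
            exact Nat.pow_le_pow_left (by omega) _
        _ ≤ _ := by
          rw [Finset.prod_const, ← pow_mul]
          refine Nat.pow_le_pow_right (by omega) (Nat.mul_le_mul_left _ ?_)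
          calc _ ≤ (Finset.range (d + 1)).card := Finset.card_le_card fun p hp => by
                have := (Finset.mem_filter.1 hp).2
                rw [Finset.mem_range]; omega
            _ = _ := Finset.card_range _
    · rw [← Finset.prod_mul_distrib]
      simp only [not_le]
      refine Finset.prod_congr rfl fun p hp => ?_
      have := (Finset.mem_filter.1 hp).2
      rw [if_neg (by omega), pow_one, ← pow_add]
      have : rd p f ≤ d := (rd_le hfm p).trans_eq hfd
      congr 1; omega
  have h6 : 0 < ∏ p ∈ S with d < p, p ^ rd p f := Finset.prod_pos fun p hp => by
    have := (hSp p (Finset.mem_filter.1 hp).1).pos; positivity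
  refine Nat.le_of_mul_le_mul_right ?_ h6
  rw [mul_assoc]
  exact ((Nat.mul_le_mul_left _ h4).trans h3).trans h5

end GC
end

section
open Polynomial NumberField UniqueFactorizationMonoid IntermediateField

namespace GC

lemma exists_inertia {L : Type*} [Field L] [NumberField L] [IsGalois ℚ L] {p : ℕ} (hp : p.Prime)
    (hpd : (p : ℤ) ∣ discr L) : ∃ P : Ideal (𝓞 L), P.IsMaximal ∧ (p : 𝓞 L) ∈ P ∧
      ∃ g : Gal(L/ℚ), g ≠ 1 ∧ ∀ x : 𝓞 L, g • x - x ∈ P := by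
  have hpp : Prime (p : ℤ) := Nat.prime_iff_prime_int.1 hp
  have := mt (not_dvd_discr_iff_forall_liesOver L (𝓞 L) hpp).2 (not_not.2 hpd)
  push Not at this
  obtain ⟨P, hP, hlo, hun⟩ := this
  have hpI : (Ideal.span {(p : ℤ)}).IsPrime := (Ideal.span_singleton_prime hpp.ne_zero).2 hpp
  have : (Ideal.span {(p : ℤ)}).IsMaximal := hpI.isMaximal (by simpa using hp.ne_zero)
  have : P.IsPrime := hP.isPrime
  have hpf : Finite (ℤ ⧸ Ideal.span {(p : ℤ)}) := by
    have : NeZero p := ⟨hp.ne_zero⟩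
    exact Finite.of_equiv _ (Int.quotientSpanNatEquivZMod p).symm.toEquiv
  have hpr : PerfectField (Ideal.span {(p : ℤ)}).ResidueField := by
    have : Finite (Ideal.span {(p : ℤ)}).ResidueField :=
      Finite.of_surjective _ (Ideal.bijective_algebraMap_quotient_residueField (Ideal.span {(p : ℤ)})).2
    infer_instance
  have h1 := Ideal.card_inertia_eq_ramificationIdxIn (G := Gal(L/ℚ)) (Ideal.span {(p : ℤ)}) P
  rw [Ideal.ramificationIdxIn_eq_ramificationIdx (Ideal.span {(p : ℤ)}) P Gal(L/ℚ)] at h1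
  rw [← Ideal.ramificationIdx_eq_one_iff, ← h1] at hun
  have h2 : P.inertia Gal(L/ℚ) ≠ ⊥ := fun h => hun (by rw [h]; simp)
  obtain ⟨⟨g, hg⟩, hg0⟩ := Subgroup.ne_bot_iff_exists_ne_one.1 h2
  have hg1 : g ≠ 1 := fun h' => hg0 (Subtype.ext h')
  refine ⟨P, hP, ?_, g, hg1, hg⟩
  have : (p : ℤ) ∈ P.under ℤ := by rw [← hlo.over]; exact Ideal.mem_span_singleton_self _
  rw [Ideal.mem_comap] at this
  simpa using this

open Classical in
theorem rd_add_three_le {L : Type*} [Field L] [NumberField L] [IsGalois ℚ L] {p : ℕ} (hp : p.Prime)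
    (hpd : (p : ℤ) ∣ discr L) {f : ℤ[X]} (R : Finset (𝓞 L))
    (hf : f.map (algebraMap ℤ (𝓞 L)) = ∏ r ∈ R, (X - C r))
    (h5 : ∀ g : Gal(L/ℚ), g ≠ 1 → 5 ≤ (R.filter fun r => g • r ≠ r).card) :
    rd p f + 3 ≤ R.card := by
  obtain ⟨P, hP, hpP, g, hg1, hg⟩ := exists_inertia hp hpd
  have hpF : Fact p.Prime := ⟨hp⟩
  let _ : Field (𝓞 L ⧸ P) := Ideal.Quotient.field P
  let π : 𝓞 L →+* 𝓞 L ⧸ P := Ideal.Quotient.mk P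
  have hch : CharP (𝓞 L ⧸ P) p := by
    have : ((p : ℕ) : 𝓞 L ⧸ P) = 0 := by
      rw [← map_natCast π]; exact Ideal.Quotient.eq_zero_iff_mem.2 hpP
    have h := CharP.exists (𝓞 L ⧸ P)
    obtain ⟨q, hq⟩ := h
    have hdv := (CharP.cast_eq_zero_iff (𝓞 L ⧸ P) q p).1 this
    rcases (Nat.dvd_prime hp).1 hdv with h | h
    · subst h; exact absurd (CharP.char_ne_one (𝓞 L ⧸ P) 1) (by simp)
    · subst h; exact hq
  let ι : ZMod p →+* 𝓞 L ⧸ P := ZMod.castHom dvd_rfl _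
  -- radical
  have hfm : (f.map (algebraMap ℤ (𝓞 L))).Monic := by
    rw [hf]; exact monic_prod_of_monic _ _ fun r _ => monic_X_sub_C r
  have hfm' : f.Monic := by
    refine (Function.Injective.monic_map_iff (f := algebraMap ℤ (𝓞 L)) ?_).2 hfm
    exact FaithfulSMul.algebraMap_injective ℤ (𝓞 L)
  set h := radical (f.map (Int.castRingHom (ZMod p))) with hh
  have hsep : h.Separable := PerfectField.separable_iff_squarefree.2 squarefree_radical
  have hdv : h.map ι ∣ ∏ r ∈ R, (X - C (π r)) := by
    have h1 : h.map ι ∣ (f.map (Int.castRingHom (ZMod p))).map ι := Polynomial.map_dvd _ radical_dvd_self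
    have h2 : (f.map (algebraMap ℤ (𝓞 L))).map π = (f.map (Int.castRingHom (ZMod p))).map ι := by
      rw [Polynomial.map_map, Polynomial.map_map]; congr 1; exact RingHom.ext_int _ _
    rw [← h2, hf, Polynomial.map_prod] at h1
    simpa using h1
  have hprod0 : (∏ r ∈ R, (X - C (π r))) ≠ 0 := (monic_prod_of_monic _ _ fun r _ => monic_X_sub_C (π r)).ne_zero
  have hspl : (h.map ι).Splits := by
    refine Splits.of_dvd ?_ hprod0 hdv
    exact Splits.prod fun r _ => Splits.X_sub_C _
  have hcard : h.natDegree ≤ (R.image π).card := by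
    have h1 : (h.map ι).roots.toFinset ⊆ R.image π := by
      intro x hx
      rw [Multiset.mem_toFinset] at hx
      have h2 := Multiset.mem_of_le (roots.le_of_dvd hprod0 hdv) hx
      rw [mem_roots hprod0, IsRoot, eval_prod, Finset.prod_eq_zero_iff] at h2
      obtain ⟨r, hr, h3⟩ := h2
      rw [Finset.mem_image]
      rw [eval_sub, eval_X, eval_C] at h3
      exact ⟨r, hr, (sub_eq_zero.1 h3).symm⟩
    refine le_trans (le_of_eq ?_) (Finset.card_le_card h1)
    rw [Multiset.toFinset_card_of_nodup (nodup_roots (hsep.map)), ← hspl.natDegree_eq_card_roots, natDegree_map]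
  -- counting
  set B := R.filter fun r => g • r ≠ r with hB
  have hgR : ∀ r ∈ R, g • r ∈ R := by
    intro r hr
    have h1 : (f.map (algebraMap ℤ (𝓞 L))).eval (g • r) = 0 := by
      have h2 : (f.map (algebraMap ℤ (𝓞 L))).eval r = 0 := by
        rw [hf, eval_prod]; exact Finset.prod_eq_zero hr (by simp)
      rw [eval_map_algebraMap] at h2 ⊢
      have h3 := congrArg (MulSemiringAction.toRingHom Gal(L/ℚ) (𝓞 L) g) h2
      rw [map_zero, aeval_def, hom_eval₂] at h3
      rw [aeval_def]
      convert h3 using 2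
      · exact RingHom.ext_int _ _
      · rfl
    rw [hf, eval_prod, Finset.prod_eq_zero_iff] at h1
    obtain ⟨s, hs, h3⟩ := h1
    have : g • r = s := by simpa [sub_eq_zero] using h3
    rwa [this]
  have hBi : 2 * (B.image π).card ≤ B.card := by
    refine Finset.mul_card_image_le_card_of_maps_to (fun x hx => Finset.mem_image_of_mem _ hx) 2 ?_
    intro b hb
    obtain ⟨r, hr, rfl⟩ := Finset.mem_image.1 hb
    have hr2 := Finset.mem_filter.1 hr
    have : ({r, g • r} : Finset (𝓞 L)) ⊆ B.filter fun a => π a = π r := by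
      intro x hx
      rw [Finset.mem_insert, Finset.mem_singleton] at hx
      rcases hx with rfl | rfl
      · exact Finset.mem_filter.2 ⟨hr, rfl⟩
      · refine Finset.mem_filter.2 ⟨Finset.mem_filter.2 ⟨hgR r hr2.1, fun h => hr2.2 (smul_left_cancel g h)⟩, ?_⟩
        exact Ideal.Quotient.eq.2 (hg r)
    refine le_trans (le_of_eq ?_) (Finset.card_le_card this)
    rw [Finset.card_pair (Ne.symm hr2.2)]
  have hRB : (R.image π).card ≤ (R.card - B.card) + (B.image π).card := by
    have h1 : R.image π = (R \ B).image π ∪ B.image π := by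
      rw [← Finset.image_union, Finset.sdiff_union_of_subset (Finset.filter_subset _ _)]
    rw [h1]
    refine (Finset.card_union_le _ _).trans (Nat.add_le_add_right ?_ _)
    rw [← Finset.card_sdiff_of_subset (Finset.filter_subset _ _)]
    exact Finset.card_image_le
  have hBR : B.card ≤ R.card := Finset.card_le_card (Finset.filter_subset _ _)
  have : 5 ≤ B.card := by rw [hB]; exact h5 g hg1
  rw [rd_eq, rdeg, ← hh]
  omega

end GC
end

section
open Polynomial UniqueFactorizationMonoid

namespace GC

/-- monic polynomial with prescribed lower coefficients -/
noncomputable def mk {R : Type*} [CommRing R] {d : ℕ} (v : Fin d → R) : R[X] :=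
  X ^ d + ∑ i : Fin d, C (v i) * X ^ (i : ℕ)

lemma mk_monic {R : Type*} [CommRing R] {d : ℕ} (v : Fin d → R) : (mk v).Monic :=
  monic_X_pow_add (aux_degree v)

lemma mk_coeff {R : Type*} [CommRing R] {d : ℕ} (v : Fin d → R) (i : Fin d) : (mk v).coeff i = v i := by
  rw [mk, coeff_add, aux_coeff, coeff_X_pow, if_neg i.2.ne, dif_pos i.2, zero_add]

lemma mk_natDegree {R : Type*} [CommRing R] [Nontrivial R] {d : ℕ} (v : Fin d → R) : (mk v).natDegree = d := by
  refine natDegree_eq_of_degree_eq_some ?_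
  rw [mk, degree_add_eq_left_of_degree_lt] <;> rw [degree_X_pow]; exact aux_degree v

lemma mk_inj {R : Type*} [CommRing R] {d : ℕ} {v w : Fin d → R} (h : mk v = mk w) : v = w := by
  funext i; rw [← mk_coeff v, h, mk_coeff]

lemma card_nf_le {F : Type*} [Field F] [DecidableEq F] {q : F[X]} (hq : q.Monic) :
    (normalizedFactors q).card ≤ q.natDegree := by
  have h1 : (normalizedFactors q).prod = q := by
    rw [prod_normalizedFactors_eq hq.ne_zero, hq.normalize_eq_self]
  have h2 : ∀ a ∈ normalizedFactors q, a.Monic := fun a ha =>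
    by
      have := normalize_normalized_factor a ha
      rw [← this]; exact monic_normalize (irreducible_of_normalized_factor a ha).ne_zero
  conv_rhs => rw [← h1, natDegree_multiset_prod_of_monic _ h2]
  have := Multiset.card_nsmul_le_sum (s := (normalizedFactors q).map natDegree) (a := 1) (by
    intro x hx
    obtain ⟨a, ha, rfl⟩ := Multiset.mem_map.1 hx
    exact (irreducible_of_normalized_factor a ha).natDegree_pos)
  simpa using this

lemma radical_monic {F : Type*} [Field F] [DecidableEq F] (q : F[X]) : (radical q).Monic := by
  refine monic_prod_of_monic _ _ fun a ha => ?_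
  rw [mem_primeFactors] at ha
  have := normalize_normalized_factor a ha
  rw [id, ← this]; exact monic_normalize (irreducible_of_normalized_factor a ha).ne_zero

open Classical in
lemma card_rad (p : ℕ) [hp : Fact p.Prime] (d r : ℕ) :
    (Finset.univ.filter fun v : Fin d → ZMod p => (radical (mk v)).natDegree = r).card ≤
      2 ^ (d * d) * p ^ r := by
  have hc : (Finset.univ.image fun w : Fin r → ZMod p => mk w).card ≤ p ^ r := by
    refine Finset.card_image_le.trans ?_
    rw [Finset.card_univ, Fintype.card_fun, ZMod.card, Fintype.card_fin]
  refine le_trans (Finset.card_le_mul_card_image_of_maps_to (f := fun v => radical (mk v))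
    (t := Finset.univ.image fun w : Fin r → ZMod p => mk w) ?_ (2 ^ (d * d)) ?_) (Nat.mul_le_mul_left _ hc)
  · intro v hv
    have := (Finset.mem_filter.1 hv).2
    rw [Finset.mem_image]
    refine ⟨fun i => (radical (mk v)).coeff i, Finset.mem_univ _, (eq_aux ?_ this).symm⟩
    convert radical_monic (mk v)
  · intro h _
    by_cases hne : ∃ v₀ : Fin d → ZMod p, radical (mk v₀) = h
    swap
    · rw [Finset.filter_eq_empty_iff.2]
      · simp
      · intro v _ hv; exact hne ⟨v, hv⟩
    obtain ⟨v₀, hv₀⟩ := hne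
    have hcard : (primeFactors h).card ≤ d := by
      rw [← hv₀, primeFactors_radical]
      have h1 : (primeFactors (mk v₀)).card ≤ (normalizedFactors (mk v₀)).card := by
        rw [← toFinset_normalizedFactors]; exact Multiset.toFinset_card_le _
      exact (h1.trans (card_nf_le (mk_monic v₀))).trans_eq (mk_natDegree v₀)
    have hle : ∀ v : Fin d → ZMod p, radical (mk v) = h → normalizedFactors (mk v) ≤ d • (primeFactors h).val := by
      intro v hv
      rw [Multiset.le_iff_count]
      intro a
      by_cases ha : a ∈ normalizedFactors (mk v)
      · rw [Multiset.count_nsmul]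
        have h1 : a ∈ (primeFactors h).val := by
          rw [Finset.mem_val, ← hv, primeFactors_radical]; exact mem_primeFactors.2 ha
        have h2 := Multiset.one_le_count_iff_mem.2 h1
        have h3 := ((Multiset.count_le_card a _).trans (card_nf_le (mk_monic v))).trans_eq (mk_natDegree v)
        nlinarith
      · rw [Multiset.count_eq_zero_of_notMem ha]; exact Nat.zero_le _
    calc _ ≤ ((d • (primeFactors h).val).powerset.toFinset).card := by
          refine Finset.card_le_card_of_injOn (fun v => normalizedFactors (mk v)) ?_ ?_
          · intro v hv
            have := (Finset.mem_filter.1 hv).2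
            simp only [Finset.mem_coe, Multiset.mem_toFinset, Multiset.mem_powerset]
            exact hle v this
          · intro v _ w _ hvw
            have h1 := congrArg Multiset.prod hvw
            simp only [prod_normalizedFactors_eq (mk_monic v).ne_zero, prod_normalizedFactors_eq (mk_monic w).ne_zero,
              (mk_monic v).normalize_eq_self, (mk_monic w).normalize_eq_self] at h1
            exact mk_inj h1
      _ ≤ (d • (primeFactors h).val).powerset.card := Multiset.toFinset_card_le _
      _ ≤ 2 ^ (d * d) := by
          rw [Multiset.card_powerset, Multiset.card_nsmul]
          refine Nat.pow_le_pow_right (by norm_num) ?_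
          exact Nat.mul_le_mul_left _ hcard

/-- sieve weight -/
noncomputable def wt (d p : ℕ) (r : ℕ) : ℕ := if r < d then p ^ (d - 1 - r) else 0

lemma sum_wt (p : ℕ) [hp : Fact p.Prime] (d : ℕ) :
    ∑ v : Fin d → ZMod p, wt d p (radical (mk v)).natDegree ≤ d * 2 ^ (d * d) * p ^ (d - 1) := by
  classical
  calc ∑ v : Fin d → ZMod p, wt d p (radical (mk v)).natDegree
      = ∑ v : Fin d → ZMod p, ∑ r ∈ Finset.range d, if (radical (mk v)).natDegree = r then p ^ (d - 1 - r) else 0 := by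
        refine Finset.sum_congr rfl fun v _ => ?_
        rw [Finset.sum_ite_eq, wt]; simp
    _ = ∑ r ∈ Finset.range d, ∑ v : Fin d → ZMod p, if (radical (mk v)).natDegree = r then p ^ (d - 1 - r) else 0 :=
        Finset.sum_comm
    _ ≤ ∑ r ∈ Finset.range d, 2 ^ (d * d) * p ^ (d - 1) := by
        refine Finset.sum_le_sum fun r hr => ?_
        rw [← Finset.sum_filter, Finset.sum_const, smul_eq_mul]
        refine (Nat.mul_le_mul_right _ (card_rad p d r)).trans (le_of_eq ?_)
        rw [mul_assoc, ← pow_add]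
        have := Finset.mem_range.1 hr
        congr 2; omega
    _ = _ := by rw [Finset.sum_const, Finset.card_range, smul_eq_mul, mul_assoc]

end GC
end

section
open Polynomial UniqueFactorizationMonoid

namespace GC

lemma card_modEq {N n : ℕ} (hN : 1 ≤ N) (hn : 1 ≤ n) (hnN : n ≤ N) (a : ℤ) :
    (((Finset.Icc (-(N : ℤ)) N).filter fun x => x ≡ a [ZMOD n]).card : ℝ) ≤ 4 * N / n := by
  have hn' : (0 : ℤ) < n := by exact_mod_cast hn
  have h0 : Finset.Icc (-(N : ℤ)) N = Finset.Ioc (-(N : ℤ) - 1) N := by ext x; simp only [Finset.mem_Icc, Finset.mem_Ioc]; omega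
  rw [h0]
  have h1 := Int.Ioc_filter_modEq_card (-(N : ℤ) - 1) N hn' a
  have h2 : (((Finset.Ioc (-(N : ℤ) - 1) N).filter fun x => x ≡ a [ZMOD n]).card : ℝ) =
    (((((Finset.Ioc (-(N : ℤ) - 1) N).filter fun x => x ≡ a [ZMOD n]).card : ℤ)) : ℝ) := by push_cast; rfl
  rw [h2, h1]
  have hnR : (0 : ℝ) < n := by exact_mod_cast hn
  have hNR : (1 : ℝ) ≤ N := by exact_mod_cast hN
  have hnNR : (n : ℝ) ≤ N := by exact_mod_cast hnN
  rw [Int.cast_max, max_le_iff]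
  constructor
  · rw [le_div_iff₀ hnR]
    push_cast
    have e1 := Int.floor_le (((N : ℤ) - a : ℚ) / ((n : ℤ) : ℚ))
    have e2 := Int.lt_floor_add_one (((-(N : ℤ) - 1 : ℤ) - a : ℚ) / ((n : ℤ) : ℚ))
    have hnQ : (0 : ℚ) < (n : ℤ) := by exact_mod_cast hn
    rw [le_div_iff₀ hnQ] at e1
    rw [div_lt_iff₀ hnQ] at e2
    have e3 : ((⌊(((N : ℤ) - a : ℚ) / ((n : ℤ) : ℚ))⌋ - ⌊(((-(N : ℤ) - 1 : ℤ) - a : ℚ) / ((n : ℤ) : ℚ))⌋ : ℤ) : ℚ) * n ≤ 4 * N := by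
      push_cast at e1 e2 ⊢
      have : (n : ℚ) ≤ N := by exact_mod_cast hnN
      have : (1 : ℚ) ≤ N := by exact_mod_cast hN
      nlinarith
    have e4 : ((⌊(((N : ℤ) - a : ℚ) / ((n : ℤ) : ℚ))⌋ - ⌊(((-(N : ℤ) - 1 : ℤ) - a : ℚ) / ((n : ℤ) : ℚ))⌋ : ℤ)) * (n : ℤ) ≤ 4 * N := by
      exact_mod_cast e3
    have e5 := (Int.cast_le (R := ℝ)).2 e4
    push_cast at e5 ⊢
    exact e5
  · push_cast; positivity

open Classical in
lemma fiber_sum {α ι : Type*} [Fintype ι] {Y : ι → Type*} [∀ i, Fintype (Y i)] (s : Finset α)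
    (Ψ : α → ∀ i, Y i) (w : ∀ i, Y i → ℝ) (hw : ∀ i y, 0 ≤ w i y) {B : ℝ}
    (hfib : ∀ y, ((s.filter fun f => Ψ f = y).card : ℝ) ≤ B) :
    ∑ f ∈ s, ∏ i, w i (Ψ f i) ≤ B * ∏ i, ∑ y, w i y :=
  calc _ = ∑ y, ∑ f ∈ s with Ψ f = y, ∏ i, w i (Ψ f i) :=
        (Finset.sum_fiberwise s Ψ _).symm
    _ = ∑ y, (s.filter fun f => Ψ f = y).card * ∏ i, w i (y i) := by
        refine Finset.sum_congr rfl fun y _ => ?_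
        rw [← nsmul_eq_mul, ← Finset.sum_const]
        refine Finset.sum_congr rfl fun f hf => ?_
        rw [(Finset.mem_filter.1 hf).2]
    _ ≤ ∑ y, B * ∏ i, w i (y i) :=
        Finset.sum_le_sum fun y _ => mul_le_mul_of_nonneg_right (hfib y) (Finset.prod_nonneg fun p _ => hw _ _)
    _ = B * ∏ i, ∑ v, w i v := by
        rw [← Finset.mul_sum, Finset.prod_univ_sum, Fintype.piFinset_univ]

open Classical in
lemma sum_wt_box {d N n : ℕ} (hN : 1 ≤ N) (hn : Squarefree n) (hnN : n ≤ N) :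
    ∑ f ∈ box d N, ∏ p ∈ n.primeFactors, (wt d p (rd p f) : ℝ) ≤
      (4 * N / n) ^ d * ∏ p ∈ n.primeFactors, ((d * 2 ^ (d * d) * p ^ (d - 1) : ℕ) : ℝ) := by
  have hn1 : 1 ≤ n := Nat.one_le_iff_ne_zero.2 hn.ne_zero
  have hF : ∀ p : n.primeFactors, Fact (p : ℕ).Prime := fun p => ⟨Nat.prime_of_mem_primeFactors p.2⟩
  let Ψ : ℤ[X] → (∀ p : n.primeFactors, Fin d → ZMod p) := fun f p i => (f.coeff i : ZMod p)
  let w : (∀ p : n.primeFactors, (Fin d → ZMod p) → ℝ) := fun p v => (wt d p (radical (mk v)).natDegree : ℝ)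
  have hw0 : ∀ p v, 0 ≤ w p v := fun p v => Nat.cast_nonneg _
  have h1 : ∀ f ∈ box d N, ∏ p ∈ n.primeFactors, (wt d p (rd p f) : ℝ) = ∏ p : n.primeFactors, w p (Ψ f p) := by
    intro f hf
    rw [← Finset.prod_coe_sort]
    refine Finset.prod_congr rfl fun p _ => ?_
    obtain ⟨hm, hdg, -⟩ := mem_box.1 hf
    have h2 : f.map (Int.castRingHom (ZMod p)) = mk (Ψ f p) := by
      refine (eq_aux (hm.map _) (by rw [hm.natDegree_map, hdg])).trans ?_
      simp only [mk, coeff_map, Ψ]; rfl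
    simp only [w]
    rw [rd_eq, rdeg, h2]
  have hfib : ∀ y, (((box d N).filter fun f => Ψ f = y).card : ℝ) ≤ (4 * N / n) ^ d := by
    intro y
    by_cases hne : ∃ f₀, Ψ f₀ = y
    swap
    · rw [Finset.filter_eq_empty_iff.2]
      · simp only [Finset.card_empty, Nat.cast_zero]; positivity
      · intro v _ hv; exact hne ⟨v, hv⟩
    obtain ⟨f₀, rfl⟩ := hne
    calc (((box d N).filter fun f => Ψ f = Ψ f₀).card : ℝ) ≤
        ((Fintype.piFinset fun i : Fin d => (Finset.Icc (-(N : ℤ)) N).filter fun x => x ≡ f₀.coeff i [ZMOD n]).card : ℝ) := by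
          rw [Nat.cast_le]
          refine Finset.card_le_card_of_injOn (fun f i => f.coeff i) ?_ ?_
          · intro f hf
            obtain ⟨hf1, hf2⟩ := Finset.mem_filter.1 hf
            obtain ⟨-, -, hb⟩ := mem_box.1 hf1
            rw [Finset.mem_coe, Fintype.mem_piFinset]
            intro i
            refine Finset.mem_filter.2 ⟨Finset.mem_Icc.2 (abs_le.1 (hb i i.2)), ?_⟩
            apply Int.ModEq.symm
            rw [Int.modEq_iff_dvd, Int.natCast_dvd]
            rw [← Nat.prod_primeFactors_of_squarefree hn]
            refine Finset.prod_primes_dvd _ (fun p hp => (Nat.prime_of_mem_primeFactors hp).prime) ?_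
            intro p hp
            have := congrFun (congrFun hf2 ⟨p, hp⟩) i
            simp only [Ψ] at this
            rw [← Int.natCast_dvd]
            exact (ZMod.intCast_eq_intCast_iff_dvd_sub _ _ _).1 this.symm
          · intro f hf g hg hfg
            obtain ⟨hf1, hf2, -⟩ := mem_box.1 (Finset.mem_filter.1 hf).1
            obtain ⟨hg1, hg2, -⟩ := mem_box.1 (Finset.mem_filter.1 hg).1
            rw [eq_aux hf1 hf2, eq_aux hg1 hg2]
            congr 1
            exact Finset.sum_congr rfl fun i _ => by rw [show f.coeff i = g.coeff i from congrFun hfg i]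
      _ ≤ (4 * N / n) ^ d := by
          rw [Fintype.card_piFinset, Nat.cast_prod]
          refine (Finset.prod_le_prod (fun _ _ => Nat.cast_nonneg _) fun i _ => card_modEq hN hn1 hnN _).trans ?_
          rw [Finset.prod_const, Finset.card_univ, Fintype.card_fin]
  have hsum : ∀ p : n.primeFactors, ∑ v, w p v ≤ ((d * 2 ^ (d * d) * (p : ℕ) ^ (d - 1) : ℕ) : ℝ) := by
    intro p
    have h3 := sum_wt (p : ℕ) d
    rw [← Nat.cast_sum]
    exact Nat.cast_le.2 h3
  have h4 := fiber_sum (box d N) Ψ w hw0 (fun y => by convert hfib y)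
  rw [Finset.sum_congr rfl h1]
  refine h4.trans ?_
  refine mul_le_mul_of_nonneg_left ?_ (pow_nonneg (div_nonneg (by positivity) (Nat.cast_nonneg _)) _)
  refine (Finset.prod_le_prod (fun p _ => Finset.sum_nonneg fun v _ => hw0 _ _) fun p _ => hsum p).trans (le_of_eq ?_)
  exact Finset.prod_coe_sort n.primeFactors (fun p => ((d * 2 ^ (d * d) * (p : ℕ) ^ (d - 1) : ℕ) : ℝ))

lemma sum_K (K N : ℕ) :
    ∑ n ∈ Finset.Icc 1 N with Squarefree n, (K : ℝ) ^ n.primeFactors.card / n ≤ (1 + Real.log N) ^ K := by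
  classical
  have h1 : ∀ n ∈ (Finset.Icc 1 N).filter Squarefree, (K : ℝ) ^ n.primeFactors.card / n =
      ∑ x ∈ Nat.finMulAntidiag K n, ∏ i, (1 / (x i : ℝ)) := by
    intro n hn
    have hs := (Finset.mem_filter.1 hn).2
    have h2 : ∀ x ∈ Nat.finMulAntidiag K n, ∏ i, (1 / (x i : ℝ)) = 1 / n := by
      intro x hx
      rw [Finset.prod_div_distrib, Finset.prod_const_one, ← Nat.cast_prod, (Nat.mem_finMulAntidiag.1 hx).1]
    rw [Finset.sum_congr rfl h2, Finset.sum_const, Nat.card_finMulAntidiag_of_squarefree hs, nsmul_eq_mul,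
      ArithmeticFunction.cardDistinctFactors_apply]
    push_cast
    rw [mul_one_div]; rfl
  rw [Finset.sum_congr rfl h1, ← Finset.sum_biUnion]
  · calc _ ≤ ∑ x ∈ Fintype.piFinset (fun _ : Fin K => Finset.Icc 1 N), ∏ i, (1 / (x i : ℝ)) := by
          refine Finset.sum_le_sum_of_subset_of_nonneg ?_ (fun x _ _ => Finset.prod_nonneg fun i _ => by positivity)
          intro x hx
          obtain ⟨n, hn, hx⟩ := Finset.mem_biUnion.1 hx
          have hn1 := Finset.mem_Icc.1 (Finset.mem_filter.1 hn).1
          obtain ⟨h2, h3⟩ := Nat.mem_finMulAntidiag.1 hx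
          rw [Fintype.mem_piFinset]
          intro i
          have h4 : x i ∣ n := by rw [← h2]; exact Finset.dvd_prod_of_mem _ (Finset.mem_univ i)
          have h5 := Nat.le_of_dvd (by omega) h4
          have h6 := Nat.pos_of_dvd_of_pos h4 (by omega)
          rw [Finset.mem_Icc]; omega
      _ = ∏ i : Fin K, ∑ j ∈ Finset.Icc 1 N, (1 / (j : ℝ)) := by
          rw [Finset.prod_univ_sum]
      _ ≤ _ := by
          rw [Finset.prod_const, Finset.card_univ, Fintype.card_fin]
          refine pow_le_pow_left₀ (Finset.sum_nonneg fun i _ => by positivity) ?_ _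
          have := harmonic_le_one_add_log N
          rw [harmonic_eq_sum_Icc] at this
          push_cast at this
          simpa using this
  · intro a _ b _ hab
    rw [Function.onFun, Finset.disjoint_left]
    intro x hx hx'
    exact hab ((Nat.mem_finMulAntidiag.1 hx).1.symm.trans (Nat.mem_finMulAntidiag.1 hx').1)

end GC
end

section
open Polynomial UniqueFactorizationMonoid

namespace GC

/-- some squarefree modulus at which `f` is far from squarefree -/
def SieveBad (d c N : ℕ) (f : ℤ[X]) : Prop :=
  ∃ n : ℕ, Squarefree n ∧ n ≤ N ∧ (∀ p ∈ n.primeFactors, rd p f < d) ∧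
    N ≤ c * ∏ p ∈ n.primeFactors, p ^ (d - 1 - rd p f)

theorem small_sieve {d : ℕ} (hd : 1 ≤ d) {c : ℕ} (hc : 1 ≤ c) : Small d (SieveBad d c) := by
  classical
  set K := d * 2 ^ (d * d) with hK
  refine ⟨c * 4 ^ d * 2 ^ K, by positivity, K, fun N hN => ?_⟩
  have hN0 : (0 : ℝ) < N := by positivity
  have hs : {p : ℤ[X] | p ∈ box d N ∧ SieveBad d c N p} = ((box d N).filter (SieveBad d c N) : Set ℤ[X]) := by
    ext p; simp
  rw [hs, Set.ncard_coe_finset]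
  have h1 : (((box d N).filter (SieveBad d c N)).card : ℝ) ≤ ∑ f ∈ box d N,
      ∑ n ∈ Finset.Icc 1 N with Squarefree n, c / N * ∏ p ∈ n.primeFactors, (wt d p (rd p f) : ℝ) := by
    rw [Finset.card_filter, Nat.cast_sum]
    refine Finset.sum_le_sum fun f _ => ?_
    split_ifs with hf
    · obtain ⟨n, hn, hnN, hr, hb⟩ := hf
      have hmem : n ∈ (Finset.Icc 1 N).filter Squarefree :=
        Finset.mem_filter.2 ⟨Finset.mem_Icc.2 ⟨Nat.one_le_iff_ne_zero.2 hn.ne_zero, hnN⟩, hn⟩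
      refine le_trans ?_ (Finset.single_le_sum (fun n _ => by positivity) hmem)
      have h2 : ∏ p ∈ n.primeFactors, (wt d p (rd p f) : ℝ) = ((∏ p ∈ n.primeFactors, p ^ (d - 1 - rd p f) : ℕ) : ℝ) := by
        rw [Nat.cast_prod]
        refine Finset.prod_congr rfl fun p hp => ?_
        rw [wt, if_pos (hr p hp)]
      rw [h2, Nat.cast_one, div_mul_eq_mul_div, one_le_div hN0]
      exact_mod_cast hb
    · rw [Nat.cast_zero]
      exact Finset.sum_nonneg fun n _ => by positivity
  refine h1.trans ?_
  rw [Finset.sum_comm]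
  have h3 : ∀ n ∈ (Finset.Icc 1 N).filter Squarefree,
      ∑ f ∈ box d N, (c : ℝ) / N * ∏ p ∈ n.primeFactors, (wt d p (rd p f) : ℝ) ≤
      c * 4 ^ d * N ^ (d - 1) * ((K : ℝ) ^ n.primeFactors.card / n) := by
    intro n hn
    obtain ⟨hn1, hsq⟩ := Finset.mem_filter.1 hn
    obtain ⟨hn1, hnN⟩ := Finset.mem_Icc.1 hn1
    have hn0 : (0 : ℝ) < n := by exact_mod_cast hn1
    rw [← Finset.mul_sum]
    refine (mul_le_mul_of_nonneg_left (sum_wt_box (by omega) hsq hnN) (by positivity)).trans (le_of_eq ?_)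
    have h4 : ∏ p ∈ n.primeFactors, ((d * 2 ^ (d * d) * p ^ (d - 1) : ℕ) : ℝ) = (K : ℝ) ^ n.primeFactors.card * n ^ (d - 1) := by
      rw [← Nat.cast_prod, Finset.prod_mul_distrib, Finset.prod_const, Finset.prod_pow,
        Nat.prod_primeFactors_of_squarefree hsq, ← hK, Nat.cast_mul, Nat.cast_pow, Nat.cast_pow]
    rw [h4]
    obtain ⟨e, rfl⟩ : ∃ e, d = e + 1 := ⟨d - 1, by omega⟩
    rw [Nat.add_sub_cancel, div_pow, mul_pow]
    field_simp
    ring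
  refine (Finset.sum_le_sum h3).trans ?_
  rw [← Finset.mul_sum]
  have h5 := sum_K K N
  have h6 : (1 + Real.log N) ^ K ≤ 2 ^ K * ll N ^ K := by
    rw [← mul_pow]
    have := one_le_ll hN
    have h7 : ll N = 2 * Real.log N := rfl
    exact pow_le_pow_left₀ (by linarith) (by linarith) _
  calc _ ≤ c * 4 ^ d * N ^ (d - 1) * (2 ^ K * ll N ^ K) :=
        mul_le_mul_of_nonneg_left (h5.trans h6) (by positivity)
    _ = _ := by ring

lemma exists_sub_prod {N : ℕ} (hN1 : 1 ≤ N) (S : Finset ℕ) (hS : ∀ p ∈ S, 1 ≤ p ∧ p ≤ N) (h : N < ∏ p ∈ S, p) :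
    ∃ T ⊆ S, ∏ p ∈ T, p ≤ N ∧ N ≤ (∏ p ∈ T, p) ^ 2 := by
  classical
  induction S using Finset.induction_on with
  | empty => rw [Finset.prod_empty] at h; omega
  | insert a S ha ih =>
    by_cases h1 : N < ∏ p ∈ S, p
    · obtain ⟨T, hT, h2⟩ := ih (fun p hp => hS p (Finset.mem_insert_of_mem hp)) h1
      exact ⟨T, hT.trans (Finset.subset_insert _ _), h2⟩
    · rw [Finset.prod_insert ha] at h
      by_cases h2 : N ≤ a ^ 2
      · exact ⟨{a}, by simp, by simpa using (hS a (Finset.mem_insert_self _ _)).2, by simpa using h2⟩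
      · refine ⟨S, Finset.subset_insert _ _, not_lt.1 h1, ?_⟩
        by_contra h3
        push Not at h2 h3
        have h4 : (a * ∏ p ∈ S, p) ^ 2 < N ^ 2 := by
          rw [mul_pow, pow_two N]; exact Nat.mul_lt_mul'' h2 h3
        exact absurd (lt_of_pow_lt_pow_left₀ 2 (Nat.zero_le _) h4) (by omega)

lemma sieveBad_of {d c N : ℕ} (hc : 1 ≤ c) {f : ℤ[X]} (S : Finset ℕ) (hp : ∀ p ∈ S, p.Prime)
    (hN : ∀ p ∈ S, p ≤ N) (hr : ∀ p ∈ S, rd p f + 3 ≤ d)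
    (hb : N ^ 3 ≤ c * (∏ p ∈ S, p ^ (d - rd p f)) ^ 2) (hN1 : 1 ≤ N) : SieveBad d c N f := by
  have key : ∃ T ⊆ S, ∏ p ∈ T, p ≤ N ∧ N ^ 3 ≤ c * (∏ p ∈ T, p ^ (d - rd p f)) ^ 2 := by
    by_cases h : N < ∏ p ∈ S, p
    · obtain ⟨T, hT, h1, h2⟩ := exists_sub_prod hN1 S (fun p hp' => ⟨(hp p hp').one_le, hN p hp'⟩) h
      refine ⟨T, hT, h1, ?_⟩
      calc N ^ 3 ≤ ((∏ p ∈ T, p) ^ 2) ^ 3 := Nat.pow_le_pow_left h2 3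
        _ = (∏ p ∈ T, p ^ 3) ^ 2 := by rw [Finset.prod_pow]; ring
        _ ≤ (∏ p ∈ T, p ^ (d - rd p f)) ^ 2 := by
          refine Nat.pow_le_pow_left (Finset.prod_le_prod' fun p hp' => ?_) 2
          exact Nat.pow_le_pow_right (hp p (hT hp')).pos (by have := hr p (hT hp'); omega)
        _ ≤ _ := Nat.le_mul_of_pos_left _ hc
    · exact ⟨S, le_rfl, not_lt.1 h, hb⟩
  obtain ⟨T, hT, h1, h2⟩ := key
  have hTp : ∀ p ∈ T, p.Prime := fun p h => hp p (hT h)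
  have hpf : (∏ p ∈ T, p).primeFactors = T := Nat.primeFactors_prod hTp
  refine ⟨∏ p ∈ T, p, ?_, h1, ?_, ?_⟩
  · refine Finset.squarefree_prod_of_pairwise_isCoprime (fun p hp q hq hpq => ?_)
      fun p hp => (hTp p hp).squarefree
    simp only [Function.onFun, ← Nat.coprime_iff_isRelPrime]
    exact (Nat.coprime_primes (hTp p hp) (hTp q hq)).mpr hpq
  · rw [hpf]; intro p hp'; have := hr p (hT hp'); omega
  · rw [hpf]
    refine le_of_pow_le_pow_left₀ (n := 3) (by norm_num) (Nat.zero_le _) ?_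
    refine h2.trans ?_
    rw [mul_pow]
    refine Nat.mul_le_mul (Nat.le_self_pow (by norm_num) c) ?_
    rw [← Finset.prod_pow, ← Finset.prod_pow]
    refine Finset.prod_le_prod' fun p hp' => ?_
    rw [← pow_mul, ← pow_mul]
    exact Nat.pow_le_pow_right (hTp p hp').pos (by have := hr p (hT hp'); omega)

end GC
end

section
open Polynomial UniqueFactorizationMonoid

namespace GC

/-- `Res_x(g', g + t)` for `g = x * mk w` -/
noncomputable def Phi {A : Type*} [CommRing A] {n : ℕ} (w : Fin n → A) : A[X] :=
  resultant ((derivative (X * mk w)).map C) ((X * mk w).map C + C X) n (n + 1)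

/-- discriminant of `Phi` -/
noncomputable def RR {A : Type*} [CommRing A] {n : ℕ} (w : Fin n → A) : A :=
  resultant (Phi w) (derivative (Phi w)) n (n - 1)

lemma mk_map {A B : Type*} [CommRing A] [CommRing B] (φ : A →+* B) {n : ℕ} (w : Fin n → A) :
    (mk w).map φ = mk (fun i => φ (w i)) := by
  simp [mk, Polynomial.map_sum]

lemma Phi_map {A B : Type*} [CommRing A] [CommRing B] (φ : A →+* B) {n : ℕ} (w : Fin n → A) :
    (Phi w).map φ = Phi (fun i => φ (w i)) := by
  rw [Phi, Phi, ← coe_mapRingHom, ← resultant_map_map, ← mk_map φ]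
  have h : (mapRingHom φ).comp C = C.comp φ := by ext; simp
  congr 1
  · rw [map_map, h, ← map_map, ← derivative_map, Polynomial.map_mul, map_X]
  · rw [Polynomial.map_add, map_map, h, ← map_map, Polynomial.map_mul, map_X, map_C, coe_mapRingHom, map_X]

lemma RR_map {A B : Type*} [CommRing A] [CommRing B] (φ : A →+* B) {n : ℕ} (w : Fin n → A) :
    φ (RR w) = RR (fun i => φ (w i)) := by
  rw [RR, RR, ← resultant_map_map, ← derivative_map, Phi_map]

section alg
variable {k : Type*} [Field k] {n : ℕ}

lemma g_natDegree (w : Fin n → k) : (X * mk w).natDegree = n + 1 := by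
  rw [natDegree_X_mul (mk_monic w).ne_zero, mk_natDegree]

lemma g'_coeff (w : Fin n → k) : (derivative (X * mk w)).coeff n = (n + 1 : k) := by
  rw [coeff_derivative, coeff_X_mul]
  have := (mk_monic w).coeff_natDegree
  rw [mk_natDegree] at this
  rw [this, one_mul]

lemma g'_natDegree (w : Fin n → k) (hn : (n + 1 : k) ≠ 0) : (derivative (X * mk w)).natDegree = n := by
  refine natDegree_eq_of_le_of_coeff_ne_zero ?_ (by rwa [g'_coeff])
  refine (natDegree_derivative_le _).trans ?_
  rw [g_natDegree]; rfl

lemma Phi_eq [IsAlgClosed k] (w : Fin n → k) (hn : (n + 1 : k) ≠ 0) :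
    Phi w = C ((n + 1 : k) ^ (n + 1)) *
      ((derivative (X * mk w)).roots.map fun b => X + C ((X * mk w).eval b)).prod := by
  set g := X * mk w with hg
  have hd := g'_natDegree w hn
  have hinj : Function.Injective (C : k →+* k[X]) := C_injective
  have hs : (derivative g).Splits := IsAlgClosed.splits _
  have h1 := resultant_eq_prod_eval ((derivative g).map C) (g.map C + C X) (n + 1) (by
    refine (natDegree_add_le _ _).trans (max_le ?_ (by simp))
    exact natDegree_map_le.trans (g_natDegree w).le) (hs.map C)
  rw [natDegree_map_eq_of_injective hinj, hd] at h1
  rw [Phi, h1, leadingCoeff_map_of_injective hinj, hs.roots_map_of_injective hinj, Multiset.map_map]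
  congr 1
  · rw [leadingCoeff, hd, g'_coeff, C_pow]
  · congr 1
    refine Multiset.map_congr rfl fun b _ => ?_
    simp [eval_map, add_comm]

lemma Phi_natDegree [IsAlgClosed k] (w : Fin n → k) (hn : (n + 1 : k) ≠ 0) :
    (Phi w).natDegree = n := by
  rw [Phi_eq w hn, natDegree_C_mul (pow_ne_zero _ hn), natDegree_multiset_prod_of_monic, Multiset.map_map]
  · simp only [Function.comp_def, natDegree_X_add_C, Multiset.map_const', Multiset.sum_replicate, smul_eq_mul, mul_one]
    rw [← (IsAlgClosed.splits (derivative (X * mk w))).natDegree_eq_card_roots, g'_natDegree w hn]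
  · intro f hf
    obtain ⟨b, -, rfl⟩ := Multiset.mem_map.1 hf
    exact monic_X_add_C _

lemma double_root [IsAlgClosed k] (w : Fin n → k) (hn : (n + 1 : k) ≠ 0) (a : k) (G : k[X])
    (hG : 2 ≤ G.natDegree) (h1 : G ∣ X * mk w + C a) (h2 : G ∣ derivative (X * mk w)) :
    (X - C a) ^ 2 ∣ Phi w := by
  rw [Phi_eq w hn]
  refine Dvd.dvd.mul_left ?_ _
  have h0 : derivative (X * mk w) ≠ 0 := fun h => hn (by rw [← g'_coeff w, h, coeff_zero])
  have h3 := Multiset.map_le_map (f := fun b => (X + C ((X * mk w).eval b) : k[X])) (Polynomial.roots.le_of_dvd h0 h2)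
  refine dvd_trans ?_ (Multiset.prod_dvd_prod_of_le h3)
  have h4 : G.roots.map (fun b => (X + C ((X * mk w).eval b) : k[X])) = G.roots.map (fun _ => X - C a) := by
    refine Multiset.map_congr rfl fun b hb => ?_
    have := (dvd_iff_isRoot.2 (isRoot_of_mem_roots hb)).trans h1
    rw [dvd_iff_isRoot, IsRoot.def, eval_add, eval_C] at this
    rw [eq_neg_of_add_eq_zero_left this, C_neg, sub_eq_add_neg]
  rw [h4, Multiset.map_const', Multiset.prod_replicate,
    ← (IsAlgClosed.splits G).natDegree_eq_card_roots]
  exact pow_dvd_pow _ hG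

lemma RR_eq_zero [IsAlgClosed k] (w : Fin n → k) (hn : (n + 1 : k) ≠ 0) (h0 : n ≠ 0) (a : k)
    (h : (X - C a) ^ 2 ∣ Phi w) : RR w = 0 := by
  have hd := Phi_natDegree w hn
  obtain ⟨p, q, -, -, e⟩ := exists_mul_add_mul_eq_C_resultant (m := n) (n := n - 1) (Phi w) (derivative (Phi w)) hd.le
    ((natDegree_derivative_le _).trans (by rw [hd])) (Or.inl h0)
  obtain ⟨c, hc⟩ := h
  have := congrArg (eval a) e
  have h1 : eval a (Phi w) = 0 := by rw [hc]; simp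
  have h2 : eval a (derivative (Phi w)) = 0 := by rw [hc]; simp [derivative_mul, derivative_pow]
  rw [eval_add, eval_mul, eval_mul, h1, h2, eval_C, zero_mul, zero_mul, add_zero] at this
  exact this.symm

end alg

lemma RR_ne_zero {n : ℕ} (hn : 2 ≤ n) : RR (fun i : Fin n => (MvPolynomial.X i : MvPolynomial (Fin n) ℤ)) ≠ 0 := by
  intro h
  set u : Fin n → ℂ := fun i => if (i : ℕ) = 0 then -(n + 1 : ℂ) else 0 with hu
  have h1 := congrArg (MvPolynomial.eval₂Hom (Int.castRingHom ℂ) u) h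
  rw [RR_map, map_zero] at h1
  simp only [MvPolynomial.coe_eval₂Hom, MvPolynomial.eval₂_X] at h1
  change RR u = 0 at h1
  have hn1 : (n + 1 : ℂ) ≠ 0 := by exact_mod_cast n.succ_ne_zero
  have hg : X * mk u = X ^ (n + 1) - C (n + 1 : ℂ) * X := by
    have : ∑ i : Fin n, C (u i) * X ^ (i : ℕ) = - C (n + 1 : ℂ) := by
      rw [Finset.sum_eq_single ⟨0, by omega⟩]
      · simp [hu]
      · intro b _ hb
        have : (b : ℕ) ≠ 0 := fun h => hb (Fin.ext h)
        simp [hu, this]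
      · simp
    rw [mk, this]; ring
  have hg' : derivative (X * mk u) = C (n + 1 : ℂ) * (X ^ n - 1) := by
    rw [hg]; simp; ring
  have hroots : (derivative (X * mk u)).roots = nthRoots n (1 : ℂ) := by
    rw [hg', roots_C_mul _ hn1, nthRoots, C_1]
  have hP := Phi_eq u hn1
  have hnd : (derivative (X * mk u)).roots.Nodup := by
    have : IsPrimitiveRoot (Complex.exp (2 * Real.pi * Complex.I / n)) n := Complex.isPrimitiveRoot_exp n (by omega)
    rw [hroots]; exact this.nthRoots_one_nodup
  have hinj : ∀ b ∈ (derivative (X * mk u)).roots, (X * mk u).eval b = - (n : ℂ) * b := by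
    intro b hb
    rw [hroots, mem_nthRoots (by omega)] at hb
    rw [hg]; simp [pow_succ, hb]; ring
  have hsep : (Phi u).Separable := by
    rw [hP]
    refine (Associated.separable (f := (((derivative (X * mk u)).roots.map fun b => X + C ((X * mk u).eval b)).prod)) ?_ ?_)
    · exact (associated_unit_mul_left _ _ (isUnit_C.2 (pow_ne_zero _ hn1).isUnit)).symm
    · have : (derivative (X * mk u)).roots.map (fun b => X + C ((X * mk u).eval b))
          = ((derivative (X * mk u)).roots.map (fun b => (n : ℂ) * b)).map (fun a => X - C a) := by
        rw [Multiset.map_map]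
        refine Multiset.map_congr rfl fun b hb => ?_
        simp [hinj b hb, sub_eq_add_neg]
      rw [this, ← nodup_roots_iff_of_splits (monic_multiset_prod_of_monic _ _ fun a _ => monic_X_sub_C a).ne_zero
        (IsAlgClosed.splits _), roots_multiset_prod_X_sub_C]
      exact hnd.map (mul_right_injective₀ (by norm_cast; omega))
  have hd := Phi_natDegree u hn1
  have hd' : (derivative (Phi u)).natDegree = n - 1 := by
    rw [natDegree_derivative, hd]
  have := resultant_ne_zero (Phi u) (derivative (Phi u)) hsep
  rw [hd, hd'] at this
  exact this h1

end GC
end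

section
open Polynomial UniqueFactorizationMonoid

namespace GC

/-- coefficients other than the constant one -/
def tl (n : ℕ) (f : ℤ[X]) : Fin n → ℤ := fun i => f.coeff (i + 1)

lemma eq_tl {n : ℕ} {f : ℤ[X]} (hf : f.Monic) (hd : f.natDegree = n + 1) :
    f = X * mk (tl n f) + C (f.coeff 0) := by
  conv_lhs => rw [← X_mul_divX_add f]
  congr 2
  have hdiv : f.divX.natDegree = n := by rw [natDegree_divX_eq_natDegree_tsub_one, hd]; rfl
  have hm : f.divX.Monic := by
    rw [Monic, leadingCoeff, hdiv, coeff_divX, ← hd]; exact hf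
  rw [eq_aux hm hdiv, mk]
  simp [tl, coeff_divX]

lemma big_prime {n : ℕ} (h0 : n ≠ 0) {f : ℤ[X]} (hf : f.Monic) (hd : f.natDegree = n + 1) (p : ℕ) [hp : Fact p.Prime]
    (hpn : n + 1 < p) (hr : rd p f + 2 ≤ n + 1) :
    (p : ℤ) ∣ RR (tl n f) ∧ (Phi fun i => (tl n f i : ZMod p)) ≠ 0 ∧ 
      (Phi fun i => (tl n f i : ZMod p)).natDegree ≤ n ∧ 
      (Phi fun i => (tl n f i : ZMod p)).eval (f.coeff 0 : ZMod p) = 0 := by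
  set k := AlgebraicClosure (ZMod p)
  have : CharP k p := charP_of_injective_algebraMap (algebraMap (ZMod p) k).injective p
  set φ := algebraMap (ZMod p) k with hφ
  set w : Fin n → k := fun i => φ (tl n f i : ZMod p) with hw
  set F := f.map (Int.castRingHom (ZMod p)) with hF
  set a := f.coeff 0 with ha
  have hn : (n + 1 : k) ≠ 0 := by
    have := (CharP.cast_eq_zero_iff k p (n + 1)).not.2 (fun h => absurd (Nat.le_of_dvd (by omega) h) (by omega))
    exact_mod_cast this
  have hFk : F.map φ = X * mk w + C (φ (a : ZMod p)) := by
    rw [hF, eq_tl hf hd, map_map]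
    simp [mk_map, hw, ← ha]
  have hdF : F.natDegree = n + 1 := by rw [hF, hf.natDegree_map, hd]
  have hF0 : F ≠ 0 := (hf.map _).ne_zero
  have hG := congrArg natDegree (EuclideanDomain.radical_mul_divRadical (a := F))
  rw [natDegree_mul radical_ne_zero (EuclideanDomain.divRadical_ne_zero hF0), hdF] at hG
  rw [rd_eq, rdeg, ← hF] at hr
  set G := EuclideanDomain.divRadical F
  have key : (X - C (φ (a : ZMod p))) ^ 2 ∣ Phi w := by
    refine double_root w hn _ (G.map φ) ?_ ?_ ?_
    · rw [natDegree_map]; omega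
    · rw [← hFk]; exact Polynomial.map_dvd φ (EuclideanDomain.divRadical_dvd_self F)
    · have h := Polynomial.map_dvd φ (divRadical_dvd_derivative F)
      rw [← derivative_map, hFk] at h
      simpa using h
  have hPm : (Phi fun i => (tl n f i : ZMod p)).map φ = Phi w := Phi_map φ _
  refine ⟨?_, ?_, ?_, ?_⟩
  · have h1 := RR_eq_zero w hn h0 _ key
    have h2 := RR_map (φ.comp (Int.castRingHom (ZMod p))) (tl n f)
    rw [show (fun i => (φ.comp (Int.castRingHom (ZMod p))) (tl n f i)) = w from rfl, h1] at h2
    rw [RingHom.comp_apply, map_eq_zero_iff _ φ.injective] at h2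
    exact (ZMod.intCast_zmod_eq_zero_iff_dvd _ p).1 h2
  · intro h
    have := Phi_natDegree w hn
    rw [← hPm, h, Polynomial.map_zero, natDegree_zero] at this
    exact h0 this.symm
  · rw [← natDegree_map φ, hPm, Phi_natDegree w hn]
  · apply φ.injective
    rw [map_zero, ← eval_map_apply, hPm]
    obtain ⟨c, hc⟩ := key
    rw [hc]; simp

lemma mv_bound {n : ℕ} (P : MvPolynomial (Fin n) ℤ) : ∃ C k : ℕ, ∀ N : ℕ, 1 ≤ N → ∀ w : Fin n → ℤ,
    (∀ i, |w i| ≤ N) → |MvPolynomial.eval w P| ≤ C * N ^ k := by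
  induction P using MvPolynomial.induction_on with
  | C a => exact ⟨a.natAbs, 0, fun N _ w _ => by simp⟩
  | add P Q hP hQ =>
    obtain ⟨C, k, h⟩ := hP
    obtain ⟨C', k', h'⟩ := hQ
    refine ⟨C + C', k + k', fun N hN w hw => ?_⟩
    rw [map_add]
    have h1 := h N hN w hw
    have h2 := h' N hN w hw
    have hN' : (1 : ℤ) ≤ N := by exact_mod_cast hN
    have h3 : (N : ℤ) ^ k ≤ (N : ℤ) ^ (k + k') := pow_le_pow_right₀ hN' (by omega)
    have h4 : (N : ℤ) ^ k' ≤ (N : ℤ) ^ (k + k') := pow_le_pow_right₀ hN' (by omega)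
    push_cast
    calc _ ≤ _ := abs_add_le _ _
      _ ≤ (C : ℤ) * N ^ (k + k') + C' * N ^ (k + k') := add_le_add (h1.trans (by gcongr)) (h2.trans (by gcongr))
      _ = _ := by ring
  | mul_X P i hP =>
    obtain ⟨C, k, h⟩ := hP
    refine ⟨C, k + 1, fun N hN w hw => ?_⟩
    rw [map_mul, MvPolynomial.eval_X, abs_mul, pow_succ, ← mul_assoc]
    exact mul_le_mul (h N hN w hw) (hw i) (abs_nonneg _) (by positivity)

lemma card_primes {R : ℤ} (hR : R ≠ 0) {N C k : ℕ} (hN : 2 ≤ N) (h : |R| ≤ C * N ^ k) :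
    (R.natAbs.primeFactors.filter fun p => N < p).card ≤ C + k := by
  set T := R.natAbs.primeFactors.filter fun p => N < p
  have h1 : N ^ T.card ≤ ∏ p ∈ T, p := by
    rw [← Finset.prod_const]
    exact Finset.prod_le_prod' fun p hp => (Finset.mem_filter.1 hp).2.le
  have h2 : ∏ p ∈ T, p ≤ R.natAbs := by
    refine Nat.le_of_dvd (Int.natAbs_pos.2 hR) (dvd_trans ?_ (Nat.prod_primeFactors_dvd _))
    exact Finset.prod_dvd_prod_of_subset _ _ _ (Finset.filter_subset _ _)
  have h3 : R.natAbs ≤ C * N ^ k := by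
    have : ((R.natAbs : ℕ) : ℤ) ≤ ((C * N ^ k : ℕ) : ℤ) := by rw [Int.natCast_natAbs]; push_cast; exact h
    exact_mod_cast this
  have h4 : C * N ^ k ≤ N ^ (C + k) := by
    rw [pow_add]
    exact Nat.mul_le_mul_right _ ((Nat.lt_two_pow_self).le.trans (Nat.pow_le_pow_left hN _))
  exact (Nat.pow_le_pow_iff_right (by omega)).1 (h1.trans (h2.trans (h3.trans h4)))

/-- the number of integers in `[-N, N]` that are roots mod `p` -/
lemma card_roots_mod {N p : ℕ} [hp : Fact p.Prime] (hpN : N < p) {Q : (ZMod p)[X]} (hQ : Q ≠ 0) :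
    ((Finset.Icc (-(N : ℤ)) N).filter fun a : ℤ => Q.eval (a : ZMod p) = 0).card ≤ 2 * Q.natDegree := by
  classical
  have h1 : ((Finset.Icc (-(N : ℤ)) N).filter fun a : ℤ => Q.eval (a : ZMod p) = 0).card ≤
      (Q.roots.toFinset ×ˢ (Finset.univ : Finset Bool)).card := by
    refine Finset.card_le_card_of_injOn (fun a => ((a : ZMod p), decide (0 ≤ a))) ?_ ?_
    · intro a ha
      have := (Finset.mem_filter.1 ha).2
      simp [hQ, this, le_or_gt]
    · intro a ha b hb hab
      obtain ⟨h1, h2⟩ := Prod.mk.inj hab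
      have ha' := Finset.mem_Icc.1 (Finset.mem_filter.1 ha).1
      have hb' := Finset.mem_Icc.1 (Finset.mem_filter.1 hb).1
      rw [decide_eq_decide] at h2
      have h3 := (ZMod.intCast_eq_intCast_iff_dvd_sub a b p).1 h1
      have h4 := Int.eq_zero_of_abs_lt_dvd h3 (by rw [abs_lt]; constructor <;> by_cases hh : 0 ≤ a <;> have := h2 <;> simp [hh] at this <;> omega)
      omega
  refine h1.trans ?_
  rw [Finset.card_product, Finset.card_univ, Fintype.card_bool, mul_comm]
  exact Nat.mul_le_mul_left _ ((Multiset.toFinset_card_le _).trans (card_roots' Q))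

end GC
end

section
open Polynomial UniqueFactorizationMonoid

namespace GC

/-- some prime larger than `N` at which `f` has index at least two -/
def BigBad (d N : ℕ) (f : ℤ[X]) : Prop := ∃ p : ℕ, p.Prime ∧ N < p ∧ d < p ∧ rd p f + 2 ≤ d

lemma fiber_le {n N B : ℕ} (w : Fin n → ℤ) (P : ℤ[X] → Prop) (T : Finset ℤ)
    (hT : ∀ f, f ∈ box (n + 1) N → tl n f = w → P f → f.coeff 0 ∈ T) (hB : T.card ≤ B) :
    (({f : ℤ[X] | f ∈ box (n + 1) N ∧ tl n f = w ∧ P f}.ncard : ℕ) : ℝ) ≤ B := by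
  have : {f : ℤ[X] | f ∈ box (n + 1) N ∧ tl n f = w ∧ P f}.ncard ≤ (T : Set ℤ).ncard := by
    refine Set.ncard_le_ncard_of_injOn (fun f => f.coeff 0) ?_ ?_ (Finset.finite_toSet T)
    · rintro f ⟨h1, h2, h3⟩; exact hT f h1 h2 h3
    · rintro f ⟨h1, h2, h3⟩ g ⟨h1', h2', h3'⟩ h
      obtain ⟨a1, a2, -⟩ := mem_box.1 h1
      obtain ⟨b1, b2, -⟩ := mem_box.1 h1'
      rw [eq_tl a1 a2, eq_tl b1 b2, h2, h2']
      exact congrArg (fun c => X * mk w + C c) h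
  rw [Set.ncard_coe_finset] at this
  exact_mod_cast this.trans hB

theorem small_big {d : ℕ} (hd : 3 ≤ d) : Small d (BigBad d) := by
  classical
  obtain ⟨n, rfl⟩ : ∃ n, d = n + 1 := ⟨d - 1, by omega⟩
  set P := RR (fun i : Fin n => (MvPolynomial.X i : MvPolynomial (Fin n) ℤ)) with hP
  have hP0 : P ≠ 0 := RR_ne_zero (by omega)
  have hev : ∀ w : Fin n → ℤ, MvPolynomial.eval w P = RR w := fun w => by
    rw [hP, RR_map]; simp
  obtain ⟨C₀, k, hCk⟩ := mv_bound P
  set D := P.totalDegree with hD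
  set K := (C₀ + k) * (2 * n) with hK
  refine ⟨(D + K + 1) * 3 ^ n, by positivity, 0, fun N hN => ?_⟩
  set I := Finset.Icc (-(N : ℤ)) N with hI
  have hIc : I.card = 2 * N + 1 := by rw [hI, Int.card_Icc]; omega
  set W := Fintype.piFinset (fun _ : Fin n => I) with hW
  have hWc : W.card = (2 * N + 1) ^ n := by rw [hW, Fintype.card_piFinset_const, hIc]
  set Z := W.filter fun w => MvPolynomial.eval w P = 0 with hZ
  have hZc : (Z.card : ℝ) * (2 * N + 1) ≤ D * (2 * N + 1) ^ n := by
    have h := MvPolynomial.schwartz_zippel_totalDegree hP0 I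
    rw [← hW, ← hZ, hIc, div_le_div_iff₀ (by positivity) (by positivity)] at h
    exact_mod_cast h
  have htl : ∀ f, f ∈ box (n + 1) N → tl n f ∈ W := fun f hf => by
    obtain ⟨-, -, h3⟩ := mem_box.1 hf
    refine Fintype.mem_piFinset.2 fun i => ?_
    rw [hI, Finset.mem_Icc, ← abs_le]; exact h3 _ (by omega)
  have h0 : ∀ f, f ∈ box (n + 1) N → f.coeff 0 ∈ I := fun f hf => by
    obtain ⟨-, -, h3⟩ := mem_box.1 hf
    rw [hI, Finset.mem_Icc, ← abs_le]; exact h3 _ (by omega)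
  -- first part
  have hA : (({f : ℤ[X] | f ∈ box (n + 1) N ∧ RR (tl n f) = 0}.ncard : ℕ) : ℝ) ≤ Z.card * ((2 * N + 1 : ℕ) : ℝ) := by
    refine ncard_le_of_cover (s := Z) (fun w => {f : ℤ[X] | f ∈ box (n + 1) N ∧ tl n f = w ∧ True}) ?_ ?_ ?_
    · intro w _; exact fin_box _
    · rintro f ⟨hf, h⟩
      exact ⟨tl n f, Finset.mem_filter.2 ⟨htl f hf, by rw [hev, h]⟩, hf, rfl, trivial⟩
    · intro w _
      exact fiber_le w _ I (fun f hf _ _ => h0 f hf) hIc.le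
  have hB : (({f : ℤ[X] | f ∈ box (n + 1) N ∧ RR (tl n f) ≠ 0 ∧ BigBad (n + 1) N f}.ncard : ℕ) : ℝ) ≤ W.card * (K : ℝ) := by
    refine ncard_le_of_cover (s := W) (fun w => {f : ℤ[X] | f ∈ box (n + 1) N ∧ tl n f = w ∧
      (RR (tl n f) ≠ 0 ∧ BigBad (n + 1) N f)}) ?_ ?_ ?_
    · intro w _; exact fin_box _
    · rintro f ⟨hf, h⟩
      exact ⟨tl n f, htl f hf, hf, rfl, h⟩
    · intro w hw
      by_cases hR : RR w = 0
      · refine fiber_le w _ ∅ (fun f hf h1 h2 => absurd (h1 ▸ hR) h2.1) (by simp)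
      set S := ((RR w).natAbs.primeFactors.filter fun p => N < p) with hS
      have hSc : S.card ≤ C₀ + k := card_primes hR hN (by
        rw [← hev]
        refine hCk N (by omega) w fun i => ?_
        have := Fintype.mem_piFinset.1 hw i
        rwa [hI, Finset.mem_Icc, ← abs_le] at this)
      set Q : (p : ℕ) → (ZMod p)[X] := fun p => Phi (fun i => (w i : ZMod p)) with hQ
      refine fiber_le w _ (S.biUnion fun p => if Q p ≠ 0 ∧ (Q p).natDegree ≤ n then
        I.filter fun a : ℤ => (Q p).eval (a : ZMod p) = 0 else ∅) ?_ ?_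
      · rintro f hf h1 ⟨h2, p, hp, hpN, hpd, hr⟩
        obtain ⟨a1, a2, -⟩ := mem_box.1 hf
        have : Fact p.Prime := ⟨hp⟩
        obtain ⟨b1, b2, b3, b4⟩ := big_prime (by omega) a1 a2 p hpd hr
        rw [h1] at b1 b2 b3 b4
        refine Finset.mem_biUnion.2 ⟨p, Finset.mem_filter.2 ⟨Nat.mem_primeFactors.2 ⟨hp, ?_, ?_⟩, hpN⟩, ?_⟩
        · exact Int.natCast_dvd.1 b1
        · exact Int.natAbs_ne_zero.2 hR
        · rw [if_pos ⟨b2, b3⟩]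
          exact Finset.mem_filter.2 ⟨h0 f hf, b4⟩
      · refine (Finset.card_biUnion_le_card_mul _ _ (2 * n) fun p hp => ?_).trans (Nat.mul_le_mul_right _ hSc)
        split_ifs with h
        · have : Fact p.Prime := ⟨(Nat.mem_primeFactors.1 (Finset.mem_filter.1 hp).1).1⟩
          refine (card_roots_mod (Finset.mem_filter.1 hp).2 h.1).trans (Nat.mul_le_mul_left _ h.2)
        · simp
  have hU : {f : ℤ[X] | f ∈ box (n + 1) N ∧ BigBad (n + 1) N f} ⊆ {f : ℤ[X] | f ∈ box (n + 1) N ∧ RR (tl n f) = 0} ∪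
      {f : ℤ[X] | f ∈ box (n + 1) N ∧ RR (tl n f) ≠ 0 ∧ BigBad (n + 1) N f} := by
    rintro f ⟨h1, h2⟩
    by_cases h : RR (tl n f) = 0
    · exact Or.inl ⟨h1, h⟩
    · exact Or.inr ⟨h1, h, h2⟩
  have h1 := (Set.ncard_le_ncard hU ((fin_box _).union (fin_box _))).trans (Set.ncard_union_le _ _)
  have h2 : (({f : ℤ[X] | f ∈ box (n + 1) N ∧ BigBad (n + 1) N f}.ncard : ℕ) : ℝ) ≤
      D * (2 * N + 1) ^ n + (2 * N + 1) ^ n * K := by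
    rw [hWc] at hB
    push_cast at hA hB
    calc _ ≤ (({f : ℤ[X] | f ∈ box (n + 1) N ∧ RR (tl n f) = 0}.ncard : ℕ) : ℝ) +
        (({f : ℤ[X] | f ∈ box (n + 1) N ∧ RR (tl n f) ≠ 0 ∧ BigBad (n + 1) N f}.ncard : ℕ) : ℝ) := by exact_mod_cast h1
      _ ≤ _ := add_le_add (hA.trans hZc) hB
  refine h2.trans ?_
  have h3 : ((2 * N + 1 : ℝ)) ^ n ≤ 3 ^ n * N ^ n := by
    rw [← mul_pow]
    have : (1 : ℝ) ≤ N := by exact_mod_cast (by omega : 1 ≤ N)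
    exact pow_le_pow_left₀ (by positivity) (by linarith) _
  rw [pow_zero, mul_one, Nat.add_sub_cancel]
  calc _ = (D + K : ℝ) * (2 * N + 1 : ℝ) ^ n := by ring
    _ ≤ (D + K + 1 : ℝ) * (3 ^ n * N ^ n) := mul_le_mul (by linarith) h3 (by positivity) (by positivity)
    _ = _ := by ring

end GC
end

section
open Polynomial Polynomial.Gal NumberField IntermediateField

namespace GC

lemma irr_q {f : ℤ[X]} (hf : f.Monic) (hi : Irreducible f) : Irreducible (f.map (Int.castRingHom ℚ)) :=
  (hf.irreducible_iff_irreducible_map_fraction_map (K := ℚ)).1 hi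

lemma atom_of_prim {f : ℤ[X]} (hd : 2 ≤ f.natDegree) (hf : f.Monic)
    (hp : ¬ Imprim f) {L : Type} [Field L] [NumberField L] {α : L}
    (hα : minpoly ℚ α = f.map (Int.castRingHom ℚ)) : IsAtom ℚ⟮α⟯ := by
  refine ⟨fun h => ?_, fun F hF => ?_⟩
  · have h1 := IntermediateField.adjoin.finrank (Algebra.IsIntegral.isIntegral (R := ℚ) α)
    rw [hα, h, IntermediateField.finrank_bot, hf.natDegree_map] at h1
    omega
  · by_contra hb
    exact hp ⟨L, inferInstance, inferInstance, α, F, hα, hb, hF⟩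

lemma field_data0 {f : ℤ[X]} (hf : f.Monic) (hp : ¬ Imprim f) {K : Type} [Field K]
    [A : Algebra ℚ K] [NumberField K] (β : K) (htop : ℚ⟮β⟯ = ⊤)
    (hβ : minpoly ℚ β = f.map (Int.castRingHom ℚ)) : ∃ a : 𝓞 K,
      @IntermediateField.adjoin ℚ _ K _ (DivisionRing.toRatAlgebra) {(a : K)} = ⊤ ∧
      (∀ F : @IntermediateField ℚ K _ _ (DivisionRing.toRatAlgebra), F = ⊥ ∨ F = ⊤) ∧ minpoly ℤ a = f ∧
      @Module.finrank ℚ K _ _ (DivisionRing.toRatAlgebra).toModule = f.natDegree := by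
  obtain rfl : A = DivisionRing.toRatAlgebra := Subsingleton.elim _ _
  have hdeg : Module.finrank ℚ K = f.natDegree := by
    rw [← hf.natDegree_map (Int.castRingHom ℚ), ← hβ,
      ← IntermediateField.adjoin.finrank (Algebra.IsIntegral.isIntegral (R := ℚ) β), htop,
      IntermediateField.finrank_top']
  have hint : IsIntegral ℤ β := by
    refine ⟨f, hf, ?_⟩
    have := minpoly.aeval ℚ β
    rw [hβ, show Int.castRingHom ℚ = algebraMap ℤ ℚ from rfl, aeval_map_algebraMap] at this
    exact this
  refine ⟨⟨β, hint⟩, htop, fun F => ?_, ?_, hdeg⟩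
  · by_contra hF
    rw [not_or] at hF
    exact hp ⟨K, inferInstance, inferInstance, β, F, hβ, hF.1, by rw [htop]; exact lt_top_iff_ne_top.2 hF.2⟩
  · have h1 := (minpoly_prod (γ := ⟨β, hint⟩) hdeg htop).1
    have h2 : minpoly ℚ β = _ := h1
    rw [hβ] at h2
    exact (map_injective _ Int.cast_injective h2).symm

/-- the field generated by a root -/
lemma field_data {f : ℤ[X]} (hf : f.Monic)
    (hp : ¬ Imprim f) {L : Type} [Field L] [NumberField L] {α : L}
    (hα : minpoly ℚ α = f.map (Int.castRingHom ℚ)) : ∃ a : 𝓞 ℚ⟮α⟯,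
      @IntermediateField.adjoin ℚ _ ℚ⟮α⟯ _ (DivisionRing.toRatAlgebra) {(a : ℚ⟮α⟯)} = ⊤ ∧
      (∀ F : @IntermediateField ℚ ℚ⟮α⟯ _ _ (DivisionRing.toRatAlgebra), F = ⊥ ∨ F = ⊤) ∧ minpoly ℤ a = f ∧
      @Module.finrank ℚ ℚ⟮α⟯ _ _ (DivisionRing.toRatAlgebra).toModule = f.natDegree := by
  have hg := IntermediateField.minpoly_gen ℚ α
  refine field_data0 (A := ℚ⟮α⟯.algebra') hf hp (AdjoinSimple.gen ℚ α) ?_ (hg.trans hα)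
  apply IntermediateField.lift_injective
  rw [IntermediateField.lift_adjoin_simple, IntermediateField.lift_top, AdjoinSimple.coe_gen]

lemma preprim {k E : Type*} [Field k] [Field E] [Algebra k E] {q : k[X]} (hq : Irreducible q)
    (hsep : q.Separable) [Fact ((q.map (algebraMap k E)).Splits)]
    (x : q.rootSet E) [Nontrivial (q.rootSet E)]
    (hat : IsAtom k⟮(((rootsEquivRoots q E).symm x : q.rootSet q.SplittingField) : q.SplittingField)⟯) :
    MulAction.IsPreprimitive (galActionHom q E).range (q.rootSet E) := by
  have hT := galAction_isPretransitive (p := q) (E := E) hq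
  have hG : IsGalois k q.SplittingField := IsGalois.of_separable_splitting_field hsep
  have hst : MulAction.stabilizer q.Gal x =
      IntermediateField.fixingSubgroup k⟮(((rootsEquivRoots q E).symm x : q.rootSet q.SplittingField) : q.SplittingField)⟯ := by
    ext g
    rw [MulAction.mem_stabilizer_iff, Gal.smul_def, ← Equiv.eq_symm_apply, Subtype.ext_iff]
    refine Iff.trans ?_ (IntermediateField.mem_fixingSubgroup_iff
      k⟮(((rootsEquivRoots q E).symm x : q.rootSet q.SplittingField) : q.SplittingField)⟯
      (g : Gal(q.SplittingField/k))).symm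
    constructor
    · intro h
      refine (IntermediateField.forall_mem_adjoin_smul_eq_self_iff (M := Gal(q.SplittingField/k)) k g).2 ?_
      intro y hy
      obtain rfl := hy
      exact h
    · intro h
      exact h _ (mem_adjoin_simple_self k _)
  have hco : IsCoatom (MulAction.stabilizer q.Gal x) := by
    rw [hst]
    have := (IsGalois.intermediateFieldEquivSubgroup (F := k) (E := q.SplittingField)).isAtom_iff
      k⟮(((rootsEquivRoots q E).symm x : q.rootSet q.SplittingField) : q.SplittingField)⟯
    exact this.2 hat
  have hpp : MulAction.IsPreprimitive q.Gal (q.rootSet E) :=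
    (MulAction.isCoatom_stabilizer_iff_preprimitive _ x).1 hco
  let F : q.rootSet E →ₑ[(galActionHom q E).rangeRestrict] q.rootSet E := ⟨id, fun g x => rfl⟩
  exact MulAction.IsPreprimitive.of_surjective (f := F) Function.surjective_id

lemma atom_of_prim' {f : ℤ[X]} (hd : 2 ≤ f.natDegree) (hf : f.Monic)
    (hp : ¬ Imprim f) {L : Type} [Field L] [A : Algebra ℚ L] [NumberField L] {α : L}
    (hα : minpoly ℚ α = f.map (Int.castRingHom ℚ)) : IsAtom ℚ⟮α⟯ := by
  obtain rfl : A = DivisionRing.toRatAlgebra := Subsingleton.elim _ _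
  exact atom_of_prim hd hf hp hα

def Good (d : ℕ) (f : ℤ[X]) : Prop :=
  ∃ (K : Type) (_ : Field K) (_ : NumberField K) (a : 𝓞 K), ℚ⟮(a : K)⟯ = ⊤ ∧
    (∀ F : IntermediateField ℚ K, F = ⊥ ∨ F = ⊤) ∧ minpoly ℤ a = f ∧ Module.finrank ℚ K = d ∧
    ∀ p : ℕ, p.Prime → (p : ℤ) ∣ discr K → rd p f + 3 ≤ d

open Classical in
lemma core {d : ℕ} {f : ℤ[X]} (hd : f.natDegree = d) (hf : f.Monic) (hp : ¬ Imprim f) {L : Type} [Field L]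
    [A : Algebra ℚ L] [NumberField L] [hG : IsGalois ℚ L] (α : L)
    (hα : minpoly ℚ α = f.map (Int.castRingHom ℚ)) (R : Finset L)
    (hR : f.map (algebraMap ℤ L) = ∏ r ∈ R, (X - C r))
    (h5 : ∀ g : Gal(L/ℚ), g ≠ 1 → 5 ≤ (R.filter fun r => g r ≠ r).card) : Good d f := by
  obtain rfl : A = DivisionRing.toRatAlgebra := Subsingleton.elim _ _
  obtain ⟨a, h1, h2, h3, h4⟩ := field_data hf hp hα
  refine ⟨ℚ⟮α⟯, inferInstance, inferInstance, a, h1, h2, h3, h4.trans hd, fun p hpp hpd => ?_⟩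
  have hdL := hpd.trans (discr_dvd_discr ℚ⟮α⟯ L)
  have hRint : ∀ r ∈ R, IsIntegral ℤ r := fun r hr => by
    refine ⟨f, hf, ?_⟩
    rw [← eval_map, hR, eval_prod]
    exact Finset.prod_eq_zero hr (by simp)
  have hinj : Function.Injective (algebraMap (𝓞 L) L) := RingOfIntegers.coe_injective
  let S : Finset (𝓞 L) := R.preimage (algebraMap (𝓞 L) L) hinj.injOn
  have hS : S.map ⟨_, hinj⟩ = R := by
    ext r
    simp only [S, Finset.mem_map, Finset.mem_preimage, Function.Embedding.coeFn_mk]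
    constructor
    · rintro ⟨y, hy, rfl⟩; exact hy
    · intro hr; exact ⟨⟨r, hRint r hr⟩, hr, rfl⟩
  have hc : R.card = d := by
    have := congrArg natDegree hR
    rw [hf.natDegree_map, natDegree_prod_of_monic _ _ (fun r _ => monic_X_sub_C r)] at this
    simpa [hd] using this.symm
  have key := rd_add_three_le hpp hdL (f := f) S ?_ ?_
  · rwa [← Finset.card_map ⟨_, hinj⟩, hS, hc] at key
  · apply map_injective _ hinj
    rw [Polynomial.map_map, ← IsScalarTower.algebraMap_eq, hR, ← hS, Finset.prod_map,
      Polynomial.map_prod]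
    simp
  · intro g hg
    refine (h5 g hg).trans (le_of_eq ?_)
    rw [← hS, Finset.filter_map, Finset.card_map]
    congr 1
    apply Finset.filter_congr
    intro r _
    simp only [Function.comp, Function.Embedding.coeFn_mk]
    rw [not_iff_not, ← hinj.eq_iff]
    rfl

end GC
end

section
open Polynomial Polynomial.Gal NumberField IntermediateField

attribute [local instance] Polynomial.Gal.splits_ℚ_ℂ

open scoped Classical

namespace GC

lemma numberField_of {L : Type} [Field L] [A : Algebra ℚ L] [h : FiniteDimensional ℚ L] : NumberField L := by
  have : CharZero L := charZero_of_injective_algebraMap (algebraMap ℚ L).injective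
  obtain rfl : A = DivisionRing.toRatAlgebra := Subsingleton.elim _ _
  exact @NumberField.mk _ _ _ h

lemma gal_data {k E : Type} [Field k] [Field E] [Algebra k E] {q : k[X]} (hq : Irreducible q)
    (hsep : q.Separable) (hqm : q.Monic) [hF : Fact ((q.map (algebraMap k E)).Splits)]
    (hd : 12 ≤ q.natDegree)
    (hat : ∀ (L : Type) [Field L] [Algebra k L] [FiniteDimensional k L] (α : L), minpoly k α = q → IsAtom k⟮α⟯)
    (hA : ¬ alternatingGroup (q.rootSet E) ≤ (galActionHom q E).range) :
    ∃ (L : Type) (_ : Field L) (_ : Algebra k L) (_ : FiniteDimensional k L) (_ : IsGalois k L)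
      (α : L) (R : Finset L), minpoly k α = q ∧ q.map (algebraMap k L) = ∏ r ∈ R, (X - C r) ∧
      ∀ g : Gal(L/k), g ≠ 1 → 5 ≤ (R.filter fun r => g r ≠ r).card := by
  have hcard : Fintype.card (q.rootSet E) = q.natDegree := by
    convert card_rootSet_eq_natDegree hsep hF.out
  have hnt : Nontrivial (q.rootSet E) := Fintype.one_lt_card_iff_nontrivial.1 (by omega)
  obtain ⟨x, -⟩ := exists_pair_ne (q.rootSet E)
  have hmin : minpoly k ((rootsEquivRoots q E).symm x : q.rootSet q.SplittingField).1 = q := by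
    have := minpoly.eq_of_irreducible hq (mem_rootSet.mp ((rootsEquivRoots q E).symm x).2).2
    rw [hqm.leadingCoeff] at this
    simpa using this.symm
  have hpre := preprim hq hsep x (hat _ _ hmin)
  have hG : IsGalois k q.SplittingField := IsGalois.of_separable_splitting_field hsep
  have hsplit : (q.map (algebraMap k q.SplittingField)).Splits := SplittingField.splits q
  refine ⟨q.SplittingField, inferInstance, inferInstance, inferInstance, hG, _,
    (q.aroots q.SplittingField).toFinset, hmin, ?_, ?_⟩
  · have h1 := hsplit.eq_prod_roots_of_monic (hqm.map _)
    have h2 : (q.aroots q.SplittingField).Nodup := nodup_aroots_iff_of_splits hqm.ne_zero hsplit |>.2 hsep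
    rw [Finset.prod, Multiset.toFinset_val, h2.dedup]
    exact h1
  · intro g hg
    have hg' : galActionHom q E g ≠ 1 := fun h => hg (galActionHom_injective q E (h.trans (map_one _).symm))
    have := GT.five_le_support hpre (by omega) hA ⟨g, rfl⟩ hg'
    refine this.trans (Finset.card_le_card_of_injOn
      (fun y => ((rootsEquivRoots q E).symm y : q.rootSet q.SplittingField).1) ?_ ?_)
    · intro y hy
      rw [Finset.mem_coe, Equiv.Perm.mem_support] at hy
      rw [Finset.mem_coe, Finset.mem_filter]
      refine ⟨?_, fun h => hy ?_⟩
      · have := ((rootsEquivRoots q E).symm y).2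
        rw [mem_rootSet] at this
        rw [Multiset.mem_toFinset, mem_aroots]
        exact this
      · change (show q.Gal from g) • y = y
        rw [Gal.smul_def, ← Equiv.eq_symm_apply, Subtype.ext_iff]
        exact h
    · intro y _ z _ h
      exact (rootsEquivRoots q E).symm.injective (Subtype.ext h)

lemma good_of_bad {d : ℕ} (hd : 12 ≤ d) {f : ℤ[X]} (hf : f.Monic) (hfd : f.natDegree = d)
    (hi : Irreducible f) (hp : ¬ Imprim f)
    (hbad : ¬ (Fintype.card ((f.map (Int.castRingHom ℚ)).rootSet ℂ) = d ∧
      alternatingGroup ((f.map (Int.castRingHom ℚ)).rootSet ℂ) ≤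
        (galActionHom (f.map (Int.castRingHom ℚ)) ℂ).range)) : Good d f := by
  have hq := irr_q hf hi
  have hqd : (f.map (Int.castRingHom ℚ)).natDegree = d := by rw [hf.natDegree_map, hfd]
  have hcard : Fintype.card ((f.map (Int.castRingHom ℚ)).rootSet ℂ) = d := by
    rw [← hqd]
    convert card_rootSet_eq_natDegree hq.separable (IsAlgClosed.splits (k := ℂ) _)
  obtain ⟨L, _, _, _, _, α, R, h1, h2, h3⟩ := gal_data hq hq.separable (hf.map _) (by omega)
    (fun L _ A _ α h => @atom_of_prim' f (by omega) hf hp L _ A numberField_of α h)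
    (fun h => hbad ⟨hcard, h⟩)
  have := numberField_of (L := L)
  refine core hfd hf hp α h1 R ?_ h3
  rw [← h2, Polynomial.map_map]
  congr 1
  exact RingHom.ext_int _ _

end GC
end

section
open Polynomial Polynomial.Gal NumberField IntermediateField

attribute [local instance] Polynomial.Gal.splits_ℚ_ℂ

open scoped Classical

namespace GC

lemma good_cases {d N : ℕ} (hN : 2 ≤ N) {f : ℤ[X]} (h : Good d f) :
    SmallDisc 1 N f ∨ BigBad d N f ∨ SieveBad d (((d + 1) ^ (d * d * (d + 1))) ^ 2) N f := by
  obtain ⟨K, _, _, a, h1, h2, h3, h4, h5⟩ := h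
  by_cases hD : (discr K) ^ 2 ≤ (1 : ℕ) * (N : ℤ) ^ 3
  · exact Or.inl ⟨K, _, ‹_›, a, h1, h2, h3, hD⟩
  right
  have h6 := discr_le h4 h1
  rw [h3] at h6
  have hS : ∀ p ∈ (discr K).natAbs.primeFactors.filter (fun p => d < p),
      p.Prime ∧ d < p ∧ rd p f + 3 ≤ d := by
    intro p hp
    rw [Finset.mem_filter, Nat.mem_primeFactors] at hp
    exact ⟨hp.1.1, hp.2, h5 p hp.1.1 (Int.natCast_dvd.2 hp.1.2.1)⟩
  by_cases hB : ∀ p ∈ (discr K).natAbs.primeFactors.filter (fun p => d < p), p ≤ N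
  · right
    refine sieveBad_of (Nat.succ_le_of_lt (by positivity)) _ (fun p hp => (hS p hp).1) hB (fun p hp => (hS p hp).2.2) ?_ (by omega)
    rw [← mul_pow]
    refine le_trans ?_ (Nat.pow_le_pow_left h6 2)
    push Not at hD
    zify
    rw [sq_abs]
    simpa using hD.le
  · left
    push Not at hB
    obtain ⟨p, hp, hpN⟩ := hB
    exact ⟨p, (hS p hp).1, hpN, (hS p hp).2.1, by have := (hS p hp).2.2; omega⟩

theorem final (d : ℕ) (hd : 12 ≤ d) : Small d (fun _ p =>
    ¬ (Fintype.card ((p.map (Int.castRingHom ℚ)).rootSet ℂ) = d ∧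
              alternatingGroup ((p.map (Int.castRingHom ℚ)).rootSet ℂ) ≤
                (galActionHom (p.map (Int.castRingHom ℚ)) ℂ).range)) := by
  have hc : 1 ≤ ((d + 1) ^ (d * d * (d + 1))) ^ 2 := Nat.succ_le_of_lt (by positivity)
  refine ((small_red d).or ((small_imprim d).or ((small_disc (by omega) le_rfl).or
    ((small_big (by omega)).or (small_sieve (by omega) hc))))).mono ?_
  intro N hN p hp hbad
  obtain ⟨hm, hpd, -⟩ := mem_box.1 hp
  by_cases hi : Irreducible p
  · by_cases hI : Imprim p
    · exact Or.inr (Or.inl hI)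
    · exact Or.inr (Or.inr (good_cases hN (good_of_bad hd hm hpd hi hI hbad)))
  · refine Or.inl ⟨hi, ?_⟩
    rintro rfl
    simp at hpd
    omega

end GC
end

open Polynomial Polynomial.Gal

attribute [local instance] Polynomial.Gal.splits_ℚ_ℂ

open scoped Classical

/-- For `d ≥ 12`, the number of monic integer polynomials of degree `d` with coefficients
bounded by `N` whose Galois group is neither `S_d` nor `A_d` (i.e. does not contain the
alternating group on the `d` distinct complex roots) is `O(N ^ (d-1) * (log N) ^ Ω)`. -/
theorem galois_group_large_count (d : ℕ) (hd : 12 ≤ d) :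
    ∃ C : ℝ, 0 < C ∧ ∃ Ω : ℕ, 0 < Ω ∧
      ∀ N : ℕ, 2 ≤ N →
        (Set.ncard {p : Polynomial ℤ |
            p.Monic ∧ p.natDegree = d ∧
            (∀ i < d, |p.coeff i| ≤ (N : ℤ)) ∧
            ¬ (Fintype.card ((p.map (Int.castRingHom ℚ)).rootSet ℂ) = d ∧
              alternatingGroup ((p.map (Int.castRingHom ℚ)).rootSet ℂ) ≤
                (galActionHom (p.map (Int.castRingHom ℚ)) ℂ).range)} : ℝ) ≤
          C * (N : ℝ) ^ (d - 1) * Real.log N ^ Ω := by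
  obtain ⟨C, hC, Ω, h⟩ := GC.final d hd
  refine ⟨C * 2 ^ (Ω + 1), by positivity, Ω + 1, Nat.succ_pos _, fun N hN => ?_⟩
  have h1 := GC.one_le_ll hN
  have h2 : C * 2 ^ (Ω + 1) * (N : ℝ) ^ (d - 1) * Real.log N ^ (Ω + 1) =
      C * N ^ (d - 1) * GC.ll N ^ (Ω + 1) := by
    rw [GC.ll, mul_pow]; ring
  rw [h2]
  refine le_trans (le_of_eq ?_) ((h N hN).trans ?_)
  · congr 2
    ext p
    simp only [Set.mem_ofPred_eq, GC.mem_box, and_assoc]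
  · exact mul_le_mul_of_nonneg_left (pow_le_pow_right₀ h1 (Nat.le_succ _)) (by positivity)
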